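/- Mean square in the Dirichlet divisor problem (Tong, with Preissmann's error term): with C = (6π²)^{−1} Σ_{n=1}^∞ d(n)² n^{−3/2}, one has ∫_1^X Δ(x)² dx = C·X^{3/2} + O( X (log X)⁴ ) as X → ∞. -/

import Mathlib

open Real Filter Asymptotics

/-- The error term in the Dirichlet divisor problem. -/
noncomputable def dirichletDelta (x : ℝ) : ℝ :=
  (∑ n ∈ Finset.Icc 1 ⌊x⌋₊, (n.divisors.card : ℝ)) -
    x * (Real.log x + 2 * Real.eulerMascheroniConstant - 1)

namespace DivisorMeanSquare

/-- The number of divisors, as a real number. -/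
noncomputable def dR (n : ℕ) : ℝ := (n.divisors.card : ℝ)

lemma dR_nonneg (n : ℕ) : 0 ≤ dR n := by unfold dR; positivity

lemma one_le_dR {n : ℕ} (hn : n ≠ 0) : 1 ≤ dR n := by
  unfold dR
  exact_mod_cast Finset.card_pos.mpr ⟨1, by simp [hn]⟩

lemma dR_le_sq (n : ℕ) : dR n ≤ dR n ^ 2 := by
  rcases eq_or_ne n 0 with rfl | hn
  · simp [dR]
  · have := one_le_dR hn
    nlinarith

lemma sum_dR_sq_mul_le {w : ℕ → ℝ} (hw : ∀ n, 0 ≤ w n) (hmul : ∀ m n, w (m * n) = w m * w n)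
    (N : ℕ) :
    ∑ n ∈ Finset.Icc 1 N, dR n ^ 2 * w n ≤ (∑ n ∈ Finset.Icc 1 N, w n) ^ 4 := by
  set I := Finset.Icc 1 N
  let T : Finset (Σ _ : ℕ, ℕ × ℕ) := I.sigma fun n => n.divisors ×ˢ n.divisors
  let i : (Σ _ : ℕ, ℕ × ℕ) → (ℕ × ℕ) × (ℕ × ℕ) := fun t =>
    ((t.2.1.gcd t.2.2, t.2.1 / t.2.1.gcd t.2.2),
      (t.2.2 / t.2.1.gcd t.2.2, t.1 / t.2.1.lcm t.2.2))
  let F : (ℕ × ℕ) × (ℕ × ℕ) → ℝ := fun p => (w p.1.1 * w p.1.2) * (w p.2.1 * w p.2.2)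
  have key : ∀ t ∈ T, t.1 = (i t).1.1 * (i t).1.2 * ((i t).2.1 * (i t).2.2) ∧
      t.2.1 = (i t).1.1 * (i t).1.2 ∧ t.2.2 = (i t).1.1 * (i t).2.1 ∧ 1 ≤ t.1 ∧ t.1 ≤ N := by
    rintro ⟨n, a, b⟩ ht
    simp only [T, I, Finset.mem_sigma, Finset.mem_Icc, Finset.mem_product, Nat.mem_divisors] at ht
    obtain ⟨⟨h1, hN⟩, ⟨ha, hn⟩, ⟨hb, -⟩⟩ := ht
    have hl : a.lcm b ∣ n := Nat.lcm_dvd ha hb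
    have e1 : a.gcd b * (a / a.gcd b) = a := Nat.mul_div_cancel' (Nat.gcd_dvd_left a b)
    have e2 : a.gcd b * (b / a.gcd b) = b := Nat.mul_div_cancel' (Nat.gcd_dvd_right a b)
    have e3 : a.lcm b * (n / a.lcm b) = n := Nat.mul_div_cancel' hl
    have e4 : a * (b / a.gcd b) = a.lcm b := by
      rw [Nat.lcm, Nat.mul_div_assoc _ (Nat.gcd_dvd_right a b)]
    refine ⟨?_, e1.symm, e2.symm, h1, hN⟩
    simp only [i]
    rw [e1, ← mul_assoc, e4, e3]
  have hF : ∀ t ∈ T, w t.1 = F (i t) := by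
    intro t ht
    conv_lhs => rw [(key t ht).1]
    simp only [hmul, F]
  have hinj : Set.InjOn i T := by
    intro s hs t ht hst
    obtain ⟨s1, s2, s3, -⟩ := key s hs
    obtain ⟨t1, t2, t3, -⟩ := key t ht
    rw [hst] at s1 s2 s3
    obtain ⟨n, a, b⟩ := s
    obtain ⟨n', a', b'⟩ := t
    have h1 : n = n' := s1.trans t1.symm
    have h2 : a = a' := s2.trans t2.symm
    have h3 : b = b' := s3.trans t3.symm
    subst h1 h2 h3
    rfl
  have hmem : T.image i ⊆ (I ×ˢ I) ×ˢ (I ×ˢ I) := by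
    intro p hp
    obtain ⟨t, ht, rfl⟩ := Finset.mem_image.mp hp
    obtain ⟨h1, -, -, h4, h5⟩ := key t ht
    set p := i t
    have hne : p.1.1 * p.1.2 * (p.2.1 * p.2.2) ≠ 0 := by omega
    have h0 : (p.1.1 ≠ 0 ∧ p.1.2 ≠ 0) ∧ p.2.1 ≠ 0 ∧ p.2.2 ≠ 0 := by
      simpa only [mul_ne_zero_iff] using hne
    obtain ⟨⟨q1, q2⟩, q3, q4⟩ := h0
    have hb : ∀ x, x ∣ t.1 → x ≤ N := fun x hx => (Nat.le_of_dvd (by omega) hx).trans h5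
    simp only [I, Finset.mem_product, Finset.mem_Icc]
    refine ⟨⟨⟨by omega, hb _ ?_⟩, ⟨by omega, hb _ ?_⟩⟩,
      ⟨⟨by omega, hb _ ?_⟩, ⟨by omega, hb _ ?_⟩⟩⟩ <;>
      rw [h1]
    · exact (Dvd.intro _ rfl : p.1.1 ∣ p.1.1 * p.1.2).mul_right _
    · exact (Dvd.intro_left _ rfl : p.1.2 ∣ p.1.1 * p.1.2).mul_right _
    · exact (Dvd.intro _ rfl : p.2.1 ∣ p.2.1 * p.2.2).mul_left _
    · exact (Dvd.intro_left _ rfl : p.2.2 ∣ p.2.1 * p.2.2).mul_left _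
  calc ∑ n ∈ I, dR n ^ 2 * w n = ∑ t ∈ T, w t.1 := by
        rw [Finset.sum_sigma]
        refine Finset.sum_congr rfl fun n _ => ?_
        simp [dR, Finset.card_product, sq]
    _ = ∑ t ∈ T, F (i t) := Finset.sum_congr rfl hF
    _ = ∑ p ∈ T.image i, F p := (Finset.sum_image hinj).symm
    _ ≤ ∑ p ∈ (I ×ˢ I) ×ˢ (I ×ˢ I), F p :=
        Finset.sum_le_sum_of_subset_of_nonneg hmem fun p _ _ =>
          mul_nonneg (mul_nonneg (hw _) (hw _)) (mul_nonneg (hw _) (hw _))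
    _ = (∑ n ∈ I, w n) ^ 4 := by
        rw [Finset.sum_product]
        simp only [F, ← Finset.mul_sum, ← Finset.sum_mul, Finset.sum_product]
        ring

lemma sum_dR_mul_le {w : ℕ → ℝ} (hw : ∀ n, 0 ≤ w n) (hmul : ∀ m n, w (m * n) = w m * w n)
    (N : ℕ) :
    ∑ n ∈ Finset.Icc 1 N, dR n * w n ≤ (∑ n ∈ Finset.Icc 1 N, w n) ^ 2 := by
  set I := Finset.Icc 1 N
  let T : Finset (Σ _ : ℕ, ℕ × ℕ) := I.sigma fun n => n.divisorsAntidiagonal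
  have hinj : Set.InjOn (fun t : (Σ _ : ℕ, ℕ × ℕ) => t.2) T := by
    rintro ⟨n, a⟩ hs ⟨m, b⟩ ht hst
    simp only [T, Finset.coe_sigma, Set.mem_sigma_iff, Finset.mem_coe,
      Nat.mem_divisorsAntidiagonal] at hs ht
    simp only at hst
    subst hst
    have : n = m := hs.2.1.symm.trans ht.2.1
    subst this; rfl
  calc ∑ n ∈ I, dR n * w n = ∑ t ∈ T, w t.2.1 * w t.2.2 := by
        rw [Finset.sum_sigma]
        refine Finset.sum_congr rfl fun n _ => ?_
        rw [Finset.sum_congr rfl (g := fun _ => w n)]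
        · simp [dR, ← Nat.map_div_right_divisors]
        · intro p hp
          rw [← hmul, (Nat.mem_divisorsAntidiagonal.mp hp).1]
    _ = ∑ p ∈ T.image (fun t => t.2), w p.1 * w p.2 :=
        (Finset.sum_image (f := fun p : ℕ × ℕ => w p.1 * w p.2) hinj).symm
    _ ≤ ∑ p ∈ I ×ˢ I, w p.1 * w p.2 := by
        refine Finset.sum_le_sum_of_subset_of_nonneg ?_ fun p _ _ => mul_nonneg (hw _) (hw _)
        intro p hp
        obtain ⟨⟨n, a, b⟩, ht, rfl⟩ := Finset.mem_image.mp hp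
        simp only [T, I, Finset.mem_sigma, Nat.mem_divisorsAntidiagonal, Finset.mem_Icc] at ht
        obtain ⟨⟨h1, h2⟩, h3, h4⟩ := ht
        have h5 : a ≠ 0 ∧ b ≠ 0 := by rw [← h3, mul_ne_zero_iff] at h4; exact h4
        simp only [I, Finset.mem_product, Finset.mem_Icc]
        exact ⟨⟨by omega, (Nat.le_of_dvd (by omega) (Dvd.intro _ h3)).trans h2⟩,
          ⟨by omega, (Nat.le_of_dvd (by omega) (Dvd.intro_left _ h3)).trans h2⟩⟩
    _ = (∑ n ∈ I, w n) ^ 2 := by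
        rw [Finset.sum_product]
        simp only [← Finset.mul_sum, ← Finset.sum_mul, sq]

lemma rpow_neg_mul_nat (σ : ℝ) (m n : ℕ) :
    ((m * n : ℕ) : ℝ) ^ (-σ) = (m : ℝ) ^ (-σ) * (n : ℝ) ^ (-σ) := by
  rw [Nat.cast_mul, Real.mul_rpow (by positivity) (by positivity)]

lemma summable_dR_sq {σ : ℝ} (hσ : 1 < σ) : Summable fun n : ℕ => dR n ^ 2 * (n : ℝ) ^ (-σ) := by
  have hs : Summable fun n : ℕ => (n : ℝ) ^ (-σ) := Real.summable_nat_rpow.mpr (by linarith)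
  have hnn : ∀ n : ℕ, 0 ≤ (n : ℝ) ^ (-σ) := fun n => by positivity
  refine summable_of_sum_range_le (c := (∑' n : ℕ, (n : ℝ) ^ (-σ)) ^ 4)
    (fun n => by positivity) fun N => ?_
  calc _ ≤ ∑ n ∈ Finset.Icc 1 N, dR n ^ 2 * (n : ℝ) ^ (-σ) := by
        rcases Nat.eq_zero_or_pos N with rfl | hN
        · simp
        rw [Finset.range_eq_Ico, Finset.sum_eq_sum_Ico_succ_bot hN]
        simp only [dR, Nat.divisors_zero, Finset.card_empty, Nat.cast_zero, ne_eq,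
          OfNat.ofNat_ne_zero, not_false_eq_true, zero_pow, zero_mul, zero_add]
        refine Finset.sum_le_sum_of_subset_of_nonneg ?_ fun p _ _ => by positivity
        intro n hn
        simp only [Finset.mem_Ico, Finset.mem_Icc] at hn ⊢
        omega
    _ ≤ (∑ n ∈ Finset.Icc 1 N, (n : ℝ) ^ (-σ)) ^ 4 :=
        sum_dR_sq_mul_le hnn (fun m n => rpow_neg_mul_nat σ m n) N
    _ ≤ _ := by
        gcongr
        exact hs.sum_le_tsum _ fun n _ => hnn n

lemma summable_dR {σ : ℝ} (hσ : 1 < σ) : Summable fun n : ℕ => dR n * (n : ℝ) ^ (-σ) :=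
  (summable_dR_sq hσ).of_nonneg_of_le (fun n => mul_nonneg (dR_nonneg n) (by positivity))
    fun n => mul_le_mul_of_nonneg_right (dR_le_sq n) (by positivity)

/-- Harmonic numbers as real numbers. -/
noncomputable def hR (N : ℕ) : ℝ := ∑ n ∈ Finset.Icc 1 N, (n : ℝ)⁻¹

lemma hR_nonneg (N : ℕ) : 0 ≤ hR N := Finset.sum_nonneg fun n _ => by positivity

lemma hR_eq_harmonic (N : ℕ) : hR N = harmonic N := by
  rw [harmonic_eq_sum_Icc]; simp [hR]

lemma hR_le (N : ℕ) : hR N ≤ 1 + Real.log N := by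
  rw [hR_eq_harmonic]; exact harmonic_le_one_add_log N

lemma sum_dR_sq_div_le (N : ℕ) : ∑ n ∈ Finset.Icc 1 N, dR n ^ 2 * (n : ℝ)⁻¹ ≤ hR N ^ 4 :=
  sum_dR_sq_mul_le (w := fun n => (n : ℝ)⁻¹) (fun n => by positivity)
    (fun m n => by push_cast; rw [mul_inv]) N

lemma sum_dR_div_le (N : ℕ) : ∑ n ∈ Finset.Icc 1 N, dR n * (n : ℝ)⁻¹ ≤ hR N ^ 2 :=
  sum_dR_mul_le (w := fun n => (n : ℝ)⁻¹) (fun n => by positivity)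
    (fun m n => by push_cast; rw [mul_inv]) N

lemma abs_hR_floor_sub_le {z : ℝ} (hz : 1 ≤ z) :
    |hR ⌊z⌋₊ - (Real.log z + eulerMascheroniConstant)| ≤ 2 / z := by
  have hz0 : 0 < z := by linarith
  set n := ⌊z⌋₊
  have hn1 : 1 ≤ n := Nat.one_le_floor_iff _ |>.mpr hz
  have hn0 : (0 : ℝ) < n := by exact_mod_cast hn1
  have hnz : (n : ℝ) ≤ z := Nat.floor_le hz0.le
  have hzn : z < n + 1 := Nat.lt_floor_add_one z
  have h1 : (harmonic n : ℝ) - Real.log (n + 1) < eulerMascheroniConstant :=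
    eulerMascheroniSeq_lt_eulerMascheroniConstant n
  have h2 : eulerMascheroniConstant < (harmonic n : ℝ) - Real.log n := by
    have := eulerMascheroniConstant_lt_eulerMascheroniSeq' n
    rwa [eulerMascheroniSeq', if_neg (by omega)] at this
  rw [hR_eq_harmonic, abs_le]
  have h3 : Real.log (n + 1) ≤ Real.log z + 1 / z := by
    have : Real.log ((n + 1) / z) ≤ (n + 1) / z - 1 := Real.log_le_sub_one_of_pos (by positivity)
    rw [Real.log_div (by positivity) hz0.ne'] at this
    have h : ((n : ℝ) + 1) / z - 1 ≤ 1 / z := by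
      rw [div_sub_one hz0.ne']; gcongr; linarith
    linarith
  have h4 : Real.log z ≤ Real.log n + 2 / z := by
    have : Real.log (z / n) ≤ z / n - 1 := Real.log_le_sub_one_of_pos (by positivity)
    rw [Real.log_div hz0.ne' hn0.ne'] at this
    have h : z / n - 1 ≤ 2 / z := by
      rw [div_sub_one hn0.ne', div_le_div_iff₀ hn0 hz0]
      have : (1 : ℝ) ≤ n := by exact_mod_cast hn1
      nlinarith
    linarith
  have h5 : 1 / z ≤ 2 / z := by gcongr; norm_num
  constructor <;> linarith

lemma sum_card_divisors_eq (N : ℕ) :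
    ∑ n ∈ Finset.Icc 1 N, n.divisors.card + N.sqrt ^ 2 =
      2 * ∑ a ∈ Finset.Icc 1 N.sqrt, N / a := by
  set s := N.sqrt
  have hs1 : s * s ≤ N := Nat.sqrt_le N
  have hs2 : N < (s + 1) * (s + 1) := Nat.lt_succ_sqrt N
  have hsN : s ≤ N := Nat.sqrt_le_self N
  have hdiv : ∀ a ∈ Finset.Icc 1 N, N / a = ∑ b ∈ Finset.Icc 1 N, if a * b ≤ N then 1 else 0 := by
    intro a ha
    have ha1 : 1 ≤ a := (Finset.mem_Icc.mp ha).1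
    rw [← Finset.card_filter]
    conv_lhs => rw [show N / a = (Finset.Icc 1 (N / a)).card by simp]
    congr 1
    ext b
    simp only [Finset.mem_Icc, Finset.mem_filter]
    rw [Nat.le_div_iff_mul_le (by omega), mul_comm b a]
    constructor
    · rintro ⟨h1, h2⟩
      exact ⟨⟨h1, le_trans (Nat.le_mul_of_pos_left b (by omega)) h2⟩, h2⟩
    · rintro ⟨⟨h1, -⟩, h2⟩
      exact ⟨h1, h2⟩
  have h1 : ∑ n ∈ Finset.Icc 1 N, n.divisors.card = ∑ a ∈ Finset.Icc 1 N, N / a := by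
    have := ArithmeticFunction.sum_Ioc_sigma0_eq_sum_div N
    simpa [ArithmeticFunction.sigma_zero_apply, ← Finset.Icc_succ_left_eq_Ioc] using this
  have hsub : ∀ F : ℕ → ℕ, ∑ a ∈ Finset.Icc 1 s, F a =
      ∑ a ∈ Finset.Icc 1 N, if a ≤ s then F a else 0 := by
    intro F
    rw [← Finset.sum_filter]
    congr 1
    ext a
    simp only [Finset.mem_Icc, Finset.mem_filter]
    omega
  have h2 : ∑ a ∈ Finset.Icc 1 s, N / a =
      ∑ a ∈ Finset.Icc 1 N, ∑ b ∈ Finset.Icc 1 N, if a ≤ s ∧ a * b ≤ N then 1 else 0 := by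
    rw [hsub]
    refine Finset.sum_congr rfl fun a ha => ?_
    split_ifs with h
    · rw [hdiv a ha]
      simp [h]
    · simp [h]
  have h3 : ∑ a ∈ Finset.Icc 1 s, N / a =
      ∑ a ∈ Finset.Icc 1 N, ∑ b ∈ Finset.Icc 1 N, if b ≤ s ∧ a * b ≤ N then 1 else 0 := by
    rw [h2, Finset.sum_comm]
    simp only [mul_comm]
  have h4 : s ^ 2 = ∑ a ∈ Finset.Icc 1 N, ∑ b ∈ Finset.Icc 1 N, if a ≤ s ∧ b ≤ s then 1 else 0 := by
    have : s = ∑ a ∈ Finset.Icc 1 N, if a ≤ s then 1 else 0 := by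
      rw [← hsub]; simp
    conv_lhs => rw [sq, this]
    rw [Finset.sum_mul_sum]
    refine Finset.sum_congr rfl fun a _ => Finset.sum_congr rfl fun b _ => ?_
    by_cases h : a ≤ s <;> by_cases h' : b ≤ s <;> simp [h, h']
  rw [h1, h4, two_mul]
  conv_rhs => rw [h2]
  rw [← h2]
  nth_rewrite 1 [h2]
  rw [h3, Finset.sum_congr rfl hdiv, ← Finset.sum_add_distrib, ← Finset.sum_add_distrib]
  refine Finset.sum_congr rfl fun a _ => ?_
  rw [← Finset.sum_add_distrib, ← Finset.sum_add_distrib]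
  refine Finset.sum_congr rfl fun b _ => ?_
  have hA : a ≤ s → b ≤ s → a * b ≤ N := fun h h' => (Nat.mul_le_mul h h').trans hs1
  have hB : a * b ≤ N → a ≤ s ∨ b ≤ s := by
    intro h
    by_contra! hc
    have := Nat.mul_le_mul (Nat.succ_le_of_lt hc.1) (Nat.succ_le_of_lt hc.2)
    simp only [Nat.succ_eq_add_one] at this
    omega
  by_cases h : a ≤ s <;> by_cases h' : b ≤ s <;> by_cases h'' : a * b ≤ N <;> simp [h, h', h''] <;>
    tauto

lemma abs_dirichletDelta_le {x : ℝ} (hx : 1 ≤ x) : |dirichletDelta x| ≤ 8 * √x := by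
  have hx0 : 0 < x := by linarith
  set N := ⌊x⌋₊ with hN
  set s := N.sqrt with hs
  have hsf : s = ⌊√x⌋₊ := by
    refine eq_of_forall_le_iff fun k => ?_
    rw [hs, Nat.le_sqrt, Nat.le_floor_iff hx0.le, Nat.le_floor_iff (by positivity),
      Real.le_sqrt (by positivity) hx0.le, Nat.cast_mul, sq]
  have hz1 : 1 ≤ √x := Real.one_le_sqrt.mpr hx
  have hzz : √x * √x = x := Real.mul_self_sqrt hx0.le
  have hs1 : (s : ℝ) ≤ √x := by rw [hsf]; exact Nat.floor_le (by positivity)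
  have hs2 : √x < s + 1 := by rw [hsf]; exact Nat.lt_floor_add_one _
  have hH := abs_hR_floor_sub_le hz1
  rw [← hsf, Real.log_sqrt hx0.le, abs_le] at hH
  have hD : (∑ n ∈ Finset.Icc 1 N, (n.divisors.card : ℝ)) + (s : ℝ) ^ 2 =
      2 * ∑ a ∈ Finset.Icc 1 s, ((N / a : ℕ) : ℝ) := by
    have := sum_card_divisors_eq N
    exact_mod_cast this
  have hup : ∑ a ∈ Finset.Icc 1 s, ((N / a : ℕ) : ℝ) ≤ x * hR s := by
    rw [hR, Finset.mul_sum]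
    refine Finset.sum_le_sum fun a ha => ?_
    rw [← div_eq_mul_inv, hN, ← Nat.floor_div_natCast]
    exact Nat.floor_le (by positivity)
  have hlo : x * hR s - s ≤ ∑ a ∈ Finset.Icc 1 s, ((N / a : ℕ) : ℝ) := by
    have : (s : ℝ) = ∑ a ∈ Finset.Icc 1 s, (1 : ℝ) := by simp
    conv_lhs => rw [this]
    rw [hR, Finset.mul_sum, ← Finset.sum_sub_distrib]
    refine Finset.sum_le_sum fun a ha => ?_
    rw [← div_eq_mul_inv, hN, ← Nat.floor_div_natCast]
    linarith [Nat.lt_floor_add_one (x / (a : ℝ))]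
  have e : x * (2 / √x) = 2 * √x := by
    field_simp; rw [sq, hzz]
  have hH1 : x * hR s ≤ x * (1 / 2 * Real.log x + eulerMascheroniConstant) + 2 * √x := by
    rw [← e, ← mul_add]; gcongr; linarith
  have hH2 : x * (1 / 2 * Real.log x + eulerMascheroniConstant) - 2 * √x ≤ x * hR s := by
    rw [← e, ← mul_sub]; gcongr; linarith
  have hs0 : (0 : ℝ) ≤ s := by positivity
  have hsq1 : (s : ℝ) ^ 2 ≤ x := by nlinarith
  have hsq2 : x - 2 * √x ≤ (s : ℝ) ^ 2 := by nlinarith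
  rw [dirichletDelta, ← hN, abs_le]
  constructor <;> nlinarith

section Hilbert

open Complex in
lemma integral_exp_int {k : ℤ} (hk : k ≠ 0) :
    ∫ t in (0 : ℝ)..1, cexp (2 * π * I * k * t) = 0 := by
  have hc : (2 * π * I * k : ℂ) ≠ 0 := by simp [hk, Real.pi_ne_zero]
  have h1 : cexp (2 * π * I * k) = 1 := by
    rw [mul_comm, Complex.exp_int_mul_two_pi_mul_I]
  rw [integral_exp_mul_complex hc]
  simp [h1]

open Complex in
lemma integral_sawtooth_mul_exp_int {k : ℤ} (hk : k ≠ 0) :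
    ∫ t in (0 : ℝ)..1, ((t - 1 / 2 : ℝ) : ℂ) * cexp (2 * π * I * k * t) = 1 / (2 * π * I * k) := by
  have hc : (2 * π * I * k : ℂ) ≠ 0 := by simp [hk, Real.pi_ne_zero]
  have h1 : cexp (2 * π * I * k) = 1 := by
    rw [mul_comm, Complex.exp_int_mul_two_pi_mul_I]
  set c : ℂ := 2 * π * I * k
  have hd : ∀ t : ℝ, HasDerivAt
      (fun t : ℝ => ((t - 1 / 2 : ℝ) : ℂ) * (cexp (c * t) / c) - cexp (c * t) / c / c)
      (((t - 1 / 2 : ℝ) : ℂ) * cexp (c * t)) t := by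
    intro t
    have he : HasDerivAt (fun t : ℝ => cexp (c * t) / c) (cexp (c * t)) t := by
      have h := (((hasDerivAt_id (t : ℂ)).const_mul c).cexp.div_const c).comp_ofReal
      have hc' : cexp (c * t) * (c * 1) / c = cexp (c * t) := by field_simp
      rw [← hc']
      exact h
    have hl : HasDerivAt (fun t : ℝ => ((t - 1 / 2 : ℝ) : ℂ)) 1 t := by
      simpa using ((hasDerivAt_id t).sub_const (1 / 2)).ofReal_comp
    exact ((hl.mul he).sub (he.div_const c)).congr_deriv (by ring)
  rw [intervalIntegral.integral_eq_sub_of_hasDerivAt (fun t _ => hd t)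
    ((by fun_prop : Continuous fun t : ℝ => ((t - 1 / 2 : ℝ) : ℂ) * cexp (c * t)).intervalIntegrable
      _ _)]
  simp only [ofReal_one, mul_one, h1, ofReal_zero, mul_zero, Complex.exp_zero]
  push_cast
  field_simp
  ring

open Complex in
/-- Hilbert's inequality. -/
lemma hilbert_inequality (s : Finset ℕ) (z : ℕ → ℂ) :
    ‖∑ m ∈ s, ∑ n ∈ s, if m = n then 0 else z m * (starRingEnd ℂ) (z n) / ((m : ℂ) - n)‖ ≤
      π * ∑ n ∈ s, ‖z n‖ ^ 2 := by
  let e : ℤ → ℝ → ℂ := fun k t => cexp (2 * π * I * k * t)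
  let P : ℝ → ℂ := fun t => ∑ n ∈ s, z n * e n t
  have he : ∀ k, Continuous (e k) := fun k => by fun_prop
  have hP : Continuous P := by fun_prop
  have hexp : ∀ t, ((‖P t‖ ^ 2 : ℝ) : ℂ) =
      ∑ m ∈ s, ∑ n ∈ s, z m * (starRingEnd ℂ) (z n) * e ((m : ℤ) - n) t := by
    intro t
    rw [← Complex.normSq_eq_norm_sq, Complex.normSq_eq_conj_mul_self, mul_comm, map_sum,
      Finset.sum_mul_sum]
    refine Finset.sum_congr rfl fun m _ => Finset.sum_congr rfl fun n _ => ?_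
    have : e ((m : ℤ) - n) t = e m t * (starRingEnd ℂ) (e n t) := by
      simp only [e]
      rw [← Complex.exp_conj, ← Complex.exp_add]
      congr 1
      simp [Complex.conj_ofReal, map_ofNat]
      ring
    rw [this, map_mul]
    ring
  have hsaw : ∫ t in (0 : ℝ)..1, ((t - 1 / 2 : ℝ) : ℂ) * ((‖P t‖ ^ 2 : ℝ) : ℂ) =
      (1 / (2 * π * I)) * ∑ m ∈ s, ∑ n ∈ s,
        if m = n then 0 else z m * (starRingEnd ℂ) (z n) / ((m : ℂ) - n) := by
    simp only [hexp, Finset.mul_sum]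
    rw [intervalIntegral.integral_finsetSum
      fun m _ => (by fun_prop : Continuous _).intervalIntegrable _ _]
    refine Finset.sum_congr rfl fun m _ => ?_
    rw [intervalIntegral.integral_finsetSum
      fun m _ => (by fun_prop : Continuous _).intervalIntegrable _ _]
    refine Finset.sum_congr rfl fun n _ => ?_
    have : ∀ t : ℝ, ((t - 1 / 2 : ℝ) : ℂ) * (z m * (starRingEnd ℂ) (z n) * e ((m : ℤ) - n) t) =
        (z m * (starRingEnd ℂ) (z n)) * (((t - 1 / 2 : ℝ) : ℂ) * e ((m : ℤ) - n) t) := fun t => by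
      ring
    simp only [this]
    rw [intervalIntegral.integral_const_mul]
    split_ifs with h
    · subst h
      have : ∫ t in (0 : ℝ)..1, ((t - 1 / 2 : ℝ) : ℂ) * e ((m : ℤ) - m) t = 0 := by
        simp only [e, sub_self, Int.cast_zero, mul_zero, zero_mul, Complex.exp_zero, mul_one]
        rw [intervalIntegral.integral_ofReal]
        norm_num
      rw [this]; simp
    · have hk : (m : ℤ) - n ≠ 0 := by omega
      rw [integral_sawtooth_mul_exp_int hk]
      push_cast
      have : (m : ℂ) - n ≠ 0 := by exact_mod_cast hk
      field_simp
  have hone : ∫ t in (0 : ℝ)..1, ((‖P t‖ ^ 2 : ℝ) : ℂ) = ((∑ n ∈ s, ‖z n‖ ^ 2 : ℝ) : ℂ) := by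
    simp only [hexp]
    rw [intervalIntegral.integral_finsetSum
      fun m _ => (by fun_prop : Continuous _).intervalIntegrable _ _]
    push_cast
    refine Finset.sum_congr rfl fun m hm => ?_
    rw [intervalIntegral.integral_finsetSum
      fun m _ => (by fun_prop : Continuous _).intervalIntegrable _ _]
    rw [Finset.sum_eq_single m]
    · rw [intervalIntegral.integral_const_mul]
      simp [e, Complex.mul_conj, Complex.normSq_eq_norm_sq]
    · intro n _ hn
      have hk : (m : ℤ) - n ≠ 0 := by omega
      rw [intervalIntegral.integral_const_mul, integral_exp_int hk, mul_zero]
    · intro h; exact absurd hm h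
  have hone' : ∫ t in (0 : ℝ)..1, ‖P t‖ ^ 2 = ∑ n ∈ s, ‖z n‖ ^ 2 := by
    rw [intervalIntegral.integral_ofReal] at hone
    exact_mod_cast hone
  have hbound : ‖∫ t in (0 : ℝ)..1, ((t - 1 / 2 : ℝ) : ℂ) * ((‖P t‖ ^ 2 : ℝ) : ℂ)‖ ≤
      ∫ t in (0 : ℝ)..1, 1 / 2 * ‖P t‖ ^ 2 := by
    refine intervalIntegral.norm_integral_le_of_norm_le zero_le_one ?_
      ((by fun_prop : Continuous _).intervalIntegrable _ _)
    refine Eventually.of_forall fun t ht => ?_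
    rw [norm_mul, Complex.norm_real, Complex.norm_real, Real.norm_eq_abs, Real.norm_eq_abs,
      abs_of_nonneg (by positivity : 0 ≤ ‖P t‖ ^ 2)]
    gcongr
    rw [abs_le]; constructor <;> linarith [ht.1, ht.2]
  rw [intervalIntegral.integral_const_mul, hone', hsaw, norm_mul] at hbound
  have hn : ‖(1 / (2 * π * I) : ℂ)‖ = 1 / (2 * π) := by
    simp [abs_of_pos Real.pi_pos]
  rw [hn] at hbound
  have hpi := Real.pi_pos
  calc _ = 2 * π * (1 / (2 * π) * ‖∑ m ∈ s, ∑ n ∈ s,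
        if m = n then 0 else z m * (starRingEnd ℂ) (z n) / ((m : ℂ) - n)‖) := by
        field_simp
    _ ≤ 2 * π * (1 / 2 * ∑ n ∈ s, ‖z n‖ ^ 2) := by gcongr
    _ = _ := by ring

lemma hilbert_inequality_sin (s : Finset ℕ) (x θ : ℕ → ℝ) :
    |∑ m ∈ s, ∑ n ∈ s, if m = n then 0 else x m * x n * Real.sin (θ m - θ n) / ((m : ℝ) - n)| ≤
      π * ∑ n ∈ s, x n ^ 2 := by
  have h := hilbert_inequality s fun n => x n * Complex.exp (θ n * Complex.I)
  have hn : ∀ n, ‖(x n : ℂ) * Complex.exp (θ n * Complex.I)‖ ^ 2 = x n ^ 2 := fun n => by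
    rw [norm_mul, Complex.norm_exp_ofReal_mul_I, Complex.norm_real, mul_one, Real.norm_eq_abs,
      sq_abs]
  simp only [hn] at h
  refine le_trans ?_ h
  refine le_trans (le_of_eq ?_) (Complex.abs_im_le_norm _)
  congr 1
  rw [Complex.im_sum]
  refine Finset.sum_congr rfl fun m _ => ?_
  rw [Complex.im_sum]
  refine Finset.sum_congr rfl fun n _ => ?_
  split_ifs
  · simp
  · have : (x m : ℂ) * Complex.exp (θ m * Complex.I) *
        (starRingEnd ℂ) (x n * Complex.exp (θ n * Complex.I)) / ((m : ℂ) - n) =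
        ((x m * x n / ((m : ℝ) - n) : ℝ) : ℂ) * Complex.exp ((θ m - θ n : ℝ) * Complex.I) := by
      rw [map_mul, ← Complex.exp_conj]
      simp only [Complex.conj_ofReal, map_mul, Complex.conj_I]
      push_cast
      rw [sub_mul, sub_eq_add_neg (_ * Complex.I), Complex.exp_add]
      ring_nf
    rw [this, Complex.im_ofReal_mul, Complex.exp_ofReal_mul_I_im]
    ring

end Hilbert

section MeanSquare

/-- Second mean value bound for oscillatory integrals with an increasing weight. -/
lemma abs_integral_mul_deriv_le {w w' F f : ℝ → ℝ} {a b B : ℝ} (hab : a ≤ b)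
    (hw : ∀ y ∈ Set.Icc a b, HasDerivAt w (w' y) y) (hF : ∀ y ∈ Set.Icc a b, HasDerivAt F (f y) y)
    (hw' : ContinuousOn w' (Set.Icc a b)) (hf : ContinuousOn f (Set.Icc a b))
    (hw0 : 0 ≤ w a) (hpos : ∀ y ∈ Set.Icc a b, 0 ≤ w' y)
    (hB : ∀ y ∈ Set.Icc a b, |F y| ≤ B) :
    |∫ y in a..b, w y * f y| ≤ 2 * B * w b := by
  have hu : Set.uIcc a b = Set.Icc a b := Set.uIcc_of_le hab
  have hFc : ContinuousOn F (Set.Icc a b) := fun y hy => (hF y hy).continuousAt.continuousWithinAt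
  have hi : IntervalIntegrable w' MeasureTheory.volume a b :=
    (by rwa [hu] : ContinuousOn w' (Set.uIcc a b)).intervalIntegrable
  have hmono : w b - w a = ∫ y in a..b, w' y :=
    (intervalIntegral.integral_eq_sub_of_hasDerivAt (fun y hy => hw y (hu ▸ hy)) hi).symm
  have hB0 : 0 ≤ B := (abs_nonneg _).trans (hB a ⟨le_rfl, hab⟩)
  have h0 : 0 ≤ w b - w a := by
    rw [hmono]; exact intervalIntegral.integral_nonneg hab hpos
  rw [intervalIntegral.integral_mul_deriv_eq_deriv_mul (fun y hy => hw y (hu ▸ hy))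
    (fun y hy => hF y (hu ▸ hy)) hi
    (by rwa [hu] : ContinuousOn f (Set.uIcc a b)).intervalIntegrable]
  have h1 : |∫ y in a..b, w' y * F y| ≤ B * (w b - w a) := by
    rw [hmono, ← intervalIntegral.integral_const_mul, ← Real.norm_eq_abs]
    refine intervalIntegral.norm_integral_le_of_norm_le hab (Eventually.of_forall fun y hy => ?_)
      (hi.const_mul B)
    have hy' : y ∈ Set.Icc a b := ⟨hy.1.le, hy.2⟩
    rw [Real.norm_eq_abs, abs_mul, abs_of_nonneg (hpos y hy'), mul_comm]
    exact mul_le_mul_of_nonneg_right (hB y hy') (hpos y hy')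
  have h2 : |w b * F b| ≤ w b * B := by
    rw [abs_mul, abs_of_nonneg (by linarith)]
    exact mul_le_mul_of_nonneg_left (hB b ⟨hab, le_rfl⟩) (by linarith)
  have h3 : |w a * F a| ≤ w a * B := by
    rw [abs_mul, abs_of_nonneg hw0]
    exact mul_le_mul_of_nonneg_left (hB a ⟨le_rfl, hab⟩) hw0
  rw [abs_le] at *
  constructor <;> nlinarith

/-- The fourth root, used to write Voronoi coefficients rationally. -/
noncomputable def qroot (n : ℕ) : ℝ := √√(n : ℝ)

lemma qroot_nonneg (n : ℕ) : 0 ≤ qroot n := Real.sqrt_nonneg _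

lemma qroot_pos {n : ℕ} (hn : n ≠ 0) : 0 < qroot n :=
  Real.sqrt_pos.2 (Real.sqrt_pos.2 (by positivity))

lemma qroot_sq (n : ℕ) : qroot n ^ 2 = √n := Real.sq_sqrt (Real.sqrt_nonneg _)

lemma qroot_pow_four (n : ℕ) : qroot n ^ 4 = n := by
  rw [show 4 = 2 * 2 from rfl, pow_mul, qroot_sq, Real.sq_sqrt (by positivity)]

variable {N : ℕ} {c : ℕ → ℝ}

lemma sum_sq_mul_qroot_le (hc : ∀ n ∈ Finset.Icc 1 N, |c n| ≤ dR n / qroot n ^ 3) :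
    ∑ n ∈ Finset.Icc 1 N, (c n * qroot n) ^ 2 ≤ hR N ^ 4 := by
  refine le_trans (Finset.sum_le_sum fun n hn => ?_) (sum_dR_sq_div_le N)
  have hn0 : n ≠ 0 := by have := (Finset.mem_Icc.1 hn).1; omega
  have hp := qroot_pos hn0
  have h := hc n hn
  have h1 : |c n * qroot n| ≤ dR n / qroot n ^ 2 := by
    rw [abs_mul, abs_of_pos hp]
    calc _ ≤ dR n / qroot n ^ 3 * qroot n := by gcongr
      _ = _ := by field_simp
  calc (c n * qroot n) ^ 2 = |c n * qroot n| ^ 2 := (sq_abs _).symm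
    _ ≤ (dR n / qroot n ^ 2) ^ 2 := by gcongr
    _ = dR n ^ 2 * (n : ℝ)⁻¹ := by rw [← qroot_pow_four n]; field_simp

lemma sum_sq_le (hc : ∀ n ∈ Finset.Icc 1 N, |c n| ≤ dR n / qroot n ^ 3) :
    ∑ n ∈ Finset.Icc 1 N, c n ^ 2 ≤ hR N ^ 4 := by
  refine le_trans (Finset.sum_le_sum fun n hn => ?_) (sum_sq_mul_qroot_le hc)
  have hn0 : (1 : ℝ) ≤ n := by exact_mod_cast (Finset.mem_Icc.1 hn).1
  have hp : 1 ≤ qroot n ^ 2 := by rw [qroot_sq]; exact Real.one_le_sqrt.2 hn0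
  rw [mul_pow]
  nlinarith [sq_nonneg (c n)]

lemma sum_abs_div_qroot_le (hc : ∀ n ∈ Finset.Icc 1 N, |c n| ≤ dR n / qroot n ^ 3) :
    ∑ n ∈ Finset.Icc 1 N, |c n| / qroot n ≤ hR N ^ 2 := by
  refine le_trans (Finset.sum_le_sum fun n hn => ?_) (sum_dR_div_le N)
  have hn0 : n ≠ 0 := by have := (Finset.mem_Icc.1 hn).1; omega
  have hp := qroot_pos hn0
  calc |c n| / qroot n ≤ dR n / qroot n ^ 3 / qroot n := by gcongr; exact hc n hn
    _ = dR n * (n : ℝ)⁻¹ := by rw [← qroot_pow_four n]; field_simp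

lemma sum_sum_abs_div_le (hc : ∀ n ∈ Finset.Icc 1 N, |c n| ≤ dR n / qroot n ^ 3) :
    ∑ m ∈ Finset.Icc 1 N, ∑ n ∈ Finset.Icc 1 N, |c m * c n| / (2 * qroot m * qroot n) ≤
      1 / 2 * hR N ^ 4 := by
  have h := sum_abs_div_qroot_le hc
  have h0 : 0 ≤ ∑ n ∈ Finset.Icc 1 N, |c n| / qroot n :=
    Finset.sum_nonneg fun n _ => div_nonneg (abs_nonneg _) (qroot_nonneg _)
  calc _ = 1 / 2 * (∑ n ∈ Finset.Icc 1 N, |c n| / qroot n) ^ 2 := by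
        rw [sq, Finset.sum_mul_sum, Finset.mul_sum]
        refine Finset.sum_congr rfl fun m _ => ?_
        rw [Finset.mul_sum]
        refine Finset.sum_congr rfl fun n _ => ?_
        rw [abs_mul]; simp only [div_eq_mul_inv, mul_inv]; ring
    _ ≤ 1 / 2 * (hR N ^ 2) ^ 2 := by gcongr
    _ = _ := by ring

/-- Hilbert's inequality with the frequencies `√n`. -/
lemma abs_sum_sin_div_sqrt_sub_le (hc : ∀ n ∈ Finset.Icc 1 N, |c n| ≤ dR n / qroot n ^ 3)
    (θ : ℕ → ℝ) :
    |∑ m ∈ Finset.Icc 1 N, ∑ n ∈ Finset.Icc 1 N,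
      if m = n then 0 else c m * c n * Real.sin (θ m - θ n) / (√m - √n)| ≤ 8 * hR N ^ 4 := by
  have hsplit : ∀ m ∈ Finset.Icc 1 N, ∀ n ∈ Finset.Icc 1 N,
      (if m = n then 0 else c m * c n * Real.sin (θ m - θ n) / (√m - √n)) =
      2 * (if m = n then 0 else
        (c m * qroot m) * (c n * qroot n) * Real.sin (θ m - θ n) / ((m : ℝ) - n)) +
      c m * c n * Real.sin (θ m - θ n) *
        ((qroot m - qroot n) / ((qroot m + qroot n) * (qroot m ^ 2 + qroot n ^ 2))) := by
    intro m hm n hn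
    have hm0 : m ≠ 0 := by have := (Finset.mem_Icc.1 hm).1; omega
    have hn0 : n ≠ 0 := by have := (Finset.mem_Icc.1 hn).1; omega
    have hp := qroot_pos hm0
    have hq := qroot_pos hn0
    split_ifs with h
    · subst h; simp
    · have h4 : (m : ℝ) - n ≠ 0 := sub_ne_zero.2 (by exact_mod_cast h)
      rw [← qroot_sq, ← qroot_sq]
      rw [← qroot_pow_four m, ← qroot_pow_four n] at h4 ⊢
      have h2 : qroot m ^ 2 - qroot n ^ 2 ≠ 0 := by
        intro h; apply h4; linear_combination (qroot m ^ 2 + qroot n ^ 2) * h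
      have h5 : qroot m ^ 2 + qroot n ^ 2 ≠ 0 := by positivity
      have h6 : qroot m + qroot n ≠ 0 := by positivity
      have key : 1 / (qroot m ^ 2 - qroot n ^ 2) =
          2 * (qroot m * qroot n) / (qroot m ^ 4 - qroot n ^ 4) +
          (qroot m - qroot n) / ((qroot m + qroot n) * (qroot m ^ 2 + qroot n ^ 2)) := by
        rw [show qroot m ^ 4 - qroot n ^ 4 =
          (qroot m ^ 2 - qroot n ^ 2) * (qroot m ^ 2 + qroot n ^ 2) by ring]
        field_simp
        ring
      rw [div_eq_mul_one_div, key]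
      ring
  rw [Finset.sum_congr rfl fun m hm => Finset.sum_congr rfl fun n hn => hsplit m hm n hn]
  simp only [Finset.sum_add_distrib, ← Finset.mul_sum]
  have h1 := hilbert_inequality_sin (Finset.Icc 1 N) (fun n => c n * qroot n) θ
  have h2 := sum_sq_mul_qroot_le hc
  have h3 : |∑ m ∈ Finset.Icc 1 N, ∑ n ∈ Finset.Icc 1 N, c m * c n * Real.sin (θ m - θ n) *
        ((qroot m - qroot n) / ((qroot m + qroot n) * (qroot m ^ 2 + qroot n ^ 2)))| ≤
      1 / 2 * hR N ^ 4 := by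
    refine le_trans ?_ (sum_sum_abs_div_le hc)
    refine (Finset.abs_sum_le_sum_abs _ _).trans (Finset.sum_le_sum fun m hm => ?_)
    refine (Finset.abs_sum_le_sum_abs _ _).trans (Finset.sum_le_sum fun n hn => ?_)
    have hm0 : m ≠ 0 := by have := (Finset.mem_Icc.1 hm).1; omega
    have hn0 : n ≠ 0 := by have := (Finset.mem_Icc.1 hn).1; omega
    have hp := qroot_pos hm0
    have hq := qroot_pos hn0
    rw [abs_mul, abs_mul, div_eq_mul_one_div |c m * c n|]
    have hb : |(qroot m - qroot n) / ((qroot m + qroot n) * (qroot m ^ 2 + qroot n ^ 2))| ≤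
        1 / (2 * qroot m * qroot n) := by
      rw [abs_div, abs_of_pos (by positivity :
        0 < (qroot m + qroot n) * (qroot m ^ 2 + qroot n ^ 2)),
        div_le_div_iff₀ (by positivity) (by positivity)]
      have : |qroot m - qroot n| ≤ qroot m + qroot n := by
        rw [abs_le]; constructor <;> linarith
      calc |qroot m - qroot n| * (2 * qroot m * qroot n)
          ≤ (qroot m + qroot n) * (qroot m ^ 2 + qroot n ^ 2) := by
            gcongr; nlinarith [sq_nonneg (qroot m - qroot n)]
        _ = _ := by ring
    have hs := Real.abs_sin_le_one (θ m - θ n)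
    calc _ ≤ |c m * c n| * 1 * (1 / (2 * qroot m * qroot n)) := by gcongr
      _ = _ := by ring
  have hpi := Real.pi_lt_d2
  have hpi0 := Real.pi_pos
  have hS0 : 0 ≤ ∑ n ∈ Finset.Icc 1 N, (c n * qroot n) ^ 2 :=
    Finset.sum_nonneg fun n _ => sq_nonneg _
  have h4 : π * ∑ n ∈ Finset.Icc 1 N, (c n * qroot n) ^ 2 ≤ 3.15 * hR N ^ 4 := by
    gcongr
  have h5 := h1.trans h4
  have h0 : 0 ≤ hR N ^ 4 := hS0.trans h2
  rw [abs_le] at *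
  constructor <;> linarith

/-- The trigonometric polynomial occurring in the Voronoi expansion. -/
noncomputable def vpoly (N : ℕ) (c : ℕ → ℝ) (y : ℝ) : ℝ :=
  ∑ n ∈ Finset.Icc 1 N, c n * Real.cos (4 * π * √n * y - π / 4)

lemma continuous_vpoly (N : ℕ) (c : ℕ → ℝ) : Continuous (vpoly N c) := by
  unfold vpoly; fun_prop

lemma two_mul_vpoly_sq (N : ℕ) (c : ℕ → ℝ) (y : ℝ) :
    2 * vpoly N c y ^ 2 = ∑ n ∈ Finset.Icc 1 N, c n ^ 2 +
      (∑ m ∈ Finset.Icc 1 N, ∑ n ∈ Finset.Icc 1 N,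
        if m = n then 0 else c m * c n * Real.cos (4 * π * √m * y - 4 * π * √n * y)) +
      ∑ m ∈ Finset.Icc 1 N, ∑ n ∈ Finset.Icc 1 N,
        c m * c n * Real.sin (4 * π * √m * y + 4 * π * √n * y) := by
  have hd : ∑ n ∈ Finset.Icc 1 N, c n ^ 2 = ∑ m ∈ Finset.Icc 1 N, ∑ n ∈ Finset.Icc 1 N,
      if m = n then c m ^ 2 else 0 := by
    refine Finset.sum_congr rfl fun m hm => ?_
    rw [Finset.sum_ite_eq, if_pos hm]
  rw [hd, vpoly, sq, Finset.sum_mul_sum, Finset.mul_sum, ← Finset.sum_add_distrib,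
    ← Finset.sum_add_distrib]
  refine Finset.sum_congr rfl fun m _ => ?_
  rw [Finset.mul_sum, ← Finset.sum_add_distrib, ← Finset.sum_add_distrib]
  refine Finset.sum_congr rfl fun n _ => ?_
  have h1 : 2 * (Real.cos (4 * π * √m * y - π / 4) * Real.cos (4 * π * √n * y - π / 4)) =
      Real.cos (4 * π * √m * y - 4 * π * √n * y) + Real.sin (4 * π * √m * y + 4 * π * √n * y) := by
    rw [← Real.cos_sub_pi_div_two (4 * π * √m * y + 4 * π * √n * y), ← mul_assoc,
      Real.two_mul_cos_mul_cos]
    congr 2 <;> ring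
  split_ifs with h
  · subst h
    rw [sub_self, Real.cos_zero] at h1
    linear_combination c m ^ 2 * h1
  · linear_combination c m * c n * h1

lemma abs_integral_vpoly_sq_sub_le (hc : ∀ n ∈ Finset.Icc 1 N, |c n| ≤ dR n / qroot n ^ 3)
    {Y : ℝ} (hY : 1 ≤ Y) :
    |(∫ y in (1 : ℝ)..Y, 2 * y ^ 2 * vpoly N c y ^ 2) -
      Y ^ 3 / 3 * ∑ n ∈ Finset.Icc 1 N, c n ^ 2| ≤ 20 * Y ^ 2 * hR N ^ 4 := by
  set U : ℝ → ℝ := fun y => ∑ m ∈ Finset.Icc 1 N, ∑ n ∈ Finset.Icc 1 N,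
    if m = n then 0 else c m * c n * Real.cos (4 * π * √m * y - 4 * π * √n * y) with hU
  set V : ℝ → ℝ := fun y => ∑ m ∈ Finset.Icc 1 N, ∑ n ∈ Finset.Icc 1 N,
    c m * c n * Real.sin (4 * π * √m * y + 4 * π * √n * y) with hV
  set T : ℝ → ℝ := fun y => ∑ m ∈ Finset.Icc 1 N, ∑ n ∈ Finset.Icc 1 N,
    if m = n then 0 else c m * c n * Real.sin (4 * π * √m * y - 4 * π * √n * y) / (√m - √n) with hT
  set W : ℝ → ℝ := fun y => ∑ m ∈ Finset.Icc 1 N, ∑ n ∈ Finset.Icc 1 N,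
    -(c m * c n * Real.cos (4 * π * √m * y + 4 * π * √n * y) / (√m + √n)) with hW
  have hUc : Continuous U := by
    refine continuous_finsetSum _ fun m _ => continuous_finsetSum _ fun n _ => ?_
    split_ifs <;> fun_prop
  have hVc : Continuous V := by fun_prop
  have hTd : ∀ y, HasDerivAt T (4 * π * U y) y := by
    intro y
    simp only [hT, hU, Finset.mul_sum]
    refine HasDerivAt.fun_sum fun m _ => HasDerivAt.fun_sum fun n _ => ?_
    split_ifs with h
    · simpa using hasDerivAt_const y (0 : ℝ)
    · have hne : √(m : ℝ) - √n ≠ 0 := by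
        rw [sub_ne_zero, Ne, Real.sqrt_inj (by positivity) (by positivity)]
        exact_mod_cast h
      have h1 : HasDerivAt (fun y : ℝ => 4 * π * √m * y - 4 * π * √n * y)
          (4 * π * √m - 4 * π * √n) y := by
        simpa using ((hasDerivAt_id y).const_mul (4 * π * √m)).fun_sub
          ((hasDerivAt_id y).const_mul (4 * π * √n))
      refine ((h1.sin.const_mul (c m * c n)).div_const _).congr_deriv ?_
      field_simp
  have hWd : ∀ y, HasDerivAt W (4 * π * V y) y := by
    intro y
    simp only [hW, hV, Finset.mul_sum]
    refine HasDerivAt.fun_sum fun m hm => HasDerivAt.fun_sum fun n hn => ?_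
    have hm0 : 0 < √(m : ℝ) := Real.sqrt_pos.2 (by
      exact_mod_cast (Finset.mem_Icc.1 hm).1)
    have hne : √(m : ℝ) + √n ≠ 0 := by positivity
    have h1 : HasDerivAt (fun y : ℝ => 4 * π * √m * y + 4 * π * √n * y)
        (4 * π * √m + 4 * π * √n) y := by
      simpa using ((hasDerivAt_id y).const_mul (4 * π * √m)).fun_add
        ((hasDerivAt_id y).const_mul (4 * π * √n))
    refine (((h1.cos.const_mul (c m * c n)).div_const _).neg).congr_deriv ?_
    field_simp
  have hTb : ∀ y, |T y| ≤ 8 * hR N ^ 4 := fun y =>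
    abs_sum_sin_div_sqrt_sub_le hc fun n => 4 * π * √n * y
  have hWb : ∀ y, |W y| ≤ 1 / 2 * hR N ^ 4 := by
    intro y
    refine le_trans ?_ (sum_sum_abs_div_le hc)
    refine (Finset.abs_sum_le_sum_abs _ _).trans (Finset.sum_le_sum fun m hm => ?_)
    refine (Finset.abs_sum_le_sum_abs _ _).trans (Finset.sum_le_sum fun n hn => ?_)
    have hm0 : m ≠ 0 := by have := (Finset.mem_Icc.1 hm).1; omega
    have hn0 : n ≠ 0 := by have := (Finset.mem_Icc.1 hn).1; omega
    have hp := qroot_pos hm0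
    have hq := qroot_pos hn0
    rw [abs_neg, abs_div, abs_mul, ← qroot_sq, ← qroot_sq,
      abs_of_pos (by positivity : 0 < qroot m ^ 2 + qroot n ^ 2)]
    have hs := Real.abs_cos_le_one (4 * π * qroot m ^ 2 * y + 4 * π * qroot n ^ 2 * y)
    calc _ ≤ |c m * c n| * 1 / (2 * qroot m * qroot n) := by
          gcongr; nlinarith [sq_nonneg (qroot m - qroot n)]
      _ = _ := by ring
  have hsqd : ∀ y : ℝ, HasDerivAt (fun y : ℝ => y ^ 2) (2 * y) y := fun y => by
    simpa using hasDerivAt_pow 2 y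
  have hIU := abs_integral_mul_deriv_le hY (fun y _ => hsqd y) (fun y _ => hTd y)
    (by fun_prop) (by fun_prop) (by norm_num)
    (fun y hy => by linarith [hy.1]) (fun y _ => hTb y)
  have hIV := abs_integral_mul_deriv_le hY (fun y _ => hsqd y) (fun y _ => hWd y)
    (by fun_prop) (by fun_prop) (by norm_num)
    (fun y hy => by linarith [hy.1]) (fun y _ => hWb y)
  have hcomm : ∀ f : ℝ → ℝ, (∫ y in (1 : ℝ)..Y, y ^ 2 * (4 * π * f y)) =
      4 * π * ∫ y in (1 : ℝ)..Y, y ^ 2 * f y := fun f => by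
    rw [← intervalIntegral.integral_const_mul]
    congr 1; ext y; ring
  rw [hcomm] at hIU hIV
  have hInt : (∫ y in (1 : ℝ)..Y, 2 * y ^ 2 * vpoly N c y ^ 2) =
      (Y ^ 3 - 1) / 3 * ∑ n ∈ Finset.Icc 1 N, c n ^ 2 +
      (∫ y in (1 : ℝ)..Y, y ^ 2 * U y) + ∫ y in (1 : ℝ)..Y, y ^ 2 * V y := by
    have : ∀ y : ℝ, 2 * y ^ 2 * vpoly N c y ^ 2 =
        y ^ 2 * ∑ n ∈ Finset.Icc 1 N, c n ^ 2 + y ^ 2 * U y + y ^ 2 * V y := fun y => by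
      linear_combination y ^ 2 * two_mul_vpoly_sq N c y
    simp only [this]
    rw [intervalIntegral.integral_add, intervalIntegral.integral_add,
      intervalIntegral.integral_mul_const, integral_pow]
    · norm_num
    all_goals exact (by fun_prop : Continuous _).intervalIntegrable _ _
  rw [hInt]
  have hS := sum_sq_le hc
  have hS0 : 0 ≤ ∑ n ∈ Finset.Icc 1 N, c n ^ 2 := Finset.sum_nonneg fun n _ => sq_nonneg _
  have hpi := Real.pi_gt_three
  have h0 : 0 ≤ hR N ^ 4 := hS0.trans hS
  have hY2 : 1 ≤ Y ^ 2 := by nlinarith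
  have hH : hR N ^ 4 ≤ Y ^ 2 * hR N ^ 4 := le_mul_of_one_le_left h0 hY2
  have hpi4 : (1 : ℝ) ≤ |4 * π| := by rw [abs_of_pos (by positivity)]; linarith
  rw [abs_mul] at hIU hIV
  have hIU' := (le_mul_of_one_le_left (abs_nonneg _) hpi4).trans hIU
  have hIV' := (le_mul_of_one_le_left (abs_nonneg _) hpi4).trans hIV
  rw [abs_le] at *
  constructor <;> nlinarith

lemma abs_integral_rpow_mul_vpoly_le (N : ℕ) (c : ℕ → ℝ) {a Y : ℝ} (ha : 0 ≤ a) (hY : 1 ≤ Y) :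
    |∫ y in (1 : ℝ)..Y, y ^ a * vpoly N c y| ≤
      2 * (∑ n ∈ Finset.Icc 1 N, |c n| / √n) * Y ^ a := by
  set W : ℝ → ℝ := fun y => ∑ n ∈ Finset.Icc 1 N,
    c n * Real.sin (4 * π * √n * y - π / 4) / (4 * π * √n) with hW
  have hpi := Real.pi_gt_three
  have hWd : ∀ y, HasDerivAt W (vpoly N c y) y := by
    intro y
    refine HasDerivAt.fun_sum fun n hn => ?_
    have hn0 : 0 < √(n : ℝ) := Real.sqrt_pos.2 (by
      exact_mod_cast (Finset.mem_Icc.1 hn).1)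
    have h1 : HasDerivAt (fun y : ℝ => 4 * π * √n * y - π / 4) (4 * π * √n) y := by
      simpa using ((hasDerivAt_id y).const_mul (4 * π * √n)).sub_const (π / 4)
    refine ((h1.sin.const_mul (c n)).div_const _).congr_deriv ?_
    field_simp
  refine abs_integral_mul_deriv_le hY
    (w' := fun y => a * y ^ (a - 1)) (fun y hy => Real.hasDerivAt_rpow_const
      (Or.inl (by linarith [hy.1]))) (fun y _ => hWd y) ?_
    (continuous_vpoly N c).continuousOn (by positivity)
    (fun y hy => mul_nonneg ha (Real.rpow_nonneg (by linarith [hy.1]) _)) fun y _ => ?_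
  · refine continuousOn_const.mul fun y hy => ?_
    exact (Real.continuousAt_rpow_const _ _ (Or.inl (by linarith [hy.1]))).continuousWithinAt
  · refine (Finset.abs_sum_le_sum_abs _ _).trans (Finset.sum_le_sum fun n hn => ?_)
    have hn0 : 0 < √(n : ℝ) := Real.sqrt_pos.2 (by
      exact_mod_cast (Finset.mem_Icc.1 hn).1)
    rw [abs_div, abs_mul, abs_of_pos (by positivity : 0 < 4 * π * √(n : ℝ))]
    have hs := Real.abs_sin_le_one (4 * π * √n * y - π / 4)
    calc _ ≤ |c n| * 1 / (1 * √n) := by gcongr; linarith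
      _ = _ := by ring

end MeanSquare

section Kernel

/-- The bound for oscillatory integrals with a decreasing weight. -/
lemma abs_integral_mul_deriv_le_of_antitone {w w' F f : ℝ → ℝ} {a b B : ℝ} (hab : a ≤ b)
    (hw : ∀ y ∈ Set.Icc a b, HasDerivAt w (w' y) y) (hF : ∀ y ∈ Set.Icc a b, HasDerivAt F (f y) y)
    (hw' : ContinuousOn w' (Set.Icc a b)) (hf : ContinuousOn f (Set.Icc a b))
    (hw0 : 0 ≤ w b) (hneg : ∀ y ∈ Set.Icc a b, w' y ≤ 0)
    (hB : ∀ y ∈ Set.Icc a b, |F y| ≤ B) :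
    |∫ y in a..b, w y * f y| ≤ 2 * B * w a := by
  have hu : ∀ {y}, y ∈ Set.Icc (-b) (-a) → -y ∈ Set.Icc a b := fun hy =>
    ⟨by linarith [hy.2], by linarith [hy.1]⟩
  have hm : Set.MapsTo (fun y : ℝ => -y) (Set.Icc (-b) (-a)) (Set.Icc a b) := fun y hy => hu hy
  have h := abs_integral_mul_deriv_le (w := fun y => w (-y)) (w' := fun y => -w' (-y))
    (F := fun y => -F (-y)) (f := fun y => f (-y)) (B := B) (neg_le_neg hab)
    (fun y hy => by
      simpa [Function.comp_def] using (hw _ (hu hy)).scomp y (hasDerivAt_neg y))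
    (fun y hy => by
      simpa [Function.comp_def] using ((hF _ (hu hy)).scomp y (hasDerivAt_neg y)).fun_neg)
    ((hw'.comp continuous_neg.continuousOn hm).neg) (hf.comp continuous_neg.continuousOn hm)
    (by simpa using hw0) (fun y hy => by simpa using hneg _ (hu hy))
    (fun y hy => by simpa using hB _ (hu hy))
  have h2 := intervalIntegral.integral_comp_neg (a := -b) (b := -a) fun y => w y * f y
  simp only [neg_neg] at h h2
  rwa [h2] at h

section Fresnel

open Complex in
lemma norm_integral_cexp_neg_mul_sq_le {c : ℂ} (hc : c ≠ 0) (hre : 0 ≤ c.re) {S T : ℝ}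
    (hS : 0 < S) (hST : S ≤ T) :
    ‖∫ s in S..T, cexp (-c * s ^ 2)‖ ≤ 1 / (‖c‖ * S) := by
  have hu : Set.uIcc S T = Set.Icc S T := Set.uIcc_of_le hST
  have hpos : ∀ {s}, s ∈ Set.Icc S T → 0 < s := fun hs => hS.trans_le hs.1
  have hnorm : ∀ s : ℝ, ‖cexp (-c * s ^ 2)‖ ≤ 1 := by
    intro s
    rw [Complex.norm_exp, Real.exp_le_one_iff]
    have : (-c * (s : ℂ) ^ 2).re = -(c.re * s ^ 2) := by
      rw [← Complex.ofReal_pow, Complex.re_mul_ofReal]; simp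
    rw [this]
    have := mul_nonneg hre (sq_nonneg s)
    linarith
  have hv : ∀ s ∈ Set.uIcc S T, HasDerivAt (fun s : ℝ => cexp (-c * s ^ 2))
      (cexp (-c * s ^ 2) * (-2 * c * s)) s := by
    intro s _
    have h := (((hasDerivAt_pow 2 (s : ℂ)).const_mul (-c)).cexp).comp_ofReal
    refine h.congr_deriv ?_
    push_cast; ring
  have hw : ∀ s ∈ Set.uIcc S T, HasDerivAt (fun s : ℝ => ((s⁻¹ : ℝ) : ℂ))
      ((-(s ^ 2)⁻¹ : ℝ) : ℂ) s := fun s hs =>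
    (hasDerivAt_inv (hpos (hu ▸ hs)).ne').ofReal_comp
  have hwi : IntervalIntegrable (fun s : ℝ => -(s ^ 2)⁻¹) MeasureTheory.volume S T := by
    refine ContinuousOn.intervalIntegrable ?_
    rw [hu]
    refine (ContinuousOn.inv₀ (by fun_prop) fun s hs => ?_).neg
    exact pow_ne_zero _ (hpos hs).ne'
  have hparts := intervalIntegral.integral_mul_deriv_eq_deriv_mul hw hv
    ((intervalIntegrable_iff.2 (intervalIntegrable_iff.1 hwi).ofReal))
    ((by fun_prop : Continuous fun s : ℝ =>
      cexp (-c * s ^ 2) * (-2 * c * s)).intervalIntegrable _ _)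
  have hlhs : (∫ s in S..T, ((s⁻¹ : ℝ) : ℂ) * (cexp (-c * s ^ 2) * (-2 * c * s))) =
      (-2 * c) * ∫ s in S..T, cexp (-c * s ^ 2) := by
    rw [← intervalIntegral.integral_const_mul]
    refine intervalIntegral.integral_congr fun s hs => ?_
    have : (s : ℂ) ≠ 0 := by exact_mod_cast (hpos (hu ▸ hs)).ne'
    push_cast
    field_simp
  have hInt : (∫ s in S..T, (s ^ 2)⁻¹) = S⁻¹ - T⁻¹ := by
    have := intervalIntegral.integral_eq_sub_of_hasDerivAt (f := fun s : ℝ => s⁻¹)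
      (fun s hs => hasDerivAt_inv (hpos (hu ▸ hs)).ne') hwi
    rw [intervalIntegral.integral_neg] at this
    linarith
  have hrest : ‖∫ s in S..T, ((-(s ^ 2)⁻¹ : ℝ) : ℂ) * cexp (-c * s ^ 2)‖ ≤ S⁻¹ - T⁻¹ := by
    rw [← hInt]
    refine intervalIntegral.norm_integral_le_of_norm_le hST (Eventually.of_forall fun s hs => ?_)
      (by simpa [Pi.neg_def] using hwi.neg)
    rw [norm_mul, Complex.norm_real, norm_neg, Real.norm_of_nonneg (by positivity)]
    exact mul_le_of_le_one_right (by positivity) (hnorm s)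
  have hb : ∀ s : ℝ, 0 < s → ‖((s⁻¹ : ℝ) : ℂ) * cexp (-c * s ^ 2)‖ ≤ s⁻¹ := by
    intro s hs
    rw [norm_mul, Complex.norm_real, Real.norm_of_nonneg (by positivity)]
    exact mul_le_of_le_one_right (by positivity) (hnorm s)
  rw [hlhs] at hparts
  have hle : ‖(-2 * c) * ∫ s in S..T, cexp (-c * s ^ 2)‖ ≤ 2 * S⁻¹ := by
    rw [hparts]
    refine (norm_sub_le _ _).trans ?_
    have := norm_sub_le (((T⁻¹ : ℝ) : ℂ) * cexp (-c * T ^ 2)) (((S⁻¹ : ℝ) : ℂ) * cexp (-c * S ^ 2))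
    linarith [hb S hS, hb T (hS.trans_le hST)]
  have hc0 : 0 < ‖c‖ := norm_pos_iff.2 hc
  rw [norm_mul, norm_mul, norm_neg, Complex.norm_ofNat] at hle
  rw [le_div_iff₀ (by positivity)]
  have : 2 * ‖c‖ * ‖∫ s in S..T, cexp (-c * s ^ 2)‖ * S ≤ 2 * S⁻¹ * S :=
    mul_le_mul_of_nonneg_right hle hS.le
  rw [mul_assoc 2 S⁻¹, inv_mul_cancel₀ hS.ne'] at this
  nlinarith

open Complex in
lemma norm_integral_cexp_neg_mul_sq_sub_le {c : ℂ} (hre : 0 < c.re) {S : ℝ} (hS : 0 < S) :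
    ‖(∫ s in (0 : ℝ)..S, cexp (-c * s ^ 2)) - (π / c) ^ (1 / 2 : ℂ) / 2‖ ≤ 1 / (‖c‖ * S) := by
  have hc : c ≠ 0 := fun h => by simp [h] at hre
  have hlim := MeasureTheory.intervalIntegral_tendsto_integral_Ioi 0
    (integrable_cexp_neg_mul_sq hre).integrableOn (tendsto_id (α := ℝ) (x := atTop))
  rw [integral_gaussian_complex_Ioi hre] at hlim
  have hl := (tendsto_const_nhds (x := ∫ s in (0 : ℝ)..S, cexp (-c * s ^ 2))).sub hlim
  refine le_of_tendsto hl.norm ?_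
  filter_upwards [eventually_ge_atTop S] with T hT
  have hi : ∀ a b : ℝ, IntervalIntegrable (fun s : ℝ => cexp (-c * s ^ 2))
    MeasureTheory.volume a b := fun a b => (by fun_prop : Continuous _).intervalIntegrable _ _
  rw [norm_sub_rev, intervalIntegral.integral_interval_sub_left (hi _ _) (hi _ _)]
  exact norm_integral_cexp_neg_mul_sq_le hc hre.le hS hT

open Complex in
lemma norm_integral_cexp_mul_sq_sub_le {l S : ℝ} (hl : 0 < l) (hS : 0 < S) :
    ‖(∫ s in (0 : ℝ)..S, cexp (l * s ^ 2 * I)) - (π / (-l * I)) ^ (1 / 2 : ℂ) / 2‖ ≤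
      1 / (l * S) := by
  have hcts : Continuous fun e : ℝ => ∫ s in (0 : ℝ)..S, cexp (-(e - l * I) * s ^ 2) := by
    refine intervalIntegral.continuous_parametric_intervalIntegral_of_continuous' ?_ 0 S
    fun_prop
  have h1 : Tendsto (fun e : ℝ => ∫ s in (0 : ℝ)..S, cexp (-(e - l * I) * s ^ 2))
      (nhdsWithin 0 (Set.Ioi 0)) (nhds (∫ s in (0 : ℝ)..S, cexp (l * s ^ 2 * I))) := by
    have := (hcts.tendsto 0).mono_left (nhdsWithin_le_nhds (s := Set.Ioi 0))
    simpa [mul_right_comm] using this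
  have hne : (-l * I : ℂ) ≠ 0 := by simp [hl.ne']
  have h2 : Tendsto (fun e : ℝ => (π / (e - l * I)) ^ (1 / 2 : ℂ) / 2)
      (nhdsWithin 0 (Set.Ioi 0)) (nhds ((π / (-l * I)) ^ (1 / 2 : ℂ) / 2)) := by
    have hslit : (π / (-l * I) : ℂ) ∈ Complex.slitPlane := by
      right
      have : (π / (-l * I) : ℂ) = ((π / l : ℝ) : ℂ) * I := by
        have : (l : ℂ) ≠ 0 := by exact_mod_cast hl.ne'
        push_cast
        field_simp
        rw [I_sq]
      rw [this]
      simp [hl.ne', Real.pi_ne_zero]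
    have hca : ContinuousAt (fun e : ℝ => (π / ((e : ℂ) - l * I)) ^ (1 / 2 : ℂ) / 2) 0 := by
      refine ContinuousAt.div_const (ContinuousAt.cpow ?_ continuousAt_const ?_) _
      · refine continuousAt_const.div (by fun_prop) ?_
        simpa using hne
      · simpa using hslit
    have := hca.tendsto.mono_left (nhdsWithin_le_nhds (s := Set.Ioi 0))
    simpa using this
  refine le_of_tendsto_of_tendsto (h1.sub h2).norm
    (tendsto_const_nhds (x := 1 / (l * S))) ?_
  filter_upwards [self_mem_nhdsWithin] with e he
  have he' : 0 < e := he
  have hre : 0 < ((e : ℂ) - l * I).re := by simpa using he'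
  refine (norm_integral_cexp_neg_mul_sq_sub_le hre hS).trans ?_
  have : l ≤ ‖(e : ℂ) - l * I‖ := by
    have := Complex.abs_im_le_norm ((e : ℂ) - l * I)
    simp only [sub_im, ofReal_im, mul_im, ofReal_re, I_im, I_re, mul_one, mul_zero, add_zero,
      zero_sub, abs_neg, abs_of_pos hl] at this
    exact this
  gcongr

open Complex in
lemma abs_integral_sin_mul_one_add_sq_sub_le {l S : ℝ} (hl : 0 < l) (hS : 0 < S) :
    |(∫ s in (0 : ℝ)..S, Real.sin (l * (1 + s ^ 2))) - √(π / l) / 2 * Real.sin (l + π / 4)| ≤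
      1 / (l * S) := by
  have hroot : (π / (-l * I) : ℂ) ^ (1 / 2 : ℂ) = √(π / l) * cexp ((π / 4 : ℝ) * I) := by
    have h0 : (l : ℂ) ≠ 0 := by exact_mod_cast hl.ne'
    have : (π / (-l * I) : ℂ) = ((π / l : ℝ) : ℂ) * I := by
      push_cast
      field_simp
      rw [I_sq]
    have hpl : 0 < π / l := by positivity
    have harg : Complex.arg (((π / l : ℝ) : ℂ) * I) = π / 2 := by
      rw [Complex.arg_real_mul _ hpl, Complex.arg_I]
    have hhalf : (1 / 2 : ℂ) = ((1 / 2 : ℝ) : ℂ) := by push_cast; rfl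
    rw [this, hhalf, Complex.cpow_ofReal, harg, norm_mul, Complex.norm_I, mul_one,
      Complex.norm_real, Real.norm_of_nonneg hpl.le, ← Real.sqrt_eq_rpow,
      show π / 2 * (1 / 2) = π / 4 by ring, Complex.exp_mul_I, Complex.ofReal_cos,
      Complex.ofReal_sin]
  have h := norm_integral_cexp_mul_sq_sub_le hl hS
  have hci : IntervalIntegrable (fun s : ℝ => cexp (l * I) * cexp (l * s ^ 2 * I))
      MeasureTheory.volume 0 S := (by fun_prop : Continuous _).intervalIntegrable _ _
  have him : (∫ s in (0 : ℝ)..S, Real.sin (l * (1 + s ^ 2))) =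
      (cexp (l * I) * ∫ s in (0 : ℝ)..S, cexp (l * s ^ 2 * I)).im := by
    rw [← intervalIntegral.integral_const_mul]
    have h2 := intervalIntegral.intervalIntegral_im hci
    refine Eq.trans ?_ h2
    refine intervalIntegral.integral_congr fun s _ => ?_
    have : cexp (l * I) * cexp (l * s ^ 2 * I) = cexp ((l * (1 + s ^ 2) : ℝ) * I) := by
      rw [← Complex.exp_add]; congr 1; push_cast; ring
    simp only [this]
    exact (Complex.exp_ofReal_mul_I_im _).symm
  have hmain : √(π / l) / 2 * Real.sin (l + π / 4) =
      (cexp (l * I) * ((π / (-l * I)) ^ (1 / 2 : ℂ) / 2)).im := by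
    have : cexp (l * I) * ((π / (-l * I)) ^ (1 / 2 : ℂ) / 2) =
        ((√(π / l) / 2 : ℝ) : ℂ) * cexp ((l + π / 4 : ℝ) * I) := by
      rw [hroot, Complex.ofReal_add, add_mul, Complex.exp_add]
      push_cast; ring
    rw [this, Complex.im_ofReal_mul, Complex.exp_ofReal_mul_I_im]
  rw [him, hmain, ← Complex.sub_im, ← mul_sub]
  refine (Complex.abs_im_le_norm _).trans ?_
  rwa [norm_mul, Complex.norm_exp_ofReal_mul_I, one_mul]

end Fresnel

end Kernel

section KernelAsymptotics

/-- The function `√(2 + s²)`, arising from the substitution `√(1 + x²) = 1 + s²`. -/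
noncomputable def rootTwoAdd (s : ℝ) : ℝ := √(2 + s ^ 2)

lemma rootTwoAdd_sq (s : ℝ) : rootTwoAdd s ^ 2 = 2 + s ^ 2 := Real.sq_sqrt (by positivity)

lemma rootTwoAdd_pos (s : ℝ) : 0 < rootTwoAdd s := Real.sqrt_pos.2 (by positivity)

lemma one_le_rootTwoAdd (s : ℝ) : 1 ≤ rootTwoAdd s :=
  Real.one_le_sqrt.2 (by nlinarith [sq_nonneg s])

lemma le_rootTwoAdd (s : ℝ) : s ≤ rootTwoAdd s :=
  Real.le_sqrt_of_sq_le (by linarith)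

lemma continuous_rootTwoAdd : Continuous rootTwoAdd := by unfold rootTwoAdd; fun_prop

lemma hasDerivAt_rootTwoAdd (s : ℝ) : HasDerivAt rootTwoAdd (s / rootTwoAdd s) s := by
  have h := (((hasDerivAt_pow 2 s).const_add 2).sqrt (by positivity))
  refine h.congr_deriv ?_
  rw [rootTwoAdd]; field_simp; simp

lemma hasDerivAt_amplitude (s : ℝ) :
    HasDerivAt (fun s => s / rootTwoAdd s + s / (rootTwoAdd s + √2))
      (2 / rootTwoAdd s ^ 3 + √2 / (rootTwoAdd s * (rootTwoAdd s + √2))) s := by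
  have hD := rootTwoAdd_pos s
  have h2 : 0 < √(2 : ℝ) := by positivity
  have hd := hasDerivAt_rootTwoAdd s
  have h1 := ((hasDerivAt_id' s).fun_div hd hD.ne').fun_add
    ((hasDerivAt_id' s).fun_div (hd.add_const √2) (by positivity))
  refine h1.congr_deriv ?_
  have e1 := rootTwoAdd_sq s
  have e2 : √(2 : ℝ) ^ 2 = 2 := Real.sq_sqrt (by norm_num)
  have e3 : s ^ 2 = rootTwoAdd s ^ 2 - √(2 : ℝ) ^ 2 := by rw [e1, e2]; ring
  set D := rootTwoAdd s
  have a1 : (1 * D - s * (s / D)) / D ^ 2 = 2 / D ^ 3 := by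
    field_simp; rw [e3, e2]; ring
  have a2 : (1 * (D + √2) - s * (s / D)) / (D + √2) ^ 2 = √2 / (D * (D + √2)) := by
    field_simp; rw [e3]; ring
  rw [a1, a2]

lemma hasDerivAt_amplitude_weight {s : ℝ} (hs : 0 < s) :
    HasDerivAt (fun s => (2 / rootTwoAdd s ^ 3 + √2 / (rootTwoAdd s * (rootTwoAdd s + √2))) *
        (2 * s)⁻¹)
      (-(6 * s / rootTwoAdd s ^ 5 + √2 * s * (2 * rootTwoAdd s + √2) /
          (rootTwoAdd s * (rootTwoAdd s * (rootTwoAdd s + √2)) ^ 2)) * (2 * s)⁻¹ -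
        (2 / rootTwoAdd s ^ 3 + √2 / (rootTwoAdd s * (rootTwoAdd s + √2))) * (2 * s ^ 2)⁻¹) s := by
  have hD := rootTwoAdd_pos s
  have h2 : 0 < √(2 : ℝ) := by positivity
  have hd := hasDerivAt_rootTwoAdd s
  have h1 := ((hasDerivAt_const s (2 : ℝ)).fun_div (hd.fun_pow 3) (by positivity)).fun_add
    ((hasDerivAt_const s (√2 : ℝ)).fun_div (hd.fun_mul (hd.add_const √2)) (by positivity))
  have h3 := ((hasDerivAt_id' s).const_mul 2).fun_inv (by positivity)
  refine (h1.fun_mul h3).congr_deriv ?_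
  set D := rootTwoAdd s
  field_simp
  ring

lemma abs_integral_amplitude_deriv_mul_cos_le {l S : ℝ} (hl : 1 ≤ l) (hS : 1 ≤ S) :
    |∫ s in (0 : ℝ)..S, (2 / rootTwoAdd s ^ 3 + √2 / (rootTwoAdd s * (rootTwoAdd s + √2))) *
      Real.cos (l * (1 + s ^ 2))| ≤ 4 / √l := by
  set n' : ℝ → ℝ := fun s => 2 / rootTwoAdd s ^ 3 + √2 / (rootTwoAdd s * (rootTwoAdd s + √2))
    with hn'
  have hDc := continuous_rootTwoAdd
  have h2 : 0 < √(2 : ℝ) := by positivity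
  have hn0 : ∀ s, 0 ≤ n' s := fun s => by have := rootTwoAdd_pos s; positivity
  have hn2 : ∀ s, n' s ≤ 2 := by
    intro s
    have hD := rootTwoAdd_pos s
    have hD1 := one_le_rootTwoAdd s
    have a1 : 2 / rootTwoAdd s ^ 3 ≤ 1 := by
      rw [div_le_one (by positivity)]
      nlinarith [rootTwoAdd_sq s, sq_nonneg s]
    have a2 : √2 / (rootTwoAdd s * (rootTwoAdd s + √2)) ≤ 1 := by
      rw [div_le_one (by positivity)]
      nlinarith
    simp only [hn']; linarith
  have hnc : Continuous n' := by
    have h3 : ∀ s, rootTwoAdd s ≠ 0 := fun s => (rootTwoAdd_pos s).ne'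
    refine (continuous_const.div (by fun_prop) fun s => pow_ne_zero _ (h3 s)).add
      (continuous_const.div (by fun_prop) fun s => ?_)
    have := rootTwoAdd_pos s
    positivity
  have hsl : 1 ≤ √l := Real.one_le_sqrt.2 hl
  set s0 := (√l)⁻¹ with hs0
  have hs0p : 0 < s0 := by positivity
  have hs01 : s0 ≤ 1 := inv_le_one_of_one_le₀ hsl
  have hi : ∀ a b : ℝ, IntervalIntegrable (fun s => n' s * Real.cos (l * (1 + s ^ 2)))
    MeasureTheory.volume a b := fun a b => (by fun_prop : Continuous _).intervalIntegrable _ _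
  rw [← intervalIntegral.integral_add_adjacent_intervals (hi 0 s0) (hi s0 S)]
  have hA : |∫ s in (0 : ℝ)..s0, n' s * Real.cos (l * (1 + s ^ 2))| ≤ 2 * s0 := by
    have := intervalIntegral.norm_integral_le_of_norm_le_const (a := 0) (b := s0) (C := 2)
      (f := fun s => n' s * Real.cos (l * (1 + s ^ 2))) fun s _ => by
        rw [norm_mul, Real.norm_of_nonneg (hn0 s)]
        exact (mul_le_of_le_one_right (hn0 s) (Real.abs_cos_le_one _)).trans (hn2 s)
    rwa [sub_zero, abs_of_pos hs0p] at this
  have hB : |∫ s in s0..S, n' s * Real.cos (l * (1 + s ^ 2))| ≤ 2 * s0 := by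
    have hcongr : (∫ s in s0..S, n' s * Real.cos (l * (1 + s ^ 2))) =
        ∫ s in s0..S, (n' s * (2 * s)⁻¹) * (Real.cos (l * (1 + s ^ 2)) * (2 * s)) := by
      refine intervalIntegral.integral_congr fun s hs => ?_
      rw [Set.uIcc_of_le (hs01.trans hS)] at hs
      have : 0 < s := hs0p.trans_le hs.1
      field_simp
    rw [hcongr]
    have hF : ∀ s, HasDerivAt (fun s => Real.sin (l * (1 + s ^ 2)) / l)
        (Real.cos (l * (1 + s ^ 2)) * (2 * s)) s := fun s => by
      have := ((((hasDerivAt_pow 2 s).const_add 1).const_mul l).sin.div_const l)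
      refine this.congr_deriv ?_
      field_simp; norm_num; ring
    have hpos : ∀ s ∈ Set.Icc s0 S, 0 < s := fun s hs => hs0p.trans_le hs.1
    have h := abs_integral_mul_deriv_le_of_antitone (hs01.trans hS)
      (fun s hs => hasDerivAt_amplitude_weight (hpos s hs)) (fun s _ => hF s) (B := 1 / l)
      ?_ (by fun_prop) ?_ ?_ ?_
    · refine h.trans ?_
      have hll : √l * √l = l := Real.mul_self_sqrt (by linarith)
      calc 2 * (1 / l) * (n' s0 * (2 * s0)⁻¹) ≤ 2 * (1 / l) * (2 * (2 * s0)⁻¹) := by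
            gcongr; exact hn2 s0
        _ = 2 * s0 := by
            rw [hs0]; field_simp; nlinarith
    · have hD : ∀ s, 0 < rootTwoAdd s := rootTwoAdd_pos
      have hD' : ∀ s, rootTwoAdd s ≠ 0 := fun s => (hD s).ne'
      intro s hs
      refine ContinuousAt.continuousWithinAt ?_
      have h1 := hpos s hs
      have h4 := hD s
      have hDa : ContinuousAt rootTwoAdd s := hDc.continuousAt
      have e1 : rootTwoAdd s ^ 5 ≠ 0 := by positivity
      have e2 : rootTwoAdd s * (rootTwoAdd s * (rootTwoAdd s + √2)) ^ 2 ≠ 0 := by positivity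
      have e3 : 2 * s ≠ 0 := by positivity
      have e4 : rootTwoAdd s ^ 3 ≠ 0 := by positivity
      have e5 : rootTwoAdd s * (rootTwoAdd s + √2) ≠ 0 := by positivity
      have e6 : 2 * s ^ 2 ≠ 0 := by positivity
      fun_prop (disch := assumption)
    · have := hn0 S
      exact mul_nonneg this (by positivity)
    · intro s hs
      have h1 := hpos s hs
      have h4 := rootTwoAdd_pos s
      rw [neg_mul, sub_eq_add_neg, ← neg_add]
      exact neg_nonpos.2 (by positivity)
    · intro s _
      rw [abs_div, abs_of_pos (by linarith : 0 < l)]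
      gcongr
      exact Real.abs_sin_le_one _
  have := abs_add_le (∫ s in (0 : ℝ)..s0, n' s * Real.cos (l * (1 + s ^ 2)))
    (∫ s in s0..S, n' s * Real.cos (l * (1 + s ^ 2)))
  have e : 4 / √l = 4 * s0 := by rw [hs0]; ring
  rw [e]
  linarith

lemma abs_integral_sin_mul_amplitude_le {l S : ℝ} (hl : 1 ≤ l) (hS : 1 ≤ S) :
    |(∫ s in (0 : ℝ)..S, Real.sin (l * (1 + s ^ 2)) * (2 * (1 + s ^ 2) / rootTwoAdd s)) -
      √2 * (√(π / l) / 2) * Real.sin (l + π / 4) +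
      Real.cos (l * (1 + S ^ 2)) * (S / rootTwoAdd S + S / (rootTwoAdd S + √2)) / (2 * l)| ≤
      2 / (l * √l) + 2 / (l * S) := by
  have hl0 : 0 < l := by linarith
  have hDc := continuous_rootTwoAdd
  have h2 : 0 < √(2 : ℝ) := by positivity
  set n : ℝ → ℝ := fun s => s / rootTwoAdd s + s / (rootTwoAdd s + √2) with hn
  set n' : ℝ → ℝ := fun s => 2 / rootTwoAdd s ^ 3 + √2 / (rootTwoAdd s * (rootTwoAdd s + √2))
    with hn'
  have hnc : Continuous n := continuous_iff_continuousAt.2 fun s =>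
    (hasDerivAt_amplitude s).continuousAt
  have hn'c : Continuous n' := by
    have h3 : ∀ s, rootTwoAdd s ≠ 0 := fun s => (rootTwoAdd_pos s).ne'
    refine (continuous_const.div (by fun_prop) fun s => pow_ne_zero _ (h3 s)).add
      (continuous_const.div (by fun_prop) fun s => ?_)
    have := rootTwoAdd_pos s
    positivity
  have hm : ∀ s, 2 * (1 + s ^ 2) / rootTwoAdd s = √2 + s * n s := by
    intro s
    have hD := rootTwoAdd_pos s
    have e1 := rootTwoAdd_sq s
    have e2 : √(2 : ℝ) ^ 2 = 2 := Real.sq_sqrt (by norm_num)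
    have e3 : s ^ 2 = rootTwoAdd s ^ 2 - √(2 : ℝ) ^ 2 := by rw [e1, e2]; ring
    simp only [hn]
    have : (1 : ℝ) = √2 ^ 2 / 2 := by rw [e2]; norm_num
    rw [this]
    field_simp
    rw [e3]; ring
  have hsplit : (∫ s in (0 : ℝ)..S, Real.sin (l * (1 + s ^ 2)) * (2 * (1 + s ^ 2) / rootTwoAdd s)) =
      √2 * (∫ s in (0 : ℝ)..S, Real.sin (l * (1 + s ^ 2))) +
      ∫ s in (0 : ℝ)..S, n s * (Real.sin (l * (1 + s ^ 2)) * s) := by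
    rw [← intervalIntegral.integral_const_mul, ← intervalIntegral.integral_add]
    · refine intervalIntegral.integral_congr fun s _ => ?_
      simp only [hm]; ring
    all_goals exact (by fun_prop : Continuous _).intervalIntegrable _ _
  have hv : ∀ s, HasDerivAt (fun s => -Real.cos (l * (1 + s ^ 2)) / (2 * l))
      (Real.sin (l * (1 + s ^ 2)) * s) s := fun s => by
    have := ((((hasDerivAt_pow 2 s).const_add 1).const_mul l).cos.fun_neg.div_const (2 * l))
    refine this.congr_deriv ?_
    field_simp; norm_num; ring
  have hparts := intervalIntegral.integral_mul_deriv_eq_deriv_mul (a := 0) (b := S)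
    (fun s _ => hasDerivAt_amplitude s) (fun s _ => hv s)
    (hn'c.intervalIntegrable _ _) ((by fun_prop : Continuous _).intervalIntegrable _ _)
  change (∫ s in (0 : ℝ)..S, n s * (Real.sin (l * (1 + s ^ 2)) * s)) = n S * _ - n 0 * _ -
    ∫ s in (0 : ℝ)..S, n' s * _ at hparts
  have hn0 : n 0 = 0 := by simp [hn]
  have hrest : (∫ s in (0 : ℝ)..S, n' s * (-Real.cos (l * (1 + s ^ 2)) / (2 * l))) =
      -(1 / (2 * l)) * ∫ s in (0 : ℝ)..S, n' s * Real.cos (l * (1 + s ^ 2)) := by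
    rw [← intervalIntegral.integral_const_mul]
    congr 1; ext s; ring
  rw [hsplit, hparts, hn0, hrest]
  have hF := abs_integral_sin_mul_one_add_sq_sub_le hl0 (by linarith : 0 < S)
  have hQ := abs_integral_amplitude_deriv_mul_cos_le hl hS
  set I1 := ∫ s in (0 : ℝ)..S, Real.sin (l * (1 + s ^ 2))
  set I2 := ∫ s in (0 : ℝ)..S, n' s * Real.cos (l * (1 + s ^ 2))
  have e : √2 * I1 + (n S * (-Real.cos (l * (1 + S ^ 2)) / (2 * l)) -
      0 * (-Real.cos (l * (1 + 0 ^ 2)) / (2 * l)) - -(1 / (2 * l)) * I2) -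
      √2 * (√(π / l) / 2) * Real.sin (l + π / 4) + Real.cos (l * (1 + S ^ 2)) * n S / (2 * l) =
      √2 * (I1 - √(π / l) / 2 * Real.sin (l + π / 4)) + 1 / (2 * l) * I2 := by ring
  change |_ + Real.cos (l * (1 + S ^ 2)) * n S / (2 * l)| ≤ _
  rw [e]
  refine (abs_add_le _ _).trans ?_
  rw [abs_mul, abs_mul, abs_of_pos h2, abs_of_pos (by positivity : 0 < 1 / (2 * l))]
  have hs2 : √(2 : ℝ) ≤ 2 := by rw [Real.sqrt_le_left (by norm_num)]; norm_num
  calc _ ≤ 2 * (1 / (l * S)) + 1 / (2 * l) * (4 / √l) := by gcongr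
    _ = _ := by field_simp; ring

lemma abs_integral_sin_mul_le {l X : ℝ} (hl : 0 < l) (hX : 0 ≤ X) :
    |(∫ x in (0 : ℝ)..X, x / √(x ^ 2 + 1) * Real.sin (l * x)) +
      Real.cos (l * X) * (X / √(X ^ 2 + 1)) / l| ≤ 2 / l ^ 2 := by
  have hw : ∀ x : ℝ, 0 < √(x ^ 2 + 1) := fun x => by positivity
  have hroot : ∀ x : ℝ, HasDerivAt (fun x : ℝ => √(x ^ 2 + 1)) (x / √(x ^ 2 + 1)) x := by
    intro x
    refine (((hasDerivAt_pow 2 x).add_const 1).sqrt (by positivity)).congr_deriv ?_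
    field_simp; simp
  have hb : ∀ x : ℝ, HasDerivAt (fun x : ℝ => x / √(x ^ 2 + 1)) (1 / √(x ^ 2 + 1) ^ 3) x := by
    intro x
    refine ((hasDerivAt_id' x).fun_div (hroot x) (hw x).ne').congr_deriv ?_
    have := hw x
    have e : √(x ^ 2 + 1) ^ 2 = x ^ 2 + 1 := Real.sq_sqrt (by positivity)
    field_simp
    rw [e]; ring
  have hb' : ∀ x : ℝ, HasDerivAt (fun x : ℝ => 1 / √(x ^ 2 + 1) ^ 3)
      (-(3 * x / √(x ^ 2 + 1) ^ 5)) x := by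
    intro x
    refine ((hasDerivAt_const x (1 : ℝ)).fun_div ((hroot x).fun_pow 3)
      (pow_ne_zero _ (hw x).ne')).congr_deriv ?_
    have := hw x
    field_simp
    ring
  have hc : ∀ k : ℕ, ∀ x : ℝ, √(x ^ 2 + 1) ^ k ≠ 0 := fun k x => pow_ne_zero _ (hw x).ne'
  have hv : ∀ x, HasDerivAt (fun x => -Real.cos (l * x) / l) (Real.sin (l * x)) x := fun x => by
    refine (((hasDerivAt_id' x).const_mul l).cos.fun_neg.div_const l).congr_deriv ?_
    field_simp
  have hv2 : ∀ x, HasDerivAt (fun x => Real.sin (l * x) / l) (Real.cos (l * x)) x := fun x => by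
    refine (((hasDerivAt_id' x).const_mul l).sin.div_const l).congr_deriv ?_
    field_simp
  have hc3 : Continuous fun x : ℝ => 1 / √(x ^ 2 + 1) ^ 3 :=
    continuous_const.div (by fun_prop) (hc 3)
  have hparts := intervalIntegral.integral_mul_deriv_eq_deriv_mul (a := 0) (b := X)
    (fun x _ => hb x) (fun x _ => hv x) (hc3.intervalIntegrable _ _)
    ((by fun_prop : Continuous _).intervalIntegrable _ _)
  have hrest : (∫ x in (0 : ℝ)..X, 1 / √(x ^ 2 + 1) ^ 3 * (-Real.cos (l * x) / l)) =
      -(1 / l) * ∫ x in (0 : ℝ)..X, 1 / √(x ^ 2 + 1) ^ 3 * Real.cos (l * x) := by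
    rw [← intervalIntegral.integral_const_mul]
    congr 1; ext s; ring
  have h := abs_integral_mul_deriv_le_of_antitone hX (fun x _ => hb' x) (fun x _ => hv2 x)
    (B := 1 / l) ?_ (by fun_prop) (by positivity) ?_ ?_
  · rw [hparts, hrest]
    have e : X / √(X ^ 2 + 1) * (-Real.cos (l * X) / l) -
        0 / √(0 ^ 2 + 1) * (-Real.cos (l * 0) / l) - -(1 / l) * (∫ x in (0 : ℝ)..X,
        1 / √(x ^ 2 + 1) ^ 3 * Real.cos (l * x)) + Real.cos (l * X) * (X / √(X ^ 2 + 1)) / l =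
        1 / l * ∫ x in (0 : ℝ)..X, 1 / √(x ^ 2 + 1) ^ 3 * Real.cos (l * x) := by ring
    rw [e, abs_mul, abs_of_pos (by positivity : 0 < 1 / l)]
    simp only [ne_eq, OfNat.ofNat_ne_zero, not_false_eq_true, zero_pow, zero_add, Real.sqrt_one,
      one_pow, div_one, mul_one] at h
    calc _ ≤ 1 / l * (2 * (1 / l)) := by gcongr
      _ = _ := by field_simp
  · exact ((continuous_const.mul continuous_id).div (by fun_prop) (hc 5)).neg.continuousOn
  · intro x hx
    have := hx.1
    exact neg_nonpos.2 (by positivity)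
  · intro s _
    rw [abs_div, abs_of_pos hl]
    gcongr
    exact Real.abs_sin_le_one _

end KernelAsymptotics

section KernelLimit

lemma integral_sin_mul_sqrt_eq (l : ℝ) {S : ℝ} :
    (∫ x in (0 : ℝ)..(S * rootTwoAdd S), Real.sin (l * √(x ^ 2 + 1))) =
      ∫ s in (0 : ℝ)..S, Real.sin (l * (1 + s ^ 2)) * (2 * (1 + s ^ 2) / rootTwoAdd s) := by
  have hd : ∀ s, HasDerivAt (fun s => s * rootTwoAdd s) (2 * (1 + s ^ 2) / rootTwoAdd s) s := by
    intro s
    refine ((hasDerivAt_id' s).fun_mul (hasDerivAt_rootTwoAdd s)).congr_deriv ?_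
    have := rootTwoAdd_pos s
    have e := rootTwoAdd_sq s
    field_simp
    linarith
  have hc : Continuous fun s => 2 * (1 + s ^ 2) / rootTwoAdd s :=
    (by fun_prop : Continuous fun s : ℝ => 2 * (1 + s ^ 2)).div continuous_rootTwoAdd
      fun s => (rootTwoAdd_pos s).ne'
  have h := intervalIntegral.integral_comp_mul_deriv (a := 0) (b := S)
    (g := fun x => Real.sin (l * √(x ^ 2 + 1))) (fun s _ => hd s) hc.continuousOn (by fun_prop)
  rw [zero_mul] at h
  rw [← h]
  refine intervalIntegral.integral_congr fun s _ => ?_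
  have e : √((s * rootTwoAdd s) ^ 2 + 1) = 1 + s ^ 2 := by
    rw [mul_pow, rootTwoAdd_sq, show s ^ 2 * (2 + s ^ 2) + 1 = (1 + s ^ 2) ^ 2 by ring,
      Real.sqrt_sq (by positivity)]
  simp only [Function.comp, e]

lemma integral_sin_div_mul_cos_eq (Z : ℝ) (X : ℝ) :
    (∫ r in (X + √(X ^ 2 + 1))⁻¹..(X + √(X ^ 2 + 1)), Real.sin (Z / r) * Real.cos (Z * r)) =
      (∫ x in (0 : ℝ)..X, Real.sin (2 * Z * √(x ^ 2 + 1))) -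
        ∫ x in (0 : ℝ)..X, x / √(x ^ 2 + 1) * Real.sin (2 * Z * x) := by
  have hw : ∀ x : ℝ, 0 < √(x ^ 2 + 1) := fun x => by positivity
  have hsq : ∀ x : ℝ, √(x ^ 2 + 1) ^ 2 = x ^ 2 + 1 := fun x => Real.sq_sqrt (by positivity)
  have hr : ∀ x : ℝ, 0 < x + √(x ^ 2 + 1) := by
    intro x
    have : |x| < √(x ^ 2 + 1) := by
      rw [← Real.sqrt_sq_eq_abs]; exact Real.sqrt_lt_sqrt (by positivity) (by linarith)
    linarith [neg_abs_le x]
  have hinv : ∀ x : ℝ, (x + √(x ^ 2 + 1))⁻¹ = √(x ^ 2 + 1) - x := by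
    intro x
    refine inv_eq_of_mul_eq_one_right ?_
    linear_combination hsq x
  have hd : ∀ x : ℝ, HasDerivAt (fun x : ℝ => x + √(x ^ 2 + 1)) (1 + x / √(x ^ 2 + 1)) x := by
    intro x
    refine ((hasDerivAt_id' x).fun_add
      (((hasDerivAt_pow 2 x).add_const 1).sqrt (by positivity))).congr_deriv ?_
    field_simp
    norm_num
    ring
  have hc : Continuous fun x : ℝ => 1 + x / √(x ^ 2 + 1) :=
    continuous_const.add (continuous_id.div (by fun_prop) fun x => (hw x).ne')
  have hbc : Continuous fun x : ℝ => x / √(x ^ 2 + 1) :=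
    continuous_id.div (by fun_prop) fun x => (hw x).ne'
  have h := intervalIntegral.integral_comp_mul_deriv' (a := -X) (b := X)
    (g := fun r => Real.sin (Z / r) * Real.cos (Z * r)) (fun x _ => hd x) hc.continuousOn (by
      rintro r ⟨x, _, rfl⟩
      refine ContinuousAt.continuousWithinAt ?_
      have := (hr x).ne'
      fun_prop (disch := assumption))
  rw [neg_sq, neg_add_eq_sub, ← hinv] at h
  rw [← h]
  have hval : ∀ x : ℝ, ((fun r => Real.sin (Z / r) * Real.cos (Z * r)) ∘
      (fun x : ℝ => x + √(x ^ 2 + 1))) x * (1 + x / √(x ^ 2 + 1)) =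
      1 / 2 * (1 + x / √(x ^ 2 + 1)) *
        (Real.sin (2 * Z * √(x ^ 2 + 1)) - Real.sin (2 * Z * x)) := by
    intro x
    have h2 : 2 * (Real.sin (Z / (x + √(x ^ 2 + 1))) * Real.cos (Z * (x + √(x ^ 2 + 1)))) =
        Real.sin (2 * Z * √(x ^ 2 + 1)) - Real.sin (2 * Z * x) := by
      have e1 : Z * (√(x ^ 2 + 1) - x) - Z * (x + √(x ^ 2 + 1)) = -(2 * Z * x) := by ring
      have e2 : Z * (√(x ^ 2 + 1) - x) + Z * (x + √(x ^ 2 + 1)) = 2 * Z * √(x ^ 2 + 1) := by ring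
      rw [← mul_assoc, Real.two_mul_sin_mul_cos, div_eq_mul_inv, hinv, e1, e2, Real.sin_neg]
      ring
    simp only [Function.comp]
    linear_combination (1 / 2 * (1 + x / √(x ^ 2 + 1))) * h2
  simp only [hval]
  set f : ℝ → ℝ := fun x => 1 / 2 * (1 + x / √(x ^ 2 + 1)) *
        (Real.sin (2 * Z * √(x ^ 2 + 1)) - Real.sin (2 * Z * x)) with hf
  have hfc : Continuous f := by fun_prop
  have hneg : (∫ x in -X..0, f x) = ∫ x in (0 : ℝ)..X, f (-x) := by
    rw [intervalIntegral.integral_comp_neg, neg_zero]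
  rw [← intervalIntegral.integral_add_adjacent_intervals (hfc.intervalIntegrable (-X) 0)
    (hfc.intervalIntegrable 0 X), hneg,
    ← intervalIntegral.integral_add (f := fun x => f (-x))
      ((hfc.comp continuous_neg).intervalIntegrable _ _) (hfc.intervalIntegrable _ _),
        ← intervalIntegral.integral_sub
      ((by fun_prop : Continuous _).intervalIntegrable _ _)
      ((by fun_prop : Continuous _).intervalIntegrable _ _)]
  refine intervalIntegral.integral_congr fun x _ => ?_
  simp only [hf, neg_sq, mul_neg, Real.sin_neg]
  ring

lemma abs_boundary_le {l S : ℝ} (hl : 1 ≤ l) (hS : 1 ≤ S) :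
    |Real.cos (l * (1 + S ^ 2)) * (S / rootTwoAdd S + S / (rootTwoAdd S + √2)) / 2 -
      Real.cos (l * (S * rootTwoAdd S)) *
        (S * rootTwoAdd S / √((S * rootTwoAdd S) ^ 2 + 1))| ≤ (4 + l) / S := by
  have e : √((S * rootTwoAdd S) ^ 2 + 1) = 1 + S ^ 2 := by
    rw [mul_pow, rootTwoAdd_sq, show S ^ 2 * (2 + S ^ 2) + 1 = (1 + S ^ 2) ^ 2 by ring,
      Real.sqrt_sq (by positivity)]
  rw [e]
  set D := rootTwoAdd S with hDdef
  have hS0 : 0 < S := by linarith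
  have hDS : S ≤ D := le_rootTwoAdd S
  have hD : 0 < D := rootTwoAdd_pos S
  have hD2 : D ^ 2 = 2 + S ^ 2 := rootTwoAdd_sq S
  have h2 : 0 < √(2 : ℝ) := by positivity
  have hs2 : √(2 : ℝ) ≤ 2 := by rw [Real.sqrt_le_left (by norm_num)]; norm_num
  have hDS1 : D ≤ S + 1 := by nlinarith
  have hdiff : |(1 + S ^ 2) - S * D| ≤ 1 / S := by
    rw [le_div_iff₀ hS0, ← abs_of_pos hS0, ← abs_mul, abs_of_pos hS0]
    have : ((1 + S ^ 2) - S * D) * (1 + S ^ 2 + S * D) = 1 := by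
      linear_combination -S ^ 2 * hD2
    have hp : 0 < 1 + S ^ 2 - S * D := by
      by_contra hcon
      nlinarith [mul_pos hS0 hD]
    rw [abs_of_pos (mul_pos hp hS0)]
    refine (mul_le_mul_of_nonneg_left ?_ hp.le).trans_eq this
    nlinarith [mul_pos hS0 hD]
  have hcos : |Real.cos (l * (1 + S ^ 2)) - Real.cos (l * (S * D))| ≤ l / S := by
    have h := Real.abs_cos_sub_cos_le (l * (1 + S ^ 2)) (l * (S * D))
    rw [← mul_sub, abs_mul, abs_of_pos (by linarith : 0 < l)] at h
    calc _ ≤ _ := h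
      _ ≤ l * (1 / S) := by gcongr
      _ = l / S := by ring
  have hb : |S * D / (1 + S ^ 2) - 1| ≤ 1 / S := by
    have h1 : S * D / (1 + S ^ 2) - 1 = -(((1 + S ^ 2) - S * D) / (1 + S ^ 2)) := by
      field_simp; ring
    rw [h1, abs_neg, abs_div, abs_of_pos (by positivity : 0 < 1 + S ^ 2)]
    exact (div_le_self (abs_nonneg _) (by nlinarith)).trans hdiff
  have hn1 : |S / D - 1| ≤ 1 / S := by
    rw [abs_sub_comm, abs_of_nonneg (by rw [sub_nonneg, div_le_one hD]; exact hDS),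
      sub_le_iff_le_add, ← sub_le_iff_le_add', le_div_iff₀ hD]
    have : (1 - 1 / S) * D ≤ (1 - 1 / S) * (S + 1) := by
      refine mul_le_mul_of_nonneg_left hDS1 ?_
      rw [sub_nonneg, div_le_one hS0]; exact hS
    refine this.trans ?_
    have : (1 - 1 / S) * (S + 1) = S - 1 / S := by field_simp; ring
    rw [this]
    have : 0 < 1 / S := by positivity
    linarith
  have hn2 : |S / (D + √2) - 1| ≤ 3 / S := by
    rw [abs_sub_comm, abs_of_nonneg (by
      rw [sub_nonneg, div_le_one (by positivity)]; linarith)]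
    have h1 : 1 - S / (D + √2) = (D - S + √2) / (D + √2) := by field_simp; ring
    rw [h1]
    gcongr <;> linarith
  have hC1 := Real.abs_cos_le_one (l * (1 + S ^ 2))
  have e1 : Real.cos (l * (1 + S ^ 2)) * (S / D + S / (D + √2)) / 2 -
      Real.cos (l * (S * D)) * (S * D / (1 + S ^ 2)) =
      Real.cos (l * (1 + S ^ 2)) * ((S / D - 1 + (S / (D + √2) - 1)) / 2) +
      (Real.cos (l * (1 + S ^ 2)) - Real.cos (l * (S * D))) -
      Real.cos (l * (S * D)) * (S * D / (1 + S ^ 2) - 1) := by ring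
  rw [e1]
  have t1 : |Real.cos (l * (1 + S ^ 2)) * ((S / D - 1 + (S / (D + √2) - 1)) / 2)| ≤ 2 / S := by
    rw [abs_mul, abs_div, abs_two]
    have h3 := abs_add_le (S / D - 1) (S / (D + √2) - 1)
    calc _ ≤ 1 * ((1 / S + 3 / S) / 2) := by gcongr; linarith
      _ = _ := by ring
  have t2 : |Real.cos (l * (S * D)) * (S * D / (1 + S ^ 2) - 1)| ≤ 1 / S := by
    rw [abs_mul]
    calc _ ≤ 1 * (1 / S) := by gcongr; exact Real.abs_cos_le_one _
      _ = _ := by ring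
  have h4 : (4 + l) / S = 2 / S + l / S + 1 / S + 1 / S := by ring
  have h5 : 0 < 1 / S := by positivity
  rw [h4]
  rw [abs_le] at *
  constructor <;> linarith

lemma abs_integral_sin_div_mul_cos_sub_le {Z S : ℝ} (hl : 1 ≤ 2 * Z) (hS : 1 ≤ S) :
    |(∫ r in (S * rootTwoAdd S + (1 + S ^ 2))⁻¹..(S * rootTwoAdd S + (1 + S ^ 2)),
      Real.sin (Z / r) * Real.cos (Z * r)) -
      √2 * (√(π / (2 * Z)) / 2) * Real.sin (2 * Z + π / 4)| ≤
      4 / (2 * Z * √(2 * Z)) + (6 + 2 * Z) / S := by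
  have e : √((S * rootTwoAdd S) ^ 2 + 1) = 1 + S ^ 2 := by
    rw [mul_pow, rootTwoAdd_sq, show S ^ 2 * (2 + S ^ 2) + 1 = (1 + S ^ 2) ^ 2 by ring,
      Real.sqrt_sq (by positivity)]
  have hX : 0 ≤ S * rootTwoAdd S := mul_nonneg (by linarith) (rootTwoAdd_pos S).le
  have h := integral_sin_div_mul_cos_eq Z (S * rootTwoAdd S)
  rw [e, integral_sin_mul_sqrt_eq] at h
  rw [h]
  set l := 2 * Z with hldef
  have hl0 : 0 < l := by linarith
  have h1 := abs_integral_sin_mul_amplitude_le hl hS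
  have h2 := abs_integral_sin_mul_le hl0 hX
  have h3 := abs_boundary_le hl hS
  set I1 := ∫ s in (0 : ℝ)..S, Real.sin (l * (1 + s ^ 2)) * (2 * (1 + s ^ 2) / rootTwoAdd s)
  set I2 := ∫ x in (0 : ℝ)..(S * rootTwoAdd S), x / √(x ^ 2 + 1) * Real.sin (l * x)
  set P := Real.cos (l * (1 + S ^ 2)) * (S / rootTwoAdd S + S / (rootTwoAdd S + √2))
  set Q := Real.cos (l * (S * rootTwoAdd S)) *
        (S * rootTwoAdd S / √((S * rootTwoAdd S) ^ 2 + 1))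
  set M := √2 * (√(π / l) / 2) * Real.sin (l + π / 4)
  have e2 : I1 - I2 - M = (I1 - M + P / (2 * l)) - (I2 + Q / l) - (P / 2 - Q) / l := by
    field_simp; ring
  have h4 : |(P / 2 - Q) / l| ≤ (4 + l) / S := by
    rw [abs_div, abs_of_pos hl0]
    exact (div_le_self (abs_nonneg _) hl).trans h3
  have h5 : 2 / l ^ 2 ≤ 2 / (l * √l) := by
    have : √l ≤ l := by rw [Real.sqrt_le_left hl0.le]; nlinarith
    rw [sq]; gcongr
  have h6 : 2 / (l * S) ≤ 2 / S := by
    gcongr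
    exact le_mul_of_one_le_left (by linarith) hl
  have h7 : 4 / (l * √l) = 2 / (l * √l) + 2 / (l * √l) := by ring
  have h8 : (6 + l) / S = 2 / S + (4 + l) / S := by ring
  rw [e2, h7, h8]
  have h9 := abs_sub ((I1 - M + P / (2 * l)) - (I2 + Q / l)) ((P / 2 - Q) / l)
  have h10 := abs_sub (I1 - M + P / (2 * l)) (I2 + Q / l)
  linarith

/-- Truncations of the Voronoi kernel. -/
noncomputable def kernPartial (a b W : ℝ) : ℝ :=
  ∫ w in (0 : ℝ)..W, Real.sin (a / w) * Real.cos (b * w)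

lemma intervalIntegrable_sin_div_mul_cos (a b x y : ℝ) :
    IntervalIntegrable (fun w => Real.sin (a / w) * Real.cos (b * w)) MeasureTheory.volume x y := by
  refine (intervalIntegrable_const (c := (1 : ℝ))).mono_fun
    (by fun_prop : Measurable fun w => Real.sin (a / w) * Real.cos (b * w)).aestronglyMeasurable
    (Eventually.of_forall fun w => ?_)
  change ‖Real.sin (a / w) * Real.cos (b * w)‖ ≤ ‖(1 : ℝ)‖
  rw [norm_mul, norm_one]
  exact mul_le_one₀ (Real.abs_sin_le_one _) (norm_nonneg _) (Real.abs_cos_le_one _)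

lemma abs_kernPartial_sub_le {a b V W : ℝ} (ha : 0 ≤ a) (hb : 0 < b) (hV : 0 < V) (hVW : V ≤ W) :
    |kernPartial a b W - kernPartial a b V| ≤ 2 * a / (b * V) := by
  rw [kernPartial, kernPartial, intervalIntegral.integral_interval_sub_left
    (intervalIntegrable_sin_div_mul_cos ..) (intervalIntegrable_sin_div_mul_cos ..)]
  have hu : Set.uIcc V W = Set.Icc V W := Set.uIcc_of_le hVW
  have hpos : ∀ {w}, w ∈ Set.Icc V W → 0 < w := fun hw => hV.trans_le hw.1
  have hW : 0 < W := hV.trans_le hVW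
  have hinv : ∀ w ∈ Set.uIcc V W, HasDerivAt (fun w : ℝ => a / w) (-(a / w ^ 2)) w := by
    intro w hw
    have := hpos (hu ▸ hw)
    refine ((hasDerivAt_const w a).fun_div (hasDerivAt_id' w) this.ne').congr_deriv ?_
    field_simp; ring
  have hcd : ContinuousOn (fun w : ℝ => -(a / w ^ 2)) (Set.uIcc V W) := by
    rw [hu]
    intro w hw
    have := (pow_pos (hpos hw) 2).ne'
    exact ContinuousAt.continuousWithinAt (by fun_prop (disch := assumption))
  have hcos : ContinuousOn (fun w : ℝ => Real.cos (a / w)) (Set.uIcc V W) := by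
    rw [hu]
    intro w hw
    have := (hpos hw).ne'
    exact ContinuousAt.continuousWithinAt (by fun_prop (disch := assumption))
  have hv : ∀ w ∈ Set.uIcc V W,
      HasDerivAt (fun w => Real.sin (b * w) / b) (Real.cos (b * w)) w := by
    intro w _
    refine (((hasDerivAt_id' w).const_mul b).sin.div_const b).congr_deriv ?_
    field_simp
  have hparts := intervalIntegral.integral_mul_deriv_eq_deriv_mul
    (fun w hw => (hinv w hw).sin) hv (hcos.mul hcd).intervalIntegrable
    ((by fun_prop : Continuous _).intervalIntegrable _ _)
  rw [hparts]
  have hInt := intervalIntegral.integral_eq_sub_of_hasDerivAt hinv hcd.intervalIntegrable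
  rw [intervalIntegral.integral_neg] at hInt
  have hs : ∀ w, |Real.sin (b * w) / b| ≤ 1 / b := fun w => by
    rw [abs_div, abs_of_pos hb]; gcongr; exact Real.abs_sin_le_one _
  have h1 : ∀ w, 0 < w → |Real.sin (a / w) * (Real.sin (b * w) / b)| ≤ a / w * (1 / b) := by
    intro w hw
    rw [abs_mul]
    gcongr
    · have := Real.abs_sin_le_abs (x := a / w)
      rwa [abs_of_nonneg (by positivity : 0 ≤ a / w)] at this
    · exact hs w
  have h2 : |∫ w in V..W, Real.cos (a / w) * -(a / w ^ 2) * (Real.sin (b * w) / b)| ≤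
      (a / V - a / W) * (1 / b) := by
    have : a / V - a / W = ∫ w in V..W, a / w ^ 2 := by linarith
    rw [this, ← intervalIntegral.integral_mul_const, ← Real.norm_eq_abs]
    refine intervalIntegral.norm_integral_le_of_norm_le hVW (Eventually.of_forall fun w hw => ?_) ?_
    · have hw0 : 0 < w := hV.trans hw.1
      rw [norm_mul, norm_mul, norm_neg, Real.norm_of_nonneg (by positivity : 0 ≤ a / w ^ 2)]
      refine mul_le_mul ?_ (hs w) (norm_nonneg _) (by positivity)
      exact mul_le_of_le_one_left (by positivity) (Real.abs_cos_le_one _)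
    · have := hcd.neg.intervalIntegrable (μ := MeasureTheory.volume)
      simp only [Pi.neg_def, neg_neg] at this
      exact this.mul_const _
  have h3 := h1 V hV
  have h4 := h1 W hW
  have h5 := abs_sub (Real.sin (a / W) * (Real.sin (b * W) / b) -
    Real.sin (a / V) * (Real.sin (b * V) / b))
    (∫ w in V..W, Real.cos (a / w) * -(a / w ^ 2) * (Real.sin (b * w) / b))
  have h6 := abs_sub (Real.sin (a / W) * (Real.sin (b * W) / b))
    (Real.sin (a / V) * (Real.sin (b * V) / b))
  have e : 2 * a / (b * V) = a / W * (1 / b) + a / V * (1 / b) + (a / V - a / W) * (1 / b) := by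
    field_simp; ring
  rw [e]
  linarith

lemma abs_kernPartial_le (a b : ℝ) {W : ℝ} (hW : 0 ≤ W) : |kernPartial a b W| ≤ W := by
  have := intervalIntegral.norm_integral_le_of_norm_le_const (a := 0) (b := W) (C := 1)
    (f := fun w => Real.sin (a / w) * Real.cos (b * w)) fun w _ => by
      rw [norm_mul]
      exact mul_le_one₀ (Real.abs_sin_le_one _) (norm_nonneg _) (Real.abs_cos_le_one _)
  rwa [sub_zero, abs_of_nonneg hW, one_mul] at this

/-- The Voronoi kernel `∫_0^∞ sin(a/w) cos(bw) dw`, as an improper integral. -/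
noncomputable def kern (a b : ℝ) : ℝ := limUnder atTop (kernPartial a b)

lemma tendsto_kernPartial {a b : ℝ} (ha : 0 ≤ a) (hb : 0 < b) :
    Tendsto (kernPartial a b) atTop (nhds (kern a b)) := by
  refine tendsto_nhds_limUnder (cauchySeq_tendsto_of_complete ?_)
  rw [Metric.cauchySeq_iff']
  intro e he
  refine ⟨2 * a / (b * e) + 1, fun W hW => ?_⟩
  have hV : 0 < 2 * a / (b * e) + 1 := by positivity
  rw [Real.dist_eq]
  refine (abs_kernPartial_sub_le ha hb hV hW).trans_lt ?_
  rw [div_lt_iff₀ (by positivity)]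
  have : e * (b * (2 * a / (b * e) + 1)) = 2 * a + e * b := by field_simp
  rw [this]
  have : 0 < e * b := by positivity
  linarith

lemma abs_kern_sub_le {a b W : ℝ} (ha : 0 ≤ a) (hb : 0 < b) (hW : 0 < W) :
    |kern a b - kernPartial a b W| ≤ 2 * a / (b * W) := by
  refine le_of_tendsto (((tendsto_kernPartial ha hb).sub_const _).abs) ?_
  filter_upwards [eventually_ge_atTop W] with V hV
  exact abs_kernPartial_sub_le ha hb hW hV

lemma abs_kern_sub_main_le {a b : ℝ} (ha : 0 < a) (hb : 0 < b) (hl : 1 ≤ 2 * √(a * b)) :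
    |kern a b - √(a / b) * (√2 * (√(π / (2 * √(a * b))) / 2) * Real.sin (2 * √(a * b) + π / 4))| ≤
      √(a / b) * (4 / (2 * √(a * b) * √(2 * √(a * b)))) := by
  set Z := √(a * b) with hZ
  set q := √(a / b) with hq
  have hq0 : 0 < q := Real.sqrt_pos.2 (by positivity)
  have hZ0 : 0 < Z := Real.sqrt_pos.2 (by positivity)
  have haq : a = q * Z := by
    rw [hq, hZ, ← Real.sqrt_mul (by positivity)]
    have : a / b * (a * b) = a ^ 2 := by field_simp
    rw [this, Real.sqrt_sq ha.le]
  have hbq : b * q = Z := by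
    have h1 : q * q = a / b := Real.mul_self_sqrt (by positivity)
    have : q * (b * q) = q * Z := by rw [← haq]; field_simp at h1 ⊢; linarith
    exact mul_left_cancel₀ hq0.ne' this
  set M := √2 * (√(π / (2 * Z)) / 2) * Real.sin (2 * Z + π / 4)
  set R : ℝ → ℝ := fun S => S * rootTwoAdd S + (1 + S ^ 2) with hR
  have hRS : ∀ S, 1 ≤ S → S ≤ R S := fun S hS => by
    have := mul_pos (by linarith : 0 < S) (rootTwoAdd_pos S)
    simp only [hR]; nlinarith
  have hfin : ∀ S, 1 ≤ S → |kern a b - q * M| ≤ q * (4 / (2 * Z * √(2 * Z))) +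
      (q * (6 + 2 * Z) + 2 * a / (b * q) + q) / S := by
    intro S hS
    have hS0 : 0 < S := by linarith
    have hR1 := hRS S hS
    have hR0 : 0 < R S := by linarith
    have h1 := abs_integral_sin_div_mul_cos_sub_le hl hS
    change |(∫ r in (R S)⁻¹..(R S), Real.sin (Z / r) * Real.cos (Z * r)) - M| ≤ _ at h1
    have hscale : q * (∫ r in (R S)⁻¹..(R S), Real.sin (Z / r) * Real.cos (Z * r)) =
        kernPartial a b (q * R S) - kernPartial a b (q * (R S)⁻¹) := by
      rw [kernPartial, kernPartial, intervalIntegral.integral_interval_sub_left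
        (intervalIntegrable_sin_div_mul_cos ..) (intervalIntegrable_sin_div_mul_cos ..),
        ← intervalIntegral.mul_integral_comp_mul_left]
      congr 1
      refine intervalIntegral.integral_congr fun r _ => ?_
      rw [← mul_assoc, hbq, haq, mul_div_mul_left _ _ hq0.ne']
    have h2 := abs_kern_sub_le ha.le hb (mul_pos hq0 hR0)
    have h3 := abs_kernPartial_le a b (by positivity : 0 ≤ q * (R S)⁻¹)
    have h4 : 2 * a / (b * (q * R S)) ≤ 2 * a / (b * q) / S := by
      rw [div_div, mul_assoc b]; gcongr
    have h5 : q * (R S)⁻¹ ≤ q / S := by rw [div_eq_mul_inv]; gcongr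
    have h6 : |q * ((∫ r in (R S)⁻¹..(R S), Real.sin (Z / r) * Real.cos (Z * r)) - M)| ≤
        q * (4 / (2 * Z * √(2 * Z)) + (6 + 2 * Z) / S) := by
      rw [abs_mul, abs_of_pos hq0]; gcongr
    rw [mul_sub, hscale] at h6
    have e : (q * (6 + 2 * Z) + 2 * a / (b * q) + q) / S =
        q * ((6 + 2 * Z) / S) + 2 * a / (b * q) / S + q / S := by ring
    rw [e]
    rw [abs_le] at *
    constructor <;> linarith
  have hlim : Tendsto (fun S : ℝ => q * (4 / (2 * Z * √(2 * Z))) +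
      (q * (6 + 2 * Z) + 2 * a / (b * q) + q) / S) atTop
      (nhds (q * (4 / (2 * Z * √(2 * Z))) + 0)) :=
    tendsto_const_nhds.add (tendsto_const_nhds.div_atTop tendsto_id)
  rw [add_zero] at hlim
  refine ge_of_tendsto hlim ?_
  filter_upwards [eventually_ge_atTop 1] with S hS using hfin S hS

end KernelLimit

section Poisson

/-- A twice continuously differentiable function supported in `[0, β]`, together with its first two
derivatives. -/
structure IsC2On (β : ℝ) (B B₁ B₂ : ℝ → ℝ) : Prop where
  deriv_one : ∀ x, HasDerivAt B (B₁ x) x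
  deriv_two : ∀ x, HasDerivAt B₁ (B₂ x) x
  cont : Continuous B₂
  zero : ∀ x ∉ Set.Icc 0 β, B x = 0 ∧ B₁ x = 0 ∧ B₂ x = 0

variable {β : ℝ} {B B₁ B₂ : ℝ → ℝ}

lemma hasCompactSupport_of_eq_zero {a b : ℝ} {F : ℝ → ℝ} (h : ∀ x ∉ Set.Icc a b, F x = 0) :
    HasCompactSupport F :=
  HasCompactSupport.intro isCompact_Icc h

lemma integrable_of_eq_zero {a b : ℝ} {F : ℝ → ℝ} (hc : Continuous F)
    (h : ∀ x ∉ Set.Icc a b, F x = 0) : MeasureTheory.Integrable F :=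
  hc.integrable_of_hasCompactSupport (hasCompactSupport_of_eq_zero h)

lemma IsC2On.cont_zero (h : IsC2On β B B₁ B₂) : Continuous B :=
  continuous_iff_continuousAt.2 fun x => (h.deriv_one x).continuousAt

lemma IsC2On.cont_one (h : IsC2On β B B₁ B₂) : Continuous B₁ :=
  continuous_iff_continuousAt.2 fun x => (h.deriv_two x).continuousAt

lemma re_fourier_ofReal {F : ℝ → ℝ} (hF : MeasureTheory.Integrable F) (ξ : ℝ) :
    (FourierTransform.fourier (fun x => (F x : ℂ)) ξ).re =
      ∫ u, F u * Real.cos (2 * π * u * ξ) := by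
  have hi : MeasureTheory.Integrable fun v =>
      Complex.exp (↑(-2 * π * v * ξ) * Complex.I) • (F v : ℂ) := by
    have h1 := hF.ofReal (𝕜 := ℂ)
    refine h1.bdd_mul (c := 1) (by fun_prop) (Eventually.of_forall fun v => ?_)
    rw [Complex.norm_exp_ofReal_mul_I]
  rw [Real.fourier_eq', ← RCLike.re_eq_complex_re]
  have e : ∀ v : ℝ, (↑(-2 * π * inner ℝ v ξ) : ℂ) = ↑(-2 * π * v * ξ) := fun v => by
    simp only [RCLike.inner_apply, conj_trivial]; congr 1; ring
  simp only [e]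
  rw [← integral_re hi]
  refine MeasureTheory.integral_congr_ae (Eventually.of_forall fun v => ?_)
  simp only [smul_eq_mul, RCLike.re_eq_complex_re, Complex.mul_re, Complex.ofReal_re,
    Complex.ofReal_im, mul_zero, sub_zero, Complex.exp_ofReal_mul_I_re]
  rw [mul_comm, ← Real.cos_neg]
  congr 2; ring

lemma IsC2On.fourier_eq (h : IsC2On β B B₁ B₂) (ξ : ℝ) :
    FourierTransform.fourier (fun x => (B₂ x : ℂ)) ξ =
      -(((4 * π ^ 2 * ξ ^ 2 : ℝ) : ℂ) * FourierTransform.fourier (fun x => (B x : ℂ)) ξ) := by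
  have hB : MeasureTheory.Integrable fun x => (B x : ℂ) :=
      (integrable_of_eq_zero h.cont_zero fun x hx => (h.zero x hx).1).ofReal (𝕜 := ℂ)
  have hB1 : MeasureTheory.Integrable fun x => (B₁ x : ℂ) :=
      (integrable_of_eq_zero h.cont_one fun x hx => (h.zero x hx).2.1).ofReal (𝕜 := ℂ)
  have hB2 : MeasureTheory.Integrable fun x => (B₂ x : ℂ) :=
      (integrable_of_eq_zero h.cont fun x hx => (h.zero x hx).2.2).ofReal (𝕜 := ℂ)
  have d1 : ∀ x, HasDerivAt (fun x => (B x : ℂ)) (B₁ x : ℂ) x := fun x =>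
    (h.deriv_one x).ofReal_comp
  have d2 : ∀ x, HasDerivAt (fun x => (B₁ x : ℂ)) (B₂ x : ℂ) x := fun x =>
    (h.deriv_two x).ofReal_comp
  have e1 : deriv (fun x => (B x : ℂ)) = fun x => (B₁ x : ℂ) := funext fun x => (d1 x).deriv
  have e2 : deriv (fun x => (B₁ x : ℂ)) = fun x => (B₂ x : ℂ) := funext fun x => (d2 x).deriv
  have f1 := congrFun (Real.fourier_deriv hB (fun x => (d1 x).differentiableAt) (e1 ▸ hB1)) ξ
  have f2 := congrFun (Real.fourier_deriv hB1 (fun x => (d2 x).differentiableAt) (e2 ▸ hB2)) ξ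
  rw [e1] at f1
  rw [e2, f1] at f2
  rw [f2]
  simp only [smul_eq_mul]
  push_cast
  ring_nf
  rw [Complex.I_sq]
  ring

lemma IsC2On.integral_mul_cos_eq (h : IsC2On β B B₁ B₂) {ξ : ℝ} (hξ : ξ ≠ 0) :
    ∫ u, B u * Real.cos (2 * π * u * ξ) =
      -(∫ u, B₂ u * Real.cos (2 * π * u * ξ)) / (4 * π ^ 2 * ξ ^ 2) := by
  rw [← re_fourier_ofReal (integrable_of_eq_zero h.cont_zero fun x hx => (h.zero x hx).1),
    ← re_fourier_ofReal (integrable_of_eq_zero h.cont fun x hx => (h.zero x hx).2.2),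
    h.fourier_eq, Complex.neg_re, Complex.re_ofReal_mul]
  field_simp

lemma IsC2On.norm_fourier_le (h : IsC2On β B B₁ B₂) {ξ : ℝ} (hξ : ξ ≠ 0) :
    ‖FourierTransform.fourier (fun x => (B x : ℂ)) ξ‖ ≤ (∫ u, |B₂ u|) * |ξ| ^ (-2 : ℝ) := by
  have h1 : ‖FourierTransform.fourier (fun x => (B₂ x : ℂ)) ξ‖ ≤ ∫ u, |B₂ u| := by
    refine (VectorFourier.norm_fourierIntegral_le_integral_norm _ _ _ _ _).trans_eq ?_
    simp only [Complex.norm_real, Real.norm_eq_abs]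
  rw [h.fourier_eq, norm_neg, norm_mul, Complex.norm_real,
    Real.norm_of_nonneg (by positivity)] at h1
  rw [Real.rpow_neg (abs_nonneg _), ← div_eq_mul_inv, le_div_iff₀ (by positivity)]
  refine le_trans ?_ h1
  rw [mul_comm]
  gcongr
  rw [Real.rpow_two, sq_abs]
  have : 1 ≤ 4 * π ^ 2 := by nlinarith [Real.pi_gt_three]
  nlinarith [sq_nonneg ξ]

/-- Poisson summation for twice continuously differentiable functions supported in `[0, β]`. -/
lemma IsC2On.hasSum_poisson (h : IsC2On β B B₁ B₂) (h0 : B 0 = 0) :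
    HasSum (fun k : ℕ => 2 * ∫ u, B u * Real.cos (2 * π * u * (k + 1 : ℝ)))
      ((∑' b : ℕ, B (b + 1)) - ∫ u, B u) := by
  have hInt := integrable_of_eq_zero h.cont_zero fun x hx => (h.zero x hx).1
  have hF : FourierTransform.fourier (fun x => (B x : ℂ)) =O[cocompact ℝ] (|·| ^ (-2 : ℝ)) := by
    refine IsBigO.of_bound (∫ u, |B₂ u|) ?_
    have : ∀ᶠ x : ℝ in cocompact ℝ, x ≠ 0 := by
      have := (isCompact_singleton (x := (0 : ℝ))).compl_mem_cocompact
      filter_upwards [this] with x hx using hx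
    filter_upwards [this] with x hx
    refine (h.norm_fourier_le hx).trans ?_
    gcongr
    exact le_abs_self _
  have hBO : (fun x => (B x : ℂ)) =O[cocompact ℝ] (|·| ^ (-2 : ℝ)) := by
    have : (fun x => (B x : ℂ)) =ᶠ[cocompact ℝ] fun _ => 0 := by
      filter_upwards [(isCompact_Icc (a := (0 : ℝ)) (b := β)).compl_mem_cocompact] with x hx
      rw [(h.zero x hx).1, Complex.ofReal_zero]
    exact this.trans_isBigO (isBigO_zero _ _)
  have hsum : Summable fun n : ℤ => FourierTransform.fourier (fun x => (B x : ℂ)) (n : ℝ) :=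
    summable_of_isBigO (Real.summable_abs_int_rpow one_lt_two)
      (hF.comp_tendsto Int.tendsto_coe_cofinite)
  have hP := Real.tsum_eq_tsum_fourier_of_rpow_decay
    (Complex.continuous_ofReal.comp h.cont_zero) one_lt_two hBO hF 0
  simp only [Function.comp_def, zero_add, QuotientAddGroup.mk_zero, fourier_eval_zero,
    mul_one] at hP
  have hre : HasSum (fun n : ℤ => ∫ u, B u * Real.cos (2 * π * u * (n : ℝ))) (∑' n : ℤ, B n) := by
    have h1 := Complex.hasSum_re hsum.hasSum
    rw [← hP] at h1
    simp only [re_fourier_ofReal hInt] at h1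
    convert h1
    rw [← Complex.ofReal_tsum, Complex.ofReal_re]
  have h2 := hre.nat_add_neg
  have h3 := (hasSum_nat_add_iff' 1).2 h2
  have h4 : ∑' n : ℤ, B n = ∑' b : ℕ, B (b + 1) := by
    have hinj : Function.Injective fun b : ℕ => (b + 1 : ℤ) := fun a b h => by simpa using h
    rw [← hinj.tsum_eq (f := fun n : ℤ => B n)]
    · simp
    · intro n hn
      have hn0 : 0 < n := by
        by_contra hcon
        apply hn
        rcases (not_lt.1 hcon).lt_or_eq with h5 | h5
        · refine (h.zero _ fun h6 => ?_).1
          have := h6.1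
          norm_cast at this
          omega
        · simpa [h5] using h0
      refine ⟨(n - 1).toNat, ?_⟩
      simp only
      omega
  rw [h4] at h3
  have e1 : (fun k : ℕ => 2 * ∫ u, B u * Real.cos (2 * π * u * (k + 1 : ℝ))) =
      fun k : ℕ => (∫ u, B u * Real.cos (2 * π * u * ((k + 1 : ℕ) : ℤ))) +
        ∫ u, B u * Real.cos (2 * π * u * (-((k + 1 : ℕ) : ℤ) : ℤ)) := by
    funext k
    push_cast
    rw [two_mul]
    congr 1
    refine MeasureTheory.integral_congr_ae (Eventually.of_forall fun u => ?_)
    change _ = B u * Real.cos (2 * π * u * (-(k + 1)))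
    rw [mul_neg, Real.cos_neg]
  rw [e1]
  have e2 : (∑' b : ℕ, B (b + 1)) - ∫ u, B u = ((∑' b : ℕ, B (b + 1)) +
      ∫ u, B u * Real.cos (2 * π * u * ((0 : ℤ) : ℝ))) - ∑ i ∈ Finset.range 1,
        ((∫ u, B u * Real.cos (2 * π * u * ((i : ℤ) : ℝ))) +
          ∫ u, B u * Real.cos (2 * π * u * ((-i : ℤ) : ℝ))) := by
    simp
  rw [e2]
  exact h3

end Poisson

section TestFunctions

/-- Smooth functions supported in the interval `[α, β]` with `0 < α`. -/
structure IsTest (α β : ℝ) (F : ℝ → ℝ) : Prop where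
  pos : 0 < α
  smooth : ContDiff ℝ (⊤ : ℕ∞) F
  zero : ∀ u ∉ Set.Icc α β, F u = 0

/-- The Euler operator `F ↦ u F'(u)`. -/
noncomputable def euler (F : ℝ → ℝ) (u : ℝ) : ℝ := u * deriv F u

variable {α β : ℝ} {F G : ℝ → ℝ}

lemma IsTest.hasDerivAt (h : IsTest α β F) (u : ℝ) : HasDerivAt F (deriv F u) u :=
  (h.smooth.differentiable (by simp) u).hasDerivAt

lemma IsTest.continuous (h : IsTest α β F) : Continuous F := h.smooth.continuous

lemma IsTest.integrable (h : IsTest α β F) : MeasureTheory.Integrable F :=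
  integrable_of_eq_zero h.continuous h.zero

lemma IsTest.isTest_deriv (h : IsTest α β F) : IsTest α β (deriv F) where
  pos := h.pos
  smooth := (contDiff_infty_iff_deriv.1 h.smooth).2
  zero := fun u hu => by
    have : F =ᶠ[nhds u] fun _ => 0 := by
      filter_upwards [isClosed_Icc.isOpen_compl.mem_nhds hu] with v hv using h.zero v hv
    rw [this.deriv_eq, deriv_const]

lemma IsTest.mul_left (h : IsTest α β F) (hG : ContDiff ℝ (⊤ : ℕ∞) G) :
    IsTest α β fun u => G u * F u where
  pos := h.pos
  smooth := hG.mul h.smooth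
  zero := fun u hu => by rw [h.zero u hu, mul_zero]

lemma IsTest.sub (h : IsTest α β F) (hG : IsTest α β G) : IsTest α β fun u => F u - G u where
  pos := h.pos
  smooth := h.smooth.sub hG.smooth
  zero := fun u hu => by rw [h.zero u hu, hG.zero u hu, sub_zero]

lemma IsTest.isTest_euler (h : IsTest α β F) : IsTest α β (euler F) :=
  h.isTest_deriv.mul_left contDiff_id

lemma IsTest.comp_mul (h : IsTest α β F) {t : ℝ} (ht : 0 < t) :
    IsTest (α / t) (β / t) fun u => F (t * u) where
  pos := div_pos h.pos ht
  smooth := h.smooth.comp (contDiff_const.mul contDiff_id)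
  zero := fun _ hu => h.zero _ fun hc => hu
    ⟨(div_le_iff₀' ht).2 hc.1, (le_div_iff₀' ht).2 hc.2⟩

lemma IsTest.isC2On (h : IsTest α β F) : IsC2On β F (deriv F) (deriv (deriv F)) where
  deriv_one := h.hasDerivAt
  deriv_two := h.isTest_deriv.hasDerivAt
  cont := h.isTest_deriv.isTest_deriv.continuous
  zero := fun x hx => by
    have hx' : x ∉ Set.Icc α β := fun hc => hx ⟨h.pos.le.trans hc.1, hc.2⟩
    exact ⟨h.zero x hx', h.isTest_deriv.zero x hx', h.isTest_deriv.isTest_deriv.zero x hx'⟩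

lemma IsTest.integral_euler (h : IsTest α β F) : ∫ u, euler F u = -∫ u, F u := by
  have hd : ∀ u, HasDerivAt (fun u => u * F u) (F u + euler F u) u := fun u =>
    ((hasDerivAt_id' u).fun_mul (h.hasDerivAt u)).congr_deriv (by rw [one_mul]; rfl)
  have := MeasureTheory.integral_eq_zero_of_hasDerivAt_of_integrable hd
    (h.integrable.add h.isTest_euler.integrable) (h.mul_left contDiff_id).integrable
  rw [MeasureTheory.integral_add h.integrable h.isTest_euler.integrable] at this
  linarith

/-- A scaled cosine transform. -/
noncomputable def cosTransform (F : ℝ → ℝ) (w : ℝ) : ℝ :=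
  w⁻¹ * ∫ u, F u * Real.cos (2 * π * u / w)

lemma abs_cosTransform_le (F : ℝ → ℝ) {w : ℝ} (hF : MeasureTheory.Integrable F) (hw : 0 < w) :
    |cosTransform F w| ≤ w⁻¹ * ∫ u, |F u| := by
  rw [cosTransform, abs_mul, abs_of_pos (inv_pos.2 hw)]
  gcongr
  refine MeasureTheory.norm_integral_le_of_norm_le
    (f := fun u => F u * Real.cos (2 * π * u / w)) hF.norm (Eventually.of_forall fun u => ?_)
  rw [norm_mul]
  exact mul_le_of_le_one_right (norm_nonneg _) (Real.abs_cos_le_one _)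

lemma IsTest.cosTransform_eq (h : IsTest α β F) {w : ℝ} (hw : 0 < w) :
    cosTransform F w =
      -(w ^ 2 / (4 * π ^ 2)) * cosTransform (deriv (deriv F)) w := by
  have := h.isC2On.integral_mul_cos_eq (inv_ne_zero hw.ne')
  simp only [← div_eq_mul_inv] at this
  rw [cosTransform, this, cosTransform]
  field_simp

lemma IsTest.exists_abs_cosTransform_le (h : IsTest α β F) :
    ∃ C, 0 ≤ C ∧ ∀ w, 0 < w → |cosTransform F w| ≤ C * w ^ 3 := by
  refine ⟨∫ u, |deriv (deriv (deriv (deriv F))) u|,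
    MeasureTheory.integral_nonneg fun _ => abs_nonneg _, fun w hw => ?_⟩
  have h1 := abs_cosTransform_le _
    h.isTest_deriv.isTest_deriv.isTest_deriv.isTest_deriv.integrable hw
  rw [h.cosTransform_eq hw, h.isTest_deriv.isTest_deriv.cosTransform_eq hw, abs_mul,
    abs_mul, abs_neg,
    abs_of_nonneg (by positivity : 0 ≤ w ^ 2 / (4 * π ^ 2))]
  have h2 : w ^ 2 / (4 * π ^ 2) ≤ w ^ 2 :=
    div_le_self (by positivity) (by nlinarith [Real.pi_gt_three])
  calc _ ≤ w ^ 2 * (w ^ 2 * (w⁻¹ * _)) := by gcongr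
    _ = _ := by field_simp

lemma IsTest.integrable_mul (h : IsTest α β F) (hG : Continuous G) :
    MeasureTheory.Integrable fun u => F u * G u :=
  integrable_of_eq_zero (a := α) (b := β) (h.continuous.mul hG) fun u hu => by
    rw [h.zero u hu, zero_mul]

lemma IsTest.integrable_mul_cos (h : IsTest α β F) (w : ℝ) :
    MeasureTheory.Integrable fun u => F u * Real.cos (2 * π * u / w) :=
  h.integrable_mul (by fun_prop)

lemma IsTest.hasDerivAt_cosTransform (h : IsTest α β F) {w : ℝ} (hw : 0 < w) :
    HasDerivAt (cosTransform F) (w⁻¹ * cosTransform (euler F) w) w := by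
  have hβ : 0 ≤ |β| := abs_nonneg _
  have hd : HasDerivAt (fun w => ∫ u, F u * Real.cos (2 * π * u / w))
      (∫ u, F u * (Real.sin (2 * π * u / w) * (2 * π * u / w ^ 2))) w := by
    refine (hasDerivAt_integral_of_dominated_loc_of_deriv_le
      (F := fun w u => F u * Real.cos (2 * π * u / w))
      (F' := fun w u => F u * (Real.sin (2 * π * u / w) * (2 * π * u / w ^ 2)))
      (bound := fun u => |F u| * (1 * (2 * π * |β| / (w / 2) ^ 2)))
      (Metric.ball_mem_nhds w (half_pos hw)) (Eventually.of_forall fun v =>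
        (h.integrable_mul_cos v).aestronglyMeasurable) (h.integrable_mul_cos w) ?_ ?_ ?_ ?_).2
    · exact (h.continuous.mul (by fun_prop)).aestronglyMeasurable
    · refine Eventually.of_forall fun u v hv => ?_
      rw [Metric.mem_ball, Real.dist_eq, abs_lt] at hv
      by_cases hu : u ∈ Set.Icc α β
      · have hu0 : 0 < u := h.pos.trans_le hu.1
        have hub : u ≤ |β| := hu.2.trans (le_abs_self _)
        have hv0 : w / 2 ≤ v := by linarith
        have : 0 < v := by linarith
        rw [norm_mul, norm_mul, Real.norm_of_nonneg (by positivity : 0 ≤ 2 * π * u / v ^ 2)]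
        change |F u| * _ ≤ _
        gcongr
        exact Real.abs_sin_le_one _
      · rw [h.zero u hu]
        simp
    · exact h.integrable.abs.mul_const _
    · refine Eventually.of_forall fun u v hv => ?_
      rw [Metric.mem_ball, Real.dist_eq, abs_lt] at hv
      have hv0 : v ≠ 0 := by linarith
      refine ((((hasDerivAt_const v (2 * π * u)).fun_div (hasDerivAt_id' v) hv0).cos).const_mul
        (F u)).congr_deriv ?_
      field_simp
      ring
  refine ((hasDerivAt_inv hw.ne').fun_mul hd).congr_deriv ?_
  have hp : ∀ u, HasDerivAt (fun u => F u * (u * Real.cos (2 * π * u / w)))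
      (euler F u * Real.cos (2 * π * u / w) + F u * Real.cos (2 * π * u / w) -
        w * (F u * (Real.sin (2 * π * u / w) * (2 * π * u / w ^ 2)))) u := by
    intro u
    refine ((h.hasDerivAt u).fun_mul ((hasDerivAt_id' u).fun_mul
      (((hasDerivAt_id' u).const_mul (2 * π)).div_const w).cos)).congr_deriv ?_
    rw [euler]
    field_simp
    ring
  have i1 := h.isTest_euler.integrable_mul_cos w
  have i2 := h.integrable_mul_cos w
  have i3 : MeasureTheory.Integrable fun u =>
      w * (F u * (Real.sin (2 * π * u / w) * (2 * π * u / w ^ 2))) :=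
    (h.integrable_mul (by fun_prop)).const_mul _
  have hz := MeasureTheory.integral_eq_zero_of_hasDerivAt_of_integrable hp ((i1.add i2).sub i3)
    (h.integrable_mul (by fun_prop))
  rw [MeasureTheory.integral_sub (by exact i1.add i2) i3, MeasureTheory.integral_add i1 i2,
    MeasureTheory.integral_const_mul] at hz
  rw [cosTransform]
  generalize (∫ u, F u * (Real.sin (2 * π * u / w) * (2 * π * u / w ^ 2))) = I₃ at hz ⊢
  generalize (∫ u, F u * Real.cos (2 * π * u / w)) = I₂ at hz ⊢
  generalize (∫ u, euler F u * Real.cos (2 * π * u / w)) = I₁ at hz ⊢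
  field_simp
  linarith

lemma IsTest.cosTransform_sub (h : IsTest α β F) (hG : IsTest α β G) (w : ℝ) :
    cosTransform (fun u => F u - G u) w = cosTransform F w - cosTransform G w := by
  simp only [cosTransform, sub_mul]
  rw [MeasureTheory.integral_sub (h.integrable_mul_cos w) (hG.integrable_mul_cos w), mul_sub]

end TestFunctions

section DilationSums

/-- The sum of a function over the positive multiples of `t`. -/
noncomputable def dilSum (F : ℝ → ℝ) (t : ℝ) : ℝ := ∑' b : ℕ, F ((b + 1) * t)

variable {α β : ℝ} {F G : ℝ → ℝ}

lemma IsTest.apply_nonpos (h : IsTest α β F) {u : ℝ} (hu : u ≤ 0) : F u = 0 :=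
  h.zero u fun hc => (h.pos.trans_le hc.1).not_ge hu

lemma IsTest.dilSum_of_nonpos (h : IsTest α β F) {t : ℝ} (ht : t ≤ 0) : dilSum F t = 0 := by
  have : ∀ b : ℕ, F ((b + 1) * t) = 0 := fun b =>
    h.apply_nonpos (mul_nonpos_of_nonneg_of_nonpos (by positivity) ht)
  simp [dilSum, this]

lemma IsTest.dilSum_eq_sum (h : IsTest α β F) {t : ℝ} {N : ℕ} (hN : β < (N + 1) * t)
    (ht : 0 < t) : dilSum F t = ∑ b ∈ Finset.range N, F ((b + 1) * t) := by
  refine tsum_eq_sum fun b hb => h.zero _ fun hc => ?_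
  rw [Finset.mem_range, not_lt] at hb
  have : (N : ℝ) ≤ b := by exact_mod_cast hb
  have := hc.2
  nlinarith

lemma IsTest.dilSum_of_notMem (h : IsTest α β F) {t : ℝ} (ht : t ∉ Set.Icc 0 β) :
    dilSum F t = 0 := by
  rcases le_or_gt t 0 with h0 | h0
  · exact h.dilSum_of_nonpos h0
  · have hβ : β < t := by
      by_contra hcon
      exact ht ⟨h0.le, not_lt.1 hcon⟩
    rw [h.dilSum_eq_sum (N := 0) (by simpa using hβ) h0, Finset.sum_range_zero]

lemma IsTest.hasSum_cosTransform (h : IsTest α β F) (h0 : ∫ u, F u = 0) {t : ℝ} (ht : 0 < t) :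
    HasSum (fun k : ℕ => 2 * ((k + 1 : ℝ)⁻¹ * cosTransform F (t / (k + 1)))) (dilSum F t) := by
  have hs := h.comp_mul ht
  have hP := hs.isC2On.hasSum_poisson (hs.apply_nonpos le_rfl)
  rw [MeasureTheory.Measure.integral_comp_mul_left, h0, smul_zero, sub_zero] at hP
  simp only [mul_comm t] at hP
  rw [dilSum]
  convert hP using 3 with k
  have h1 := MeasureTheory.Measure.integral_comp_mul_right
    (fun u => F u * Real.cos (2 * π * u / (t / (k + 1)))) t
  rw [abs_of_pos (inv_pos.2 ht), smul_eq_mul] at h1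
  have h2 : ∀ u, 2 * π * (u * t) / (t / (k + 1)) = 2 * π * u * (k + 1) := fun u => by
    field_simp
  simp only [h2] at h1
  rw [h1, cosTransform]
  field_simp

lemma IsTest.exists_abs_dilSum_le (h : IsTest α β F) (h0 : ∫ u, F u = 0) :
    ∃ C, 0 ≤ C ∧ ∀ t, |dilSum F t| ≤ C * |t| ^ 3 := by
  obtain ⟨C, hC, hb⟩ := h.exists_abs_cosTransform_le
  have hs : Summable fun k : ℕ => ((k + 1 : ℝ) ^ 2)⁻¹ := by
    have := (summable_nat_add_iff 1).2 (Real.summable_nat_pow_inv.2 one_lt_two)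
    simpa using this
  refine ⟨2 * C * ∑' k : ℕ, ((k + 1 : ℝ) ^ 2)⁻¹, by positivity, fun t => ?_⟩
  rcases le_or_gt t 0 with ht | ht
  · rw [h.dilSum_of_nonpos ht, abs_zero]; positivity
  rw [abs_of_pos ht]
  have h1 := hs.hasSum.mul_left (2 * C * t ^ 3)
  have := tsum_of_norm_bounded h1 (f := fun k : ℕ =>
    2 * ((k + 1 : ℝ)⁻¹ * cosTransform F (t / (k + 1)))) fun k => ?_
  · rw [(h.hasSum_cosTransform h0 ht).tsum_eq] at this
    calc _ ≤ _ := this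
      _ = _ := by ring
  · have hk : (0 : ℝ) < k + 1 := by positivity
    rw [norm_mul, norm_mul, Real.norm_of_nonneg zero_le_two, Real.norm_of_nonneg (inv_pos.2 hk).le,
      Real.norm_eq_abs]
    calc _ ≤ 2 * ((k + 1 : ℝ)⁻¹ * (C * (t / (k + 1)) ^ 3)) := by
          gcongr; exact hb _ (div_pos ht hk)
      _ = 2 * C * t ^ 3 * (((k + 1 : ℝ) ^ 2)⁻¹ * ((k + 1 : ℝ) ^ 2)⁻¹) := by field_simp
      _ ≤ 2 * C * t ^ 3 * (((k + 1 : ℝ) ^ 2)⁻¹ * 1) := by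
          gcongr
          refine inv_le_one_of_one_le₀ (one_le_pow₀ ?_)
          linarith [(Nat.cast_nonneg k : (0 : ℝ) ≤ k)]
      _ = _ := by ring

lemma exists_lt_natCast_add_one_mul {t : ℝ} (ht : 0 < t) (β : ℝ) : ∃ N : ℕ, β < (N + 1) * t := by
  obtain ⟨N, hN⟩ := exists_nat_gt (β / t)
  refine ⟨N, ?_⟩
  rw [div_lt_iff₀ ht] at hN
  linarith

lemma IsTest.dilSum_sub (h : IsTest α β F) (hG : IsTest α β G) (t : ℝ) :
    dilSum (fun u => F u - G u) t = dilSum F t - dilSum G t := by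
  rcases le_or_gt t 0 with ht | ht
  · rw [h.dilSum_of_nonpos ht, hG.dilSum_of_nonpos ht, (h.sub hG).dilSum_of_nonpos ht, sub_zero]
  obtain ⟨N, hN⟩ := exists_lt_natCast_add_one_mul ht β
  rw [h.dilSum_eq_sum hN ht, hG.dilSum_eq_sum hN ht, (h.sub hG).dilSum_eq_sum hN ht,
    Finset.sum_sub_distrib]

lemma IsTest.hasDerivAt_dilSum (h : IsTest α β F) {t : ℝ} (ht : 0 < t) :
    HasDerivAt (dilSum F) (t⁻¹ * dilSum (euler F) t) t := by
  obtain ⟨N, hN⟩ := exists_lt_natCast_add_one_mul (half_pos ht) β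
  have hev : dilSum F =ᶠ[nhds t] fun s => ∑ b ∈ Finset.range N, F ((b + 1) * s) := by
    filter_upwards [lt_mem_nhds (half_lt_self ht)] with s hs
    refine h.dilSum_eq_sum (hN.trans ?_) ((half_pos ht).trans hs)
    gcongr
  rw [h.isTest_euler.dilSum_eq_sum (N := N) (hN.trans (by gcongr; linarith)) ht]
  refine HasDerivAt.congr_of_eventuallyEq ?_ hev
  rw [Finset.mul_sum]
  refine HasDerivAt.fun_sum fun b _ => ?_
  refine ((h.hasDerivAt ((b + 1) * t)).comp
    t ((hasDerivAt_id' t).const_mul (b + 1 : ℝ))).congr_deriv ?_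
  rw [euler]
  field_simp

lemma hasDerivAt_zero_of_abs_le {P : ℝ → ℝ} {C : ℝ} {n : ℕ} (hn : 1 < n)
    (h : ∀ t, |P t| ≤ C * |t| ^ n) : HasDerivAt P 0 0 := by
  have : P =O[nhds 0] fun t => ‖t - 0‖ ^ n := by
    refine IsBigO.of_bound C (Eventually.of_forall fun t => ?_)
    simpa using h t
  have := (this.hasFDerivAt hn).hasDerivAt
  simpa using this

/-- The function `u² F''(u)`. -/
noncomputable def eulerTwo (F : ℝ → ℝ) (u : ℝ) : ℝ := euler (euler F) u - euler F u

lemma IsTest.isTest_eulerTwo (h : IsTest α β F) : IsTest α β (eulerTwo F) :=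
  h.isTest_euler.isTest_euler.sub h.isTest_euler

lemma IsTest.integral_euler_eq_zero (h : IsTest α β F) (h0 : ∫ u, F u = 0) :
    ∫ u, euler F u = 0 := by rw [h.integral_euler, h0, neg_zero]

lemma IsTest.integral_eulerTwo (h : IsTest α β F) (h0 : ∫ u, F u = 0) :
    ∫ u, eulerTwo F u = 0 := by
  simp only [eulerTwo]
  rw [MeasureTheory.integral_sub h.isTest_euler.isTest_euler.integrable h.isTest_euler.integrable,
    h.isTest_euler.integral_euler, h.integral_euler, h0]
  simp

lemma IsTest.isC2On_dilSum (h : IsTest α β F) (h0 : ∫ u, F u = 0) :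
    IsC2On β (dilSum F) (fun t => t⁻¹ * dilSum (euler F) t)
      (fun t => (t ^ 2)⁻¹ * dilSum (eulerTwo F) t) := by
  have h1 := h.isTest_euler
  have h2 := h.isTest_eulerTwo
  have hneg : ∀ {P : ℝ → ℝ}, IsTest α β P → ∀ {t : ℝ}, t < 0 → dilSum P =ᶠ[nhds t] fun _ => 0 := by
    intro P hP t ht
    filter_upwards [gt_mem_nhds ht] with s hs using hP.dilSum_of_nonpos hs.le
  refine ⟨fun t => ?_, fun t => ?_, ?_, fun t ht => ?_⟩
  · rcases lt_trichotomy t 0 with ht | rfl | ht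
    · rw [h1.dilSum_of_nonpos ht.le, mul_zero]
      exact (hasDerivAt_const t (0 : ℝ)).congr_of_eventuallyEq (hneg h ht)
    · obtain ⟨C, _, hC⟩ := h.exists_abs_dilSum_le h0
      simpa using hasDerivAt_zero_of_abs_le (by norm_num) hC
    · exact h.hasDerivAt_dilSum ht
  · rcases lt_trichotomy t 0 with ht | rfl | ht
    · rw [h2.dilSum_of_nonpos ht.le, mul_zero]
      refine (hasDerivAt_const t (0 : ℝ)).congr_of_eventuallyEq ?_
      filter_upwards [hneg h1 ht] with s hs
      rw [hs, mul_zero]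
    · obtain ⟨C, _, hC⟩ := h1.exists_abs_dilSum_le (h.integral_euler_eq_zero h0)
      have := hasDerivAt_zero_of_abs_le (P := fun t => t⁻¹ * dilSum (euler F) t) (C := C) (n := 2)
        (by norm_num) fun t => ?_
      · simpa using this
      · rcases eq_or_ne t 0 with rfl | ht
        · simp
        · rw [abs_mul, abs_inv, inv_mul_le_iff₀ (abs_pos.2 ht)]
          exact (hC t).trans_eq (by ring)
    · refine ((hasDerivAt_inv ht.ne').fun_mul (h1.hasDerivAt_dilSum ht)).congr_deriv ?_
      change _ = (t ^ 2)⁻¹ * dilSum (fun u => euler (euler F) u - euler F u) t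
      rw [h1.isTest_euler.dilSum_sub h1]
      field_simp
      ring
  · rw [continuous_iff_continuousAt]
    intro t
    rcases lt_trichotomy t 0 with ht | rfl | ht
    · refine (continuousAt_const (y := (0 : ℝ))).congr ?_
      filter_upwards [hneg h2 ht] with s hs
      rw [hs, mul_zero]
    · obtain ⟨C, _, hC⟩ := h2.exists_abs_dilSum_le (h.integral_eulerTwo h0)
      have hb : ∀ t, |(t ^ 2)⁻¹ * dilSum (eulerTwo F) t| ≤ C * |t| := by
        intro t
        rcases eq_or_ne t 0 with rfl | ht
        · simp
        · rw [abs_mul, abs_inv, abs_pow, inv_mul_le_iff₀ (by positivity)]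
          exact (hC t).trans_eq (by ring)
      rw [ContinuousAt]
      have e : ((0 : ℝ) ^ 2)⁻¹ * dilSum (eulerTwo F) 0 = 0 := by simp
      rw [e]
      refine squeeze_zero_norm hb ?_
      have : Continuous fun t : ℝ => C * |t| := by fun_prop
      simpa using this.tendsto 0
    · have := (h2.hasDerivAt_dilSum ht).continuousAt
      have h3 : t ^ 2 ≠ 0 := by positivity
      exact ((continuousAt_id.pow 2).inv₀ h3).mul this
  · rw [h.dilSum_of_notMem ht, h1.dilSum_of_notMem ht, h2.dilSum_of_notMem ht]
    simp

end DilationSums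

section DoubleSums

lemma hasSum_dR_mul {F : ℕ → ℝ}
    (hs : Summable fun p : ℕ × ℕ => F ((p.1 + 1) * (p.2 + 1))) :
    HasSum (fun n => dR n * F n) (∑' m : ℕ, ∑' k : ℕ, F ((m + 1) * (k + 1))) := by
  have h1 := hs.hasSum.tsum_fiberwise fun p : ℕ × ℕ => (p.1 + 1) * (p.2 + 1)
  rw [hs.tsum_prod] at h1
  suffices key : ∀ n, ∑' p : ((fun p : ℕ × ℕ => (p.1 + 1) * (p.2 + 1)) ⁻¹' {n} : Set (ℕ × ℕ)),
      F ((p.1.1 + 1) * (p.1.2 + 1)) = dR n * F n by simpa only [key] using h1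
  intro n
  have hfin : ∀ p : ((fun p : ℕ × ℕ => (p.1 + 1) * (p.2 + 1)) ⁻¹' {n} : Set (ℕ × ℕ)),
      F ((p.1.1 + 1) * (p.1.2 + 1)) = F n := fun p => by
    have := p.2
    rw [Set.mem_preimage, Set.mem_singleton_iff] at this
    rw [this]
  simp only [hfin]
  have hcard : Nat.card ((fun p : ℕ × ℕ => (p.1 + 1) * (p.2 + 1)) ⁻¹' {n} : Set (ℕ × ℕ)) =
      n.divisors.card := by
    rw [← Finset.card_map, Nat.map_div_right_divisors, ← Nat.card_eq_finsetCard]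
    refine Nat.card_congr ⟨fun p => ⟨(p.1.1 + 1, p.1.2 + 1), ?_⟩,
      fun q => ⟨(q.1.1 - 1, q.1.2 - 1), ?_⟩, fun p => ?_, fun q => ?_⟩
    · have := p.2
      rw [Set.mem_preimage, Set.mem_singleton_iff] at this
      rw [Nat.mem_divisorsAntidiagonal]
      exact ⟨this, by rw [← this]; positivity⟩
    · obtain ⟨⟨a, b⟩, hq⟩ := q
      rw [Nat.mem_divisorsAntidiagonal] at hq
      have ha : a ≠ 0 := by rintro rfl; simp at hq; omega
      have hb : b ≠ 0 := by rintro rfl; simp at hq; omega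
      rw [Set.mem_preimage, Set.mem_singleton_iff]
      simp only
      rw [Nat.sub_add_cancel (by omega), Nat.sub_add_cancel (by omega)]
      exact hq.1
    · simp
    · obtain ⟨⟨a, b⟩, hq⟩ := q
      rw [Nat.mem_divisorsAntidiagonal] at hq
      have ha : a ≠ 0 := by rintro rfl; simp at hq; omega
      have hb : b ≠ 0 := by rintro rfl; simp at hq; omega
      simp only [Subtype.mk.injEq, Prod.mk.injEq]
      omega
  have : Finite ((fun p : ℕ × ℕ => (p.1 + 1) * (p.2 + 1)) ⁻¹' {n} : Set (ℕ × ℕ)) := by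
    by_cases hn : n = 0
    · subst hn
      have : ((fun p : ℕ × ℕ => (p.1 + 1) * (p.2 + 1)) ⁻¹' {0} : Set (ℕ × ℕ)) = ∅ := by
        ext p; simp
      rw [this]; infer_instance
    · refine Nat.finite_of_card_ne_zero ?_
      rw [hcard]
      exact (Finset.card_pos.2 ⟨1, Nat.one_mem_divisors.2 hn⟩).ne'
  rw [tsum_const, hcard, nsmul_eq_mul, dR]

lemma summable_prod_of_abs_le {F : ℕ → ℝ} {C : ℝ} (h : ∀ n, n ≠ 0 → |F n| ≤ C * ((n : ℝ) ^ 2)⁻¹) :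
    Summable fun p : ℕ × ℕ => F ((p.1 + 1) * (p.2 + 1)) := by
  have hs : Summable fun k : ℕ => ((k + 1 : ℝ) ^ 2)⁻¹ := by
    have := (summable_nat_add_iff 1).2 (Real.summable_nat_pow_inv.2 one_lt_two)
    simpa using this
  refine Summable.of_norm_bounded ((hs.mul_of_nonneg hs (fun _ => by positivity)
    fun _ => by positivity).mul_left C) fun p => ?_
  refine (h _ (by positivity)).trans_eq ?_
  push_cast
  rw [mul_pow, mul_inv]

end DoubleSums

section CosineSeries

variable {α β : ℝ} {f : ℝ → ℝ}

/-- Second derivative of the doubled cosine transform. -/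
noncomputable def cosTransformTwo (f : ℝ → ℝ) (w : ℝ) : ℝ :=
  2 * ((w ^ 2)⁻¹ * cosTransform (eulerTwo f) w)

/-- Fourier cosine coefficients of `cosTransformTwo f`. -/
noncomputable def cosCoeff (f : ℝ → ℝ) (ξ : ℝ) : ℝ :=
  ∫ w in Set.Ioi 0, cosTransformTwo f w * Real.cos (2 * π * w * ξ)

lemma IsTest.continuousOn_cosTransformTwo (h : IsTest α β f) :
    ContinuousOn (cosTransformTwo f) (Set.Ioi 0) := fun w hw => by
  have h1 := (h.isTest_eulerTwo.hasDerivAt_cosTransform hw).continuousAt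
  have h2 : w ^ 2 ≠ 0 := (pow_pos hw 2).ne'
  exact (continuousAt_const.mul (((continuousAt_id.pow 2).inv₀ h2).mul h1)).continuousWithinAt

lemma IsTest.integrableOn_cosTransformTwo (h : IsTest α β f) :
    MeasureTheory.IntegrableOn (cosTransformTwo f) (Set.Ioi 0) := by
  have hc := h.continuousOn_cosTransformTwo
  obtain ⟨C, hC, hb⟩ := h.isTest_eulerTwo.exists_abs_cosTransform_le
  have habs : ∀ w, |cosTransformTwo f w| = 2 * ((w ^ 2)⁻¹ * |cosTransform (eulerTwo f) w|) :=
    fun w => by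
      rw [cosTransformTwo, abs_mul, abs_mul, abs_two, abs_of_nonneg (by positivity : 0 ≤ (w ^ 2)⁻¹)]
  rw [← Set.Ioc_union_Ioi_eq_Ioi zero_le_one]
  refine MeasureTheory.IntegrableOn.union ?_ ?_
  · refine MeasureTheory.Integrable.mono' (g := fun _ => 2 * C)
      (MeasureTheory.integrableOn_const (by simp))
      ((hc.mono Set.Ioc_subset_Ioi_self).aestronglyMeasurable measurableSet_Ioc) ?_
    refine (MeasureTheory.ae_restrict_iff' measurableSet_Ioc).2
      (Eventually.of_forall fun w hw => ?_)
    have hw0 : 0 < w := hw.1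
    rw [Real.norm_eq_abs, habs]
    calc _ ≤ 2 * ((w ^ 2)⁻¹ * (C * w ^ 3)) := by gcongr; exact hb w hw0
      _ = 2 * (C * w) := by field_simp
      _ ≤ 2 * (C * 1) := by gcongr; exact hw.2
      _ = _ := by ring
  · refine MeasureTheory.Integrable.mono'
      (g := fun w => 2 * (∫ u, |eulerTwo f u|) * w ^ (-3 : ℝ))
      ((integrableOn_Ioi_rpow_of_lt (by norm_num) one_pos).const_mul _)
      ((hc.mono (Set.Ioi_subset_Ioi zero_le_one)).aestronglyMeasurable measurableSet_Ioi) ?_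
    refine (MeasureTheory.ae_restrict_iff' measurableSet_Ioi).2
      (Eventually.of_forall fun w hw => ?_)
    have hw0 : 0 < w := zero_lt_one.trans hw
    rw [Real.norm_eq_abs, habs]
    calc _ ≤ 2 * ((w ^ 2)⁻¹ * (w⁻¹ * ∫ u, |eulerTwo f u|)) := by
          gcongr; exact abs_cosTransform_le _ h.isTest_eulerTwo.integrable hw0
      _ = _ := by
          rw [Real.rpow_neg hw0.le, show (3 : ℝ) = ((3 : ℕ) : ℝ) by norm_num, Real.rpow_natCast]
          field_simp

lemma IsTest.integrableOn_cosTransformTwo_mul_cos (h : IsTest α β f) (ξ : ℝ) :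
    MeasureTheory.IntegrableOn (fun w => cosTransformTwo f w * Real.cos (2 * π * w * ξ))
      (Set.Ioi 0) := by
  refine MeasureTheory.Integrable.mul_bdd (c := 1) h.integrableOn_cosTransformTwo
    (by fun_prop : Continuous fun w => Real.cos (2 * π * w * ξ)).aestronglyMeasurable
    (Eventually.of_forall fun w => Real.abs_cos_le_one _)

lemma IsTest.abs_cosCoeff_le (h : IsTest α β f) (ξ : ℝ) :
    |cosCoeff f ξ| ≤ ∫ w in Set.Ioi 0, |cosTransformTwo f w| := by
  refine MeasureTheory.norm_integral_le_of_norm_le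
    (f := fun w => cosTransformTwo f w * Real.cos (2 * π * w * ξ))
    h.integrableOn_cosTransformTwo.norm
    (Eventually.of_forall fun w => ?_)
  rw [norm_mul]
  exact mul_le_of_le_one_right (norm_nonneg _) (Real.abs_cos_le_one _)

lemma IsTest.hasSum_cosCoeff (h : IsTest α β f) (h0 : ∫ u, f u = 0) (ξ : ℝ) :
    HasSum (fun k : ℕ => ((k + 1 : ℝ) ^ 2)⁻¹ * cosCoeff f (ξ * (k + 1)))
      (∫ t, ((t ^ 2)⁻¹ * dilSum (eulerTwo f) t) * Real.cos (2 * π * t * ξ)) := by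
  have h2 := h.isTest_eulerTwo
  have hs : Summable fun k : ℕ => ((k + 1 : ℝ) ^ 2)⁻¹ := by
    have := (summable_nat_add_iff 1).2 (Real.summable_nat_pow_inv.2 one_lt_two)
    simpa using this
  set P : ℕ → ℝ → ℝ := fun k t =>
    ((k + 1 : ℝ) ^ 3)⁻¹ * (cosTransformTwo f (t * (k + 1 : ℝ)⁻¹) * Real.cos (2 * π * t * ξ)) with hP
  have hk : ∀ k : ℕ, (0 : ℝ) < k + 1 := fun k => by positivity
  have harg : ∀ (k : ℕ) (t : ℝ),
      2 * π * (t * (k + 1 : ℝ)⁻¹) * (ξ * (k + 1)) = 2 * π * t * ξ := fun k t => by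
    have := (hk k).ne'
    field_simp
  have hInt : ∀ k, MeasureTheory.IntegrableOn (P k) (Set.Ioi 0) := fun k => by
    have h3 := (MeasureTheory.integrableOn_Ioi_comp_mul_right_iff
      (fun w => cosTransformTwo f w * Real.cos (2 * π * w * (ξ * (k + 1)))) 0 (inv_pos.2 (hk k))).2
      (by rw [zero_mul]; exact h.integrableOn_cosTransformTwo_mul_cos _)
    simp only [harg] at h3
    exact h3.const_mul _
  have hval : ∀ k, ∫ t in Set.Ioi 0, P k t = ((k + 1 : ℝ) ^ 2)⁻¹ * cosCoeff f (ξ * (k + 1)) := by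
    intro k
    have h3 := MeasureTheory.integral_comp_mul_right_Ioi
      (fun w => cosTransformTwo f w * Real.cos (2 * π * w * (ξ * (k + 1)))) 0 (inv_pos.2 (hk k))
    simp only [harg, zero_mul, inv_inv, smul_eq_mul] at h3
    simp only [hP]
    rw [MeasureTheory.integral_const_mul, h3, ← cosCoeff]
    have := (hk k).ne'
    field_simp
  have hnorm : Summable fun k => ∫ t in Set.Ioi 0, ‖P k t‖ := by
    refine Summable.of_nonneg_of_le (fun k => MeasureTheory.integral_nonneg fun _ => norm_nonneg _)
      (fun k => ?_) (hs.mul_left (∫ w in Set.Ioi 0, |cosTransformTwo f w|))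
    have h3 := MeasureTheory.integral_comp_mul_right_Ioi
      (fun w => |cosTransformTwo f w|) 0 (inv_pos.2 (hk k))
    have h4 := (MeasureTheory.integrableOn_Ioi_comp_mul_right_iff
      (fun w => |cosTransformTwo f w|) 0 (inv_pos.2 (hk k))).2
      (by rw [zero_mul]; exact h.integrableOn_cosTransformTwo.norm)
    rw [zero_mul, inv_inv, smul_eq_mul] at h3
    calc ∫ t in Set.Ioi 0, ‖P k t‖
        ≤ ∫ t in Set.Ioi 0, ((k + 1 : ℝ) ^ 3)⁻¹ * |cosTransformTwo f (t * (k + 1 : ℝ)⁻¹)| := by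
          refine MeasureTheory.integral_mono (hInt k).norm (h4.const_mul _) fun t => ?_
          simp only [hP]
          rw [norm_mul, norm_mul, Real.norm_of_nonneg (by positivity : 0 ≤ ((k + 1 : ℝ) ^ 3)⁻¹)]
          gcongr
          exact mul_le_of_le_one_right (norm_nonneg _) (Real.abs_cos_le_one _)
      _ = _ := by
          rw [MeasureTheory.integral_const_mul, h3]
          have := (hk k).ne'
          field_simp
  have hmain := MeasureTheory.hasSum_integral_of_summable_integral_norm hInt hnorm
  simp only [hval] at hmain
  suffices e : ∫ t, ((t ^ 2)⁻¹ * dilSum (eulerTwo f) t) * Real.cos (2 * π * t * ξ) =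
      ∫ t in Set.Ioi 0, ∑' k, P k t by
    rw [e]
    exact hmain
  rw [← MeasureTheory.setIntegral_eq_integral_of_forall_compl_eq_zero (s := Set.Ioi 0)]
  · refine MeasureTheory.setIntegral_congr_fun measurableSet_Ioi fun t ht => ?_
    have h3 := ((h2.hasSum_cosTransform (h.integral_eulerTwo h0) ht).mul_left ((t ^ 2)⁻¹)).mul_right
      (Real.cos (2 * π * t * ξ))
    rw [← h3.tsum_eq]
    refine tsum_congr fun k => ?_
    have ht0 : t ≠ 0 := (Set.mem_Ioi.1 ht).ne'
    simp only [hP, cosTransformTwo, div_eq_mul_inv]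
    have := (hk k).ne'
    field_simp
  · intro t ht
    rw [h2.dilSum_of_nonpos (not_lt.1 ht), mul_zero, zero_mul]

lemma IsTest.abs_cosCoeff_div_le (h : IsTest α β f) {n : ℕ} (hn : n ≠ 0) :
    |-(cosCoeff f n / (2 * π ^ 2 * (n : ℝ) ^ 2))| ≤
      (∫ w in Set.Ioi 0, |cosTransformTwo f w|) * ((n : ℝ) ^ 2)⁻¹ := by
  have hn' : (0 : ℝ) < n := by exact_mod_cast Nat.pos_of_ne_zero hn
  have h1 := h.abs_cosCoeff_le n
  rw [abs_neg, abs_div, abs_of_pos (by positivity : 0 < 2 * π ^ 2 * (n : ℝ) ^ 2), div_eq_mul_inv]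
  gcongr
  have : 1 ≤ 2 * π ^ 2 := by nlinarith [Real.pi_gt_three]
  nlinarith [sq_nonneg (n : ℝ)]

lemma IsTest.tsum_dilSum (h : IsTest α β f) :
    ∑' b : ℕ, dilSum f (b + 1) = ∑' n : ℕ, dR n * f n := by
  have hs : Summable fun p : ℕ × ℕ => f (((p.1 + 1) * (p.2 + 1) : ℕ) : ℝ) := by
    obtain ⟨N, hN⟩ := exists_nat_gt β
    refine summable_of_ne_finset_zero (s := Finset.range N ×ˢ Finset.range N) fun p hp => ?_
    refine h.zero _ fun hc => hp ?_
    have h1 : ((p.1 + 1) * (p.2 + 1) : ℕ) < N := by exact_mod_cast hc.2.trans_lt hN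
    rw [Finset.mem_product, Finset.mem_range, Finset.mem_range]
    constructor <;> nlinarith
  rw [(hasSum_dR_mul (F := fun n => f n) hs).tsum_eq]
  refine tsum_congr fun m => tsum_congr fun k => ?_
  push_cast
  rw [mul_comm]

lemma IsTest.integral_dilSum_mul_cos (h : IsTest α β f) (h0 : ∫ u, f u = 0) (m : ℕ) :
    2 * ∫ t, dilSum f t * Real.cos (2 * π * t * (m + 1)) =
      ∑' k : ℕ, -(cosCoeff f (((m + 1) * (k + 1) : ℕ) : ℝ) /
        (2 * π ^ 2 * (((m + 1) * (k + 1) : ℕ) : ℝ) ^ 2)) := by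
  have hm : (m + 1 : ℝ) ≠ 0 := by positivity
  have hs := (((h.hasSum_cosCoeff h0 (m + 1)).neg.div_const (4 * π ^ 2 * (m + 1) ^ 2)).mul_left
    2).tsum_eq
  rw [(h.isC2On_dilSum h0).integral_mul_cos_eq hm, ← hs]
  refine tsum_congr fun k => ?_
  have hk : (k + 1 : ℝ) ≠ 0 := by positivity
  push_cast
  generalize cosCoeff f ((m + 1) * (k + 1)) = c
  field_simp
  ring

/-- A preliminary form of the Voronoi summation formula. -/
lemma IsTest.hasSum_dR_mul_cosCoeff (h : IsTest α β f) (h0 : ∫ u, f u = 0) :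
    HasSum (fun n : ℕ => dR n * (-(cosCoeff f n / (2 * π ^ 2 * (n : ℝ) ^ 2))))
      ((∑' n : ℕ, dR n * f n) - ∫ t, dilSum f t) := by
  have hP := (h.isC2On_dilSum h0).hasSum_poisson (h.dilSum_of_nonpos le_rfl)
  rw [h.tsum_dilSum] at hP
  rw [← hP.tsum_eq, tsum_congr (h.integral_dilSum_mul_cos h0)]
  exact hasSum_dR_mul (F := fun n : ℕ => -(cosCoeff f n / (2 * π ^ 2 * (n : ℝ) ^ 2)))
    (summable_prod_of_abs_le fun n hn => h.abs_cosCoeff_div_le hn)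

end CosineSeries

section KernelTransform

variable {α β : ℝ} {f : ℝ → ℝ}

lemma continuousOn_Icc_of_abs_le {g : ℝ → ℝ} {C W : ℝ} {k : ℕ} (hk : k ≠ 0)
    (hg : ContinuousOn g (Set.Ioi 0))
    (h0 : g 0 = 0) (hb : ∀ w, 0 < w → |g w| ≤ C * w ^ k) : ContinuousOn g (Set.Icc 0 W) := by
  intro w hw
  rcases hw.1.eq_or_lt with rfl | hpos
  · have h1 : Tendsto (fun w : ℝ => C * w ^ k) (nhdsWithin 0 (Set.Icc 0 W)) (nhds 0) := by
      have : Continuous fun w : ℝ => C * w ^ k := by fun_prop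
      have h2 := (this.tendsto 0).mono_left (nhdsWithin_le_nhds (s := Set.Icc 0 W))
      rwa [zero_pow hk, mul_zero] at h2
    rw [ContinuousWithinAt, h0]
    refine squeeze_zero_norm' ?_ h1
    filter_upwards [self_mem_nhdsWithin] with w hw
    rcases hw.1.eq_or_lt with rfl | hpos
    · rw [h0, zero_pow hk, mul_zero, norm_zero]
    · exact hb w hpos
  · exact ((hg w hpos).continuousAt (Ioi_mem_nhds hpos)).continuousWithinAt

lemma IsTest.continuousOn_cosTransform (h : IsTest α β f) :
    ContinuousOn (cosTransform f) (Set.Ioi 0) := fun _ hw =>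
  (h.hasDerivAt_cosTransform hw).continuousAt.continuousWithinAt

lemma IsTest.continuousOn_cosTransform_Icc (h : IsTest α β f) (W : ℝ) :
    ContinuousOn (cosTransform f) (Set.Icc 0 W) := by
  obtain ⟨C, -, hb⟩ := h.exists_abs_cosTransform_le
  exact continuousOn_Icc_of_abs_le three_ne_zero h.continuousOn_cosTransform
    (by rw [cosTransform, inv_zero, zero_mul]) hb

lemma IsTest.continuousOn_inv_mul_cosTransform_Icc (h : IsTest α β f) (W : ℝ) :
    ContinuousOn (fun w => w⁻¹ * cosTransform f w) (Set.Icc 0 W) := by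
  obtain ⟨C, -, hb⟩ := h.exists_abs_cosTransform_le
  refine continuousOn_Icc_of_abs_le (C := C) two_ne_zero
    ((continuousOn_inv₀.mono fun w hw => (Set.mem_Ioi.1 hw).ne').mul h.continuousOn_cosTransform)
    (by rw [inv_zero, zero_mul]) fun w hw => ?_
  rw [abs_mul, abs_of_pos (inv_pos.2 hw)]
  calc w⁻¹ * |cosTransform f w| ≤ w⁻¹ * (C * w ^ 3) := by gcongr; exact hb w hw
    _ = C * w ^ 2 := by field_simp

lemma IsTest.hasDerivAt_inv_mul_cosTransform (h : IsTest α β f) {w : ℝ} (hw : 0 < w) :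
    HasDerivAt (fun w => 2 * (w⁻¹ * cosTransform (euler f) w)) (cosTransformTwo f w) w := by
  refine (((hasDerivAt_inv hw.ne').fun_mul
    (h.isTest_euler.hasDerivAt_cosTransform hw)).const_mul 2).congr_deriv ?_
  have e : cosTransform (eulerTwo f) w =
      cosTransform (euler (euler f)) w - cosTransform (euler f) w :=
    h.isTest_euler.isTest_euler.cosTransform_sub h.isTest_euler w
  rw [cosTransformTwo, e]
  field_simp
  ring

lemma IsTest.integral_cosTransform_mul_cos (h : IsTest α β f) {θ W : ℝ} (hW : 0 < W) :
    θ ^ 2 * (∫ w in (0 : ℝ)..W, 2 * cosTransform f w * Real.cos (θ * w)) =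
      2 * (W⁻¹ * cosTransform (euler f) W) * Real.cos (θ * W) +
        θ * (2 * cosTransform f W) * Real.sin (θ * W) -
        ∫ w in (0 : ℝ)..W, cosTransformTwo f w * Real.cos (θ * w) := by
  have hcos : Continuous fun w => Real.cos (θ * w) := by fun_prop
  have hsin : Continuous fun w => Real.sin (θ * w) := by fun_prop
  have i1 : IntervalIntegrable (fun w => cosTransformTwo f w * Real.cos (θ * w))
      MeasureTheory.volume 0 W := by
    refine IntervalIntegrable.mul_continuousOn ?_ hcos.continuousOn
    rw [intervalIntegrable_iff_integrableOn_Ioc_of_le hW.le]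
    exact h.integrableOn_cosTransformTwo.mono_set Set.Ioc_subset_Ioi_self
  have i2 : IntervalIntegrable (fun w => 2 * cosTransform f w * Real.cos (θ * w))
      MeasureTheory.volume 0 W :=
    ContinuousOn.intervalIntegrable_of_Icc hW.le
      ((continuousOn_const.mul (h.continuousOn_cosTransform_Icc W)).mul hcos.continuousOn)
  have key := intervalIntegral.integral_eq_sub_of_hasDerivAt_of_le hW.le
    (f := fun w => 2 * (w⁻¹ * cosTransform (euler f) w) * Real.cos (θ * w) +
      θ * (2 * cosTransform f w) * Real.sin (θ * w))
    (f' := fun w => cosTransformTwo f w * Real.cos (θ * w) +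
      θ ^ 2 * (2 * cosTransform f w * Real.cos (θ * w)))
    (((continuousOn_const.mul (h.isTest_euler.continuousOn_inv_mul_cosTransform_Icc W)).mul
      hcos.continuousOn).add ((continuousOn_const.mul
        (continuousOn_const.mul (h.continuousOn_cosTransform_Icc W))).mul hsin.continuousOn))
    (fun w hw => by
      have hlin : HasDerivAt (fun w => θ * w) θ w := by
        simpa using (hasDerivAt_id' w).const_mul θ
      refine (((h.hasDerivAt_inv_mul_cosTransform hw.1).fun_mul hlin.cos).fun_add
        ((((h.hasDerivAt_cosTransform hw.1).const_mul 2).const_mul θ).fun_mul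
          hlin.sin)).congr_deriv ?_
      ring)
    (i1.add (i2.const_mul _))
  rw [intervalIntegral.integral_add i1 (i2.const_mul _), intervalIntegral.integral_const_mul] at key
  simp only [inv_zero, zero_mul, mul_zero, Real.sin_zero, add_zero, sub_zero] at key
  linarith

lemma IsTest.tendsto_cosTransform (h : IsTest α β f) :
    Tendsto (cosTransform f) atTop (nhds 0) := by
  refine squeeze_zero_norm' (a := fun w => w⁻¹ * ∫ u, |f u|) ?_ ?_
  · filter_upwards [eventually_gt_atTop 0] with w hw
    exact abs_cosTransform_le f h.integrable hw
  · simpa using tendsto_inv_atTop_zero.mul_const (∫ u, |f u|)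

lemma IsTest.tendsto_integral_cosTransform_mul_cos (h : IsTest α β f) (ξ : ℝ) :
    Tendsto (fun W => (2 * π * ξ) ^ 2 *
      ∫ w in (0 : ℝ)..W, 2 * cosTransform f w * Real.cos (2 * π * ξ * w)) atTop
      (nhds (-cosCoeff f ξ)) := by
  have h1 : Tendsto (fun W => ∫ w in (0 : ℝ)..W, cosTransformTwo f w *
      Real.cos (2 * π * w * ξ)) atTop
      (nhds (cosCoeff f ξ)) :=
    MeasureTheory.intervalIntegral_tendsto_integral_Ioi 0
      (h.integrableOn_cosTransformTwo_mul_cos ξ) tendsto_id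
  have h2 : Tendsto (fun W : ℝ => 2 * (W⁻¹ * cosTransform (euler f) W) *
      Real.cos (2 * π * ξ * W)) atTop (nhds 0) := by
    refine Tendsto.zero_mul_isBoundedUnder_le ?_
      (isBoundedUnder_of ⟨1, fun W => Real.abs_cos_le_one _⟩)
    simpa using (tendsto_inv_atTop_zero.mul h.isTest_euler.tendsto_cosTransform).const_mul (2 : ℝ)
  have h3 : Tendsto (fun W : ℝ => 2 * π * ξ * (2 * cosTransform f W) *
      Real.sin (2 * π * ξ * W)) atTop (nhds 0) := by
    refine Tendsto.zero_mul_isBoundedUnder_le ?_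
      (isBoundedUnder_of ⟨1, fun W => Real.abs_sin_le_one _⟩)
    simpa using (h.tendsto_cosTransform.const_mul (2 : ℝ)).const_mul (2 * π * ξ)
  have h4 := (h2.add h3).sub h1
  rw [add_zero, zero_sub] at h4
  refine h4.congr' ?_
  filter_upwards [eventually_gt_atTop 0] with W hW
  rw [h.integral_cosTransform_mul_cos hW]
  simp only [mul_right_comm (2 * π) ξ]

lemma IsTest.cosTransform_eq_integral_deriv (h : IsTest α β f) {w : ℝ} (hw : 0 < w) :
    2 * cosTransform f w = -(1 / π) * ∫ u, deriv f u * Real.sin (2 * π * u / w) := by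
  have hd : ∀ u, HasDerivAt (fun u => f u * Real.sin (2 * π * u / w))
      (deriv f u * Real.sin (2 * π * u / w) +
        2 * π / w * (f u * Real.cos (2 * π * u / w))) u := fun u => by
    have hlin : HasDerivAt (fun u => 2 * π * u / w) (2 * π / w) u := by
      simpa using ((hasDerivAt_id' u).const_mul (2 * π)).div_const w
    exact ((h.hasDerivAt u).fun_mul hlin.sin).congr_deriv (by ring)
  have hsin : Continuous fun u => Real.sin (2 * π * u / w) := by fun_prop
  have i1 := h.isTest_deriv.integrable_mul hsin
  have i2 := (h.integrable_mul_cos w).const_mul (2 * π / w)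
  have key := MeasureTheory.integral_eq_zero_of_hasDerivAt_of_integrable hd (i1.add i2)
    (h.integrable_mul hsin)
  rw [MeasureTheory.integral_add i1 i2, MeasureTheory.integral_const_mul] at key
  rw [cosTransform]
  generalize ∫ u, f u * Real.cos (2 * π * u / w) = A at *
  generalize ∫ u, deriv f u * Real.sin (2 * π * u / w) = B at *
  have hB : B = -(2 * π / w * A) := by linarith
  rw [hB]
  field_simp

lemma stronglyMeasurable_kernPartial (b W : ℝ) :
    MeasureTheory.StronglyMeasurable fun u => kernPartial (2 * π * u) b W := by
  have hm : Measurable (Function.uncurry fun u w : ℝ =>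
      Real.sin (2 * π * u / w) * Real.cos (b * w)) := by
    unfold Function.uncurry
    fun_prop
  simp only [kernPartial, intervalIntegral]
  exact (hm.stronglyMeasurable.integral_prod_right
    (ν := MeasureTheory.volume.restrict (Set.Ioc 0 W))).sub
    (hm.stronglyMeasurable.integral_prod_right (ν := MeasureTheory.volume.restrict (Set.Ioc W 0)))

lemma IsTest.integral_integral_sin_mul_cos (h : IsTest α β f) (b : ℝ) {W : ℝ} (hW : 0 < W) :
    ∫ w in (0 : ℝ)..W, (∫ u, f u * Real.sin (2 * π * u / w)) * Real.cos (b * w) =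
      ∫ u, f u * kernPartial (2 * π * u) b W := by
  have hm : Measurable (Function.uncurry fun w u : ℝ =>
      Real.sin (2 * π * u / w) * Real.cos (b * w)) := by
    unfold Function.uncurry
    fun_prop
  have hInt : MeasureTheory.Integrable (Function.uncurry fun w u : ℝ =>
      f u * (Real.sin (2 * π * u / w) * Real.cos (b * w)))
      ((MeasureTheory.volume.restrict (Set.Ioc 0 W)).prod MeasureTheory.volume) := by
    have h1 : MeasureTheory.Integrable (fun p : ℝ × ℝ => (1 : ℝ) * f p.2)
        ((MeasureTheory.volume.restrict (Set.Ioc 0 W)).prod MeasureTheory.volume) :=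
      MeasureTheory.Integrable.mul_prod (MeasureTheory.integrable_const 1) h.integrable
    simp only [one_mul] at h1
    refine MeasureTheory.Integrable.mul_bdd (c := 1) h1 hm.aestronglyMeasurable
      (Eventually.of_forall fun p => ?_)
    rw [norm_mul]
    exact mul_le_one₀ (Real.abs_sin_le_one _) (norm_nonneg _) (Real.abs_cos_le_one _)
  have hswap := MeasureTheory.integral_integral_swap hInt
  rw [intervalIntegral.integral_of_le hW.le]
  have e1 : ∀ w, (∫ u, f u * Real.sin (2 * π * u / w)) * Real.cos (b * w) =
      ∫ u, f u * (Real.sin (2 * π * u / w) * Real.cos (b * w)) := fun w => by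
    rw [← MeasureTheory.integral_mul_const]
    simp only [mul_assoc]
  have e2 : ∀ u, f u * kernPartial (2 * π * u) b W =
      ∫ w in Set.Ioc 0 W, f u * (Real.sin (2 * π * u / w) * Real.cos (b * w)) := fun u => by
    rw [kernPartial, intervalIntegral.integral_of_le hW.le, MeasureTheory.integral_const_mul]
  simp only [e1, e2]
  exact hswap

lemma IsTest.abs_mul_kernPartial_le (h : IsTest α β f) {b W : ℝ} (hb : 0 < b) (hW : 1 ≤ W) (u : ℝ) :
    ‖f u * kernPartial (2 * π * u) b W‖ ≤ (1 + 2 * (2 * π * β) / b) * ‖f u‖ := by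
  by_cases hu : u ∈ Set.Icc α β
  · have hu0 : 0 ≤ u := h.pos.le.trans hu.1
    have h1 := abs_kernPartial_sub_le (a := 2 * π * u) (b := b) (by positivity) hb one_pos hW
    have h2 := abs_kernPartial_le (2 * π * u) b zero_le_one
    have h3 : 2 * (2 * π * u) / (b * 1) ≤ 2 * (2 * π * β) / b := by
      rw [mul_one]
      gcongr
      exact hu.2
    rw [norm_mul, mul_comm]
    gcongr
    rw [Real.norm_eq_abs]
    have h4 := abs_sub_abs_le_abs_sub (kernPartial (2 * π * u) b W) (kernPartial (2 * π * u) b 1)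
    linarith
  · rw [h.zero u hu, zero_mul, norm_zero, mul_zero]

lemma IsTest.tendsto_mul_kernPartial (h : IsTest α β f) {b : ℝ} (hb : 0 < b) (u : ℝ) :
    Tendsto (fun W => f u * kernPartial (2 * π * u) b W) atTop
      (nhds (f u * kern (2 * π * u) b)) := by
  by_cases hu : u ∈ Set.Icc α β
  · have hu0 : 0 ≤ u := h.pos.le.trans hu.1
    exact (tendsto_kernPartial (by positivity) hb).const_mul _
  · simp [h.zero u hu]

lemma IsTest.integrable_mul_kern (h : IsTest α β f) {b : ℝ} (hb : 0 < b) :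
    MeasureTheory.Integrable fun u => f u * kern (2 * π * u) b := by
  refine MeasureTheory.Integrable.mono' (h.integrable.norm.const_mul (1 + 2 * (2 * π * β) / b)) ?_
    (Eventually.of_forall fun u => ?_)
  · exact aestronglyMeasurable_of_tendsto_ae atTop
      (fun W => h.continuous.aestronglyMeasurable.mul
        (stronglyMeasurable_kernPartial b W).aestronglyMeasurable)
      (Eventually.of_forall fun u => h.tendsto_mul_kernPartial hb u)
  · refine le_of_tendsto (h.tendsto_mul_kernPartial hb u).norm ?_
    filter_upwards [eventually_ge_atTop 1] with W hW
    exact h.abs_mul_kernPartial_le hb hW u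

lemma IsTest.tendsto_integral_mul_kernPartial (h : IsTest α β f) {b : ℝ} (hb : 0 < b) :
    Tendsto (fun W => ∫ u, f u * kernPartial (2 * π * u) b W) atTop
      (nhds (∫ u, f u * kern (2 * π * u) b)) := by
  refine MeasureTheory.tendsto_integral_filter_of_dominated_convergence _
    (Eventually.of_forall fun W => h.continuous.aestronglyMeasurable.mul
        (stronglyMeasurable_kernPartial b W).aestronglyMeasurable) ?_
    (h.integrable.norm.const_mul (1 + 2 * (2 * π * β) / b))
    (Eventually.of_forall fun u => h.tendsto_mul_kernPartial hb u)
  filter_upwards [eventually_ge_atTop 1] with W hW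
  exact Eventually.of_forall fun u => h.abs_mul_kernPartial_le hb hW u

lemma IsTest.cosCoeff_eq (h : IsTest α β f) {ξ : ℝ} (hξ : 0 < ξ) :
    cosCoeff f ξ = (2 * π * ξ) ^ 2 * (1 / π) * ∫ u, deriv f u * kern (2 * π * u) (2 * π * ξ) := by
  have h1 := h.tendsto_integral_cosTransform_mul_cos ξ
  have h2 := (h.isTest_deriv.tendsto_integral_mul_kernPartial
    (by positivity : 0 < 2 * π * ξ)).const_mul ((2 * π * ξ) ^ 2 * -(1 / π))
  have h3 := tendsto_nhds_unique h1 (h2.congr' ?_)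
  · linarith
  filter_upwards [eventually_gt_atTop 0] with W hW
  rw [← h.isTest_deriv.integral_integral_sin_mul_cos _ hW, mul_assoc,
    ← intervalIntegral.integral_const_mul, intervalIntegral.integral_of_le hW.le,
    intervalIntegral.integral_of_le hW.le]
  congr 1
  refine MeasureTheory.setIntegral_congr_fun measurableSet_Ioc fun w hw => ?_
  rw [h.cosTransform_eq_integral_deriv hw.1, ← mul_assoc (-(1 / π))]

end KernelTransform

section DilationIntegral

variable {α β : ℝ} {f : ℝ → ℝ}

lemma hR_floor_eq_sum {z : ℝ} (hz : 0 ≤ z) {N : ℕ} (hN : z < N + 1) :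
    hR ⌊z⌋₊ = ∑ b ∈ Finset.range N, if (b + 1 : ℝ) ≤ z then (b + 1 : ℝ)⁻¹ else 0 := by
  have hle : ⌊z⌋₊ ≤ N := by
    have : ⌊z⌋₊ < N + 1 := (Nat.floor_lt hz).2 (by exact_mod_cast hN)
    omega
  rw [← Finset.sum_filter, hR]
  refine (Finset.sum_nbij' (· + 1) (· - 1) (fun b hb => ?_) (fun n hn => ?_) (fun b _ => rfl)
    (fun n hn => ?_) (fun b _ => by push_cast; rfl)).symm
  · rw [Finset.mem_filter] at hb
    exact Finset.mem_Icc.2 ⟨by omega, Nat.le_floor (by exact_mod_cast hb.2)⟩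
  · rw [Finset.mem_Icc] at hn
    have h1 : (n : ℝ) ≤ z := (Nat.le_floor_iff hz).1 hn.2
    refine Finset.mem_filter.2 ⟨Finset.mem_range.2 (by omega), ?_⟩
    rw [Nat.cast_sub hn.1]
    simpa using h1
  · exact Nat.sub_add_cancel (Finset.mem_Icc.1 hn).1

lemma IsTest.integral_Ioi_dilSum (h : IsTest α β f) {ε : ℝ} (hε : 0 < ε) :
    ∫ t in Set.Ioi ε, dilSum f t = ∫ u, f u * hR ⌊u / ε⌋₊ := by
  obtain ⟨N, hN⟩ := exists_lt_natCast_add_one_mul hε β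
  have h1 : ∫ t in Set.Ioi ε, dilSum f t =
      ∫ t in Set.Ioi ε, ∑ b ∈ Finset.range N, f ((b + 1) * t) := by
    refine MeasureTheory.setIntegral_congr_fun measurableSet_Ioi fun t ht => ?_
    have ht' : ε < t := ht
    exact h.dilSum_eq_sum (hN.trans (by gcongr)) (hε.trans ht)
  have hb : ∀ b : ℕ, (0 : ℝ) < b + 1 := fun b => by positivity
  have h2 : ∀ b : ℕ, ∫ t in Set.Ioi ε, f ((b + 1) * t) =
      ∫ u, f u * if (b + 1 : ℝ) ≤ u / ε then (b + 1 : ℝ)⁻¹ else 0 := fun b => by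
    rw [MeasureTheory.integral_comp_mul_left_Ioi _ _ (hb b),
      ← MeasureTheory.integral_Ici_eq_integral_Ioi,
      ← MeasureTheory.integral_indicator measurableSet_Ici, smul_eq_mul,
      ← MeasureTheory.integral_const_mul]
    refine MeasureTheory.integral_congr_ae (Eventually.of_forall fun u => ?_)
    simp only [Set.indicator_apply, Set.mem_Ici, le_div_iff₀ hε]
    split_ifs
    · ring
    · simp
  have hi : ∀ b : ℕ, MeasureTheory.Integrable fun u =>
      f u * if (b + 1 : ℝ) ≤ u / ε then (b + 1 : ℝ)⁻¹ else 0 := fun b => by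
    refine MeasureTheory.Integrable.mul_bdd (c := (b + 1 : ℝ)⁻¹) h.integrable
      (Measurable.ite (measurableSet_le measurable_const (by fun_prop))
        measurable_const measurable_const).aestronglyMeasurable (Eventually.of_forall fun u => ?_)
    split_ifs
    · rw [Real.norm_of_nonneg (inv_pos.2 (hb b)).le]
    · simpa using (hb b).le
  rw [h1, MeasureTheory.integral_finsetSum]
  · simp only [h2]
    rw [← MeasureTheory.integral_finsetSum _ fun b _ => hi b]
    refine MeasureTheory.integral_congr_ae (Eventually.of_forall fun u => ?_)
    simp only
    rw [← Finset.mul_sum]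
    by_cases hu : u ∈ Set.Icc α β
    · have hu0 : 0 ≤ u := h.pos.le.trans hu.1
      rw [hR_floor_eq_sum (by positivity) (N := N)]
      rw [div_lt_iff₀ hε]
      exact hu.2.trans_lt hN
    · rw [h.zero u hu, zero_mul, zero_mul]
  · intro b _
    exact ((h.comp_mul (hb b)).integrable).integrableOn

lemma IsTest.integrable_mul_log (h : IsTest α β f) :
    MeasureTheory.Integrable fun u => f u * Real.log u := by
  refine integrable_of_eq_zero (a := α) (b := β) ?_ fun u hu => by rw [h.zero u hu, zero_mul]
  refine continuous_iff_continuousAt.2 fun u => ?_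
  rcases eq_or_ne u 0 with rfl | hu
  · have : (fun u => f u * Real.log u) =ᶠ[nhds 0] fun _ => 0 := by
      filter_upwards [gt_mem_nhds h.pos] with v hv
      rw [h.zero v fun hc => hc.1.not_gt hv, zero_mul]
    exact this.continuousAt
  · exact h.continuous.continuousAt.mul (Real.continuousAt_log hu)

lemma IsTest.abs_integral_Ioi_dilSum_sub_le (h : IsTest α β f) (h0 : ∫ u, f u = 0) {ε : ℝ}
    (hε : 0 < ε) (hεα : ε ≤ α) :
    |(∫ t in Set.Ioi ε, dilSum f t) - ∫ u, f u * Real.log u| ≤ 2 / α * (∫ u, |f u|) * ε := by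
  have hm : MeasureTheory.AEStronglyMeasurable (fun u => f u * (hR ⌊u / ε⌋₊ -
      (Real.log (u / ε) + Real.eulerMascheroniConstant))) := by
    refine h.continuous.aestronglyMeasurable.mul (Measurable.aestronglyMeasurable ?_)
    have : Measurable fun u : ℝ => hR ⌊u / ε⌋₊ :=
      (measurable_from_nat (f := hR)).comp (Nat.measurable_floor.comp (measurable_id.div_const ε))
    fun_prop
  have hb : ∀ u, ‖f u * (hR ⌊u / ε⌋₊ - (Real.log (u / ε) + Real.eulerMascheroniConstant))‖ ≤
      2 / α * ε * |f u| := fun u => by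
    by_cases hu : u ∈ Set.Icc α β
    · have h1 : 1 ≤ u / ε := (one_le_div hε).2 (hεα.trans hu.1)
      have h2 := abs_hR_floor_sub_le h1
      rw [norm_mul, mul_comm, Real.norm_eq_abs, Real.norm_eq_abs]
      gcongr
      refine h2.trans ?_
      have := h.pos
      rw [div_div_eq_mul_div, div_mul_eq_mul_div]
      gcongr
      exact hu.1
    · rw [h.zero u hu]; simp
  have hInt := MeasureTheory.Integrable.mono' (h.integrable.norm.const_mul (2 / α * ε)) hm
    (Eventually.of_forall hb)
  have e : ∫ u, f u * (hR ⌊u / ε⌋₊ - (Real.log (u / ε) + Real.eulerMascheroniConstant)) =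
      (∫ t in Set.Ioi ε, dilSum f t) - ∫ u, f u * Real.log u := by
    have e1 : ∀ u, f u * hR ⌊u / ε⌋₊ = f u * (hR ⌊u / ε⌋₊ -
        (Real.log (u / ε) + Real.eulerMascheroniConstant)) + (f u * Real.log u +
          (Real.eulerMascheroniConstant - Real.log ε) * f u) := fun u => by
      by_cases hu : u ∈ Set.Icc α β
      · have hu0 : u ≠ 0 := (h.pos.trans_le hu.1).ne'
        rw [Real.log_div hu0 hε.ne']
        ring
      · rw [h.zero u hu]; simp
    have hInt' : MeasureTheory.Integrable fun u => f u * Real.log u +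
        (Real.eulerMascheroniConstant - Real.log ε) * f u :=
      h.integrable_mul_log.add (h.integrable.const_mul _)
    rw [h.integral_Ioi_dilSum hε, MeasureTheory.integral_congr_ae (Eventually.of_forall e1),
      MeasureTheory.integral_add hInt hInt',
      MeasureTheory.integral_add h.integrable_mul_log (h.integrable.const_mul _),
      MeasureTheory.integral_const_mul, h0]
    ring
  rw [← e]
  refine (MeasureTheory.norm_integral_le_of_norm_le (h.integrable.norm.const_mul (2 / α * ε))
    (Eventually.of_forall hb)).trans_eq ?_
  rw [MeasureTheory.integral_const_mul]
  simp only [Real.norm_eq_abs]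
  ring

lemma IsTest.integral_dilSum (h : IsTest α β f) (h0 : ∫ u, f u = 0) :
    ∫ t, dilSum f t = ∫ u, f u * Real.log u := by
  have hInt : MeasureTheory.Integrable (dilSum f) :=
    integrable_of_eq_zero (a := 0) (b := β)
      (continuous_iff_continuousAt.2 fun t => ((h.isC2On_dilSum h0).deriv_one t).continuousAt)
      fun t ht => h.dilSum_of_notMem ht
  have e : ∫ t, dilSum f t = ∫ t in Set.Ioi 0, dilSum f t := by
    refine (MeasureTheory.setIntegral_eq_integral_of_forall_compl_eq_zero fun t ht => ?_).symm
    exact h.dilSum_of_nonpos (not_lt.1 ht)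
  have h1 : Tendsto (fun k : ℕ => ∫ t in Set.Ioi (1 / ((k : ℝ) + 1)), dilSum f t) atTop
      (nhds (∫ t, dilSum f t)) := by
    have hU : (⋃ k : ℕ, Set.Ioi (1 / ((k : ℝ) + 1))) = Set.Ioi 0 := by
      ext t
      simp only [Set.mem_iUnion, Set.mem_Ioi]
      exact ⟨fun ⟨k, hk⟩ => lt_trans (by positivity) hk, exists_nat_one_div_lt⟩
    rw [e, ← hU]
    refine MeasureTheory.tendsto_setIntegral_of_monotone (fun _ => measurableSet_Ioi) ?_
      hInt.integrableOn
    intro k l hkl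
    exact Set.Ioi_subset_Ioi (Nat.one_div_le_one_div hkl)
  have h2 : Tendsto (fun k : ℕ => ∫ t in Set.Ioi (1 / ((k : ℝ) + 1)), dilSum f t) atTop
      (nhds (∫ u, f u * Real.log u)) := by
    rw [tendsto_iff_norm_sub_tendsto_zero]
    refine squeeze_zero' (Eventually.of_forall fun _ => norm_nonneg _)
      (g := fun k : ℕ => 2 / α * (∫ u, |f u|) * (1 / ((k : ℝ) + 1))) ?_ ?_
    · filter_upwards [(tendsto_one_div_add_atTop_nhds_zero_nat (𝕜 := ℝ)).eventually
        (ge_mem_nhds h.pos)] with k hk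
      exact h.abs_integral_Ioi_dilSum_sub_le h0 (by positivity) hk
    · simpa using (tendsto_one_div_add_atTop_nhds_zero_nat (𝕜 := ℝ)).const_mul
        (2 / α * (∫ u, |f u|))
  exact tendsto_nhds_unique h1 h2

end DilationIntegral

section Voronoi

variable {α β : ℝ} {f g : ℝ → ℝ}

lemma measurable_dirichletDelta : Measurable dirichletDelta := by
  have : Measurable fun x : ℝ => ∑ n ∈ Finset.Icc 1 ⌊x⌋₊, (n.divisors.card : ℝ) :=
    (measurable_from_nat (f := fun N => ∑ n ∈ Finset.Icc 1 N, (n.divisors.card : ℝ))).comp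
      Nat.measurable_floor
  unfold dirichletDelta
  fun_prop

lemma sum_dR_floor_eq {u : ℝ} (hu : 0 ≤ u) {N : ℕ} (hN : u ≤ N) :
    ∑ n ∈ Finset.Icc 1 ⌊u⌋₊, (n.divisors.card : ℝ) =
      ∑ n ∈ Finset.Icc 1 N, if (n : ℝ) ≤ u then dR n else 0 := by
  rw [← Finset.sum_filter]
  refine Finset.sum_congr (Finset.ext fun n => ?_) fun _ _ => rfl
  rw [Finset.mem_filter, Finset.mem_Icc, Finset.mem_Icc, Nat.le_floor_iff hu]
  constructor
  · rintro ⟨h1, h2⟩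
    exact ⟨⟨h1, by exact_mod_cast h2.trans hN⟩, h2⟩
  · rintro ⟨⟨h1, -⟩, h2⟩
    exact ⟨h1, h2⟩

lemma IsTest.sum_mul_eq (h : IsTest α β f) {N : ℕ} (hN : β < N) (u : ℝ) :
    (∑ n ∈ Finset.Icc 1 ⌊u⌋₊, (n.divisors.card : ℝ)) * f u =
      ∑ n ∈ Finset.Icc 1 N, dR n * (Set.Ici (n : ℝ)).indicator f u := by
  by_cases hu : u ∈ Set.Icc α β
  · rw [sum_dR_floor_eq (h.pos.le.trans hu.1) (hu.2.trans hN.le), Finset.sum_mul]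
    refine Finset.sum_congr rfl fun n _ => ?_
    simp only [Set.indicator_apply, Set.mem_Ici]
    split_ifs <;> simp
  · have h1 := h.zero u hu
    rw [h1, mul_zero, eq_comm]
    refine Finset.sum_eq_zero fun n _ => ?_
    rw [Set.indicator_apply, h1, ite_self, mul_zero]

lemma IsTest.integrable_indicator (h : IsTest α β f) (n : ℕ) :
    MeasureTheory.Integrable fun u => dR n * (Set.Ici (n : ℝ)).indicator f u :=
  (h.integrable.indicator measurableSet_Ici).const_mul _

lemma IsTest.integrable_sum_mul (h : IsTest α β f) :
    MeasureTheory.Integrable fun u => (∑ n ∈ Finset.Icc 1 ⌊u⌋₊, (n.divisors.card : ℝ)) * f u := by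
  obtain ⟨N, hN⟩ := exists_nat_gt β
  rw [funext (h.sum_mul_eq hN)]
  exact MeasureTheory.integrable_finsetSum _ fun n _ => h.integrable_indicator n

lemma IsTest.integrable_main_mul (h : IsTest α β f) :
    MeasureTheory.Integrable fun u =>
      u * (Real.log u + 2 * Real.eulerMascheroniConstant - 1) * f u := by
  have h1 := h.mul_left (G := fun u => u) contDiff_id
  refine (h1.integrable_mul_log.add
    (h1.integrable.const_mul (2 * Real.eulerMascheroniConstant - 1))).congr
      (Eventually.of_forall fun u => ?_)
  simp only [Pi.add_apply]
  ring

lemma IsTest.integrable_dirichletDelta_mul (h : IsTest α β f) :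
    MeasureTheory.Integrable fun u => dirichletDelta u * f u := by
  refine (h.integrable_sum_mul.sub h.integrable_main_mul).congr (Eventually.of_forall fun u => ?_)
  simp only [Pi.sub_apply, dirichletDelta, sub_mul]

lemma IsTest.integral_sum_mul_deriv (h : IsTest α β f) :
    ∫ u, (∑ n ∈ Finset.Icc 1 ⌊u⌋₊, (n.divisors.card : ℝ)) * deriv f u = -∑' n : ℕ, dR n * f n := by
  obtain ⟨N, hN⟩ := exists_nat_gt β
  have ht : ∑' n : ℕ, dR n * f n = ∑ n ∈ Finset.Icc 1 N, dR n * f n := by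
    refine tsum_eq_sum fun n hn => ?_
    rcases Nat.eq_zero_or_pos n with rfl | hpos
    · simp [dR]
    · rw [h.zero n fun hc => hn (Finset.mem_Icc.2 ⟨hpos, ?_⟩), mul_zero]
      exact_mod_cast hc.2.trans hN.le
  rw [funext (h.isTest_deriv.sum_mul_eq hN), MeasureTheory.integral_finsetSum _ fun n _ =>
    h.isTest_deriv.integrable_indicator n, ht, ← Finset.sum_neg_distrib]
  refine Finset.sum_congr rfl fun n _ => ?_
  rw [MeasureTheory.integral_const_mul, MeasureTheory.integral_indicator measurableSet_Ici,
    MeasureTheory.integral_Ici_eq_integral_Ioi,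
    HasCompactSupport.integral_Ioi_deriv_eq (h.smooth.of_le (by simp))
      (hasCompactSupport_of_eq_zero h.zero), mul_neg]

lemma IsTest.integral_main_mul_deriv (h : IsTest α β f) (h0 : ∫ u, f u = 0) :
    ∫ u, u * (Real.log u + 2 * Real.eulerMascheroniConstant - 1) * deriv f u =
      -∫ u, f u * Real.log u := by
  have hE := h.isTest_euler
  have e : ∀ u, u * (Real.log u + 2 * Real.eulerMascheroniConstant - 1) * deriv f u =
      euler f u * Real.log u + (2 * Real.eulerMascheroniConstant - 1) * euler f u := fun u => by
    rw [euler]; ring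
  have hu : MeasureTheory.Integrable fun u => euler f u * Real.log u := hE.integrable_mul_log
  rw [funext e]
  have hd : ∀ u, HasDerivAt (fun u => f u * (u * Real.log u))
      (euler f u * Real.log u + (f u * Real.log u + f u)) u := fun u => by
    rcases eq_or_ne u 0 with rfl | hu0
    · have hz : f =ᶠ[nhds 0] fun _ => 0 := by
        filter_upwards [gt_mem_nhds h.pos] with v hv
        exact h.zero v fun hc => hc.1.not_gt hv
      have hz' : (fun u => f u * (u * Real.log u)) =ᶠ[nhds 0] fun _ => 0 := by
        filter_upwards [hz] with v hv
        rw [hv, zero_mul]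
      refine ((hasDerivAt_const (0 : ℝ) (0 : ℝ)).congr_of_eventuallyEq hz').congr_deriv ?_
      rw [hz.eq_of_nhds, euler]
      ring
    · refine ((h.hasDerivAt u).fun_mul ((hasDerivAt_id' u).fun_mul
        (Real.hasDerivAt_log hu0))).congr_deriv ?_
      rw [euler]
      field_simp
  have hfl : MeasureTheory.Integrable fun u => f u * Real.log u + f u :=
    h.integrable_mul_log.add h.integrable
  have hprod : MeasureTheory.Integrable fun u => f u * (u * Real.log u) := by
    have := (h.mul_left contDiff_id).integrable_mul_log
    refine this.congr (Eventually.of_forall fun u => ?_)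
    simp only [id]
    ring
  have key := MeasureTheory.integral_eq_zero_of_hasDerivAt_of_integrable hd (hu.add hfl) hprod
  rw [MeasureTheory.integral_add hu hfl, MeasureTheory.integral_add h.integrable_mul_log
    h.integrable,
    h0] at key
  rw [MeasureTheory.integral_add hu (hE.integrable.const_mul _), MeasureTheory.integral_const_mul,
    h.integral_euler, h0]
  linarith

lemma IsTest.integral_dirichletDelta_mul_deriv (h : IsTest α β f) (h0 : ∫ u, f u = 0) :
    ∫ u, dirichletDelta u * deriv f u = (∫ u, f u * Real.log u) - ∑' n : ℕ, dR n * f n := by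
  have h1 := h.integral_sum_mul_deriv
  have h2 := h.integral_main_mul_deriv h0
  simp only [dirichletDelta, sub_mul (∑ n ∈ Finset.Icc 1 ⌊_⌋₊, _)]
  rw [MeasureTheory.integral_sub h.isTest_deriv.integrable_sum_mul
    h.isTest_deriv.integrable_main_mul, h1, h2]
  ring

lemma IsTest.hasSum_kern_deriv (h : IsTest α β f) (h0 : ∫ u, f u = 0) :
    HasSum (fun n : ℕ => dR n * (2 / π * ∫ u, deriv f u * kern (2 * π * u) (2 * π * n)))
      (∫ u, dirichletDelta u * deriv f u) := by
  have h1 := (h.hasSum_dR_mul_cosCoeff h0).neg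
  have e1 : -((∑' n : ℕ, dR n * f n) - ∫ t, dilSum f t) = ∫ u, dirichletDelta u * deriv f u := by
    rw [h.integral_dirichletDelta_mul_deriv h0, h.integral_dilSum h0, neg_sub]
  have e2 : ∀ n : ℕ, -(dR n * (-(cosCoeff f n / (2 * π ^ 2 * (n : ℝ) ^ 2)))) =
      dR n * (2 / π * ∫ u, deriv f u * kern (2 * π * u) (2 * π * n)) := fun n => by
    rcases Nat.eq_zero_or_pos n with rfl | hpos
    · simp [dR]
    · have hn : (0 : ℝ) < n := by exact_mod_cast hpos
      rw [h.cosCoeff_eq hn]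
      generalize ∫ u, deriv f u * kern (2 * π * u) (2 * π * n) = A
      field_simp
  rw [← e1, ← funext e2]
  exact h1

/-- A Voronoi summation formula for test functions orthogonal to affine functions. -/
lemma IsTest.hasSum_kern (h : IsTest α β g) (h0 : ∫ u, g u = 0) (h1 : ∫ u, u * g u = 0) :
    HasSum (fun n : ℕ => dR n * (2 / π * ∫ u, g u * kern (2 * π * u) (2 * π * n)))
      (∫ u, dirichletDelta u * g u) := by
  set f : ℝ → ℝ := fun u => ∫ t in (0 : ℝ)..u, g t with hf
  have hd : ∀ u, HasDerivAt f (g u) u := fun u =>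
    intervalIntegral.integral_hasDerivAt_right (h.continuous.intervalIntegrable _ _)
      h.continuous.stronglyMeasurable.stronglyMeasurableAtFilter h.continuous.continuousAt
  have hdf : deriv f = g := funext fun u => (hd u).deriv
  have hneg : ∀ u, u < α → f u = 0 := fun u hu => by
    refine intervalIntegral.integral_zero_ae (Eventually.of_forall fun t ht => ?_)
    refine h.zero t fun hc => ?_
    rcases Set.mem_uIoc.1 ht with ht | ht
    · exact (hc.1.trans ht.2).not_gt hu
    · exact (hc.1.trans ht.2).not_gt h.pos
  have hpos : ∀ u, β < u → f u = 0 := fun u hu => by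
    rcases lt_or_ge u α with hα | hα
    · exact hneg u hα
    have hu0 : 0 ≤ u := h.pos.le.trans hα
    rw [hf]
    simp only
    rw [intervalIntegral.integral_of_le hu0]
    refine Eq.trans ?_ h0
    refine MeasureTheory.setIntegral_eq_integral_of_forall_compl_eq_zero fun t ht => ?_
    refine h.zero t fun hc => ht ⟨h.pos.trans_le hc.1, hc.2.trans hu.le⟩
  have hft : IsTest α β f :=
    { pos := h.pos
      smooth := contDiff_infty_iff_deriv.2 ⟨fun u => (hd u).differentiableAt,
        by rw [hdf]; exact h.smooth⟩
      zero := fun u hu => by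
        rcases lt_or_ge u α with hα | hα
        · exact hneg u hα
        · exact hpos u (lt_of_not_ge fun hc => hu ⟨hα, hc⟩) }
  have hf0 : ∫ u, f u = 0 := by
    have := hft.integral_euler
    have e : euler f = fun u => u * g u := by funext u; rw [euler, hdf]
    rw [e, h1] at this
    linarith
  have := hft.hasSum_kern_deriv hf0
  rwa [hdf] at this

end Voronoi

section Mollifier

/-- A smooth even probability density supported in `[-1, 1]`. -/
structure IsMollifier (ρ : ℝ → ℝ) : Prop where
  smooth : ContDiff ℝ (⊤ : ℕ∞) ρ
  nonneg : ∀ s, 0 ≤ ρ s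
  even : ∀ s, ρ (-s) = ρ s
  zero : ∀ s ∉ Set.Icc (-1 : ℝ) 1, ρ s = 0
  integral_eq_one : ∫ s, ρ s = 1

lemma exists_isMollifier : ∃ ρ, IsMollifier ρ := by
  let φ : ContDiffBump (0 : ℝ) := ⟨1 / 2, 1, by norm_num, by norm_num⟩
  refine ⟨φ.normed MeasureTheory.volume, φ.contDiff_normed, φ.nonneg_normed, φ.normed_neg,
    fun s hs => ?_, φ.integral_normed⟩
  refine Function.notMem_support.1 fun hc => hs ?_
  rw [φ.support_normed_eq, Real.ball_eq_Ioo] at hc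
  exact ⟨by simpa [φ] using hc.1.le, by simpa [φ] using hc.2.le⟩

variable {ρ : ℝ → ℝ}

lemma IsMollifier.integrable (hρ : IsMollifier ρ) : MeasureTheory.Integrable ρ :=
  integrable_of_eq_zero hρ.smooth.continuous hρ.zero

lemma IsMollifier.integrable_mul (hρ : IsMollifier ρ) {F : ℝ → ℝ} (hF : Continuous F) :
    MeasureTheory.Integrable fun s => ρ s * F s :=
  integrable_of_eq_zero (hρ.smooth.continuous.mul hF) fun s hs => by rw [hρ.zero s hs, zero_mul]

lemma IsMollifier.mul_le_mul (hρ : IsMollifier ρ) {a b s : ℝ} (h : s ∈ Set.Icc (-1 : ℝ) 1 → a ≤ b) :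
    ρ s * a ≤ ρ s * b := by
  by_cases hs : s ∈ Set.Icc (-1 : ℝ) 1
  · exact mul_le_mul_of_nonneg_left (h hs) (hρ.nonneg s)
  · rw [hρ.zero s hs, zero_mul, zero_mul]

lemma IsMollifier.abs_integral_mul_le (hρ : IsMollifier ρ) {F : ℝ → ℝ} {C : ℝ}
    (hF : ∀ s ∈ Set.Icc (-1 : ℝ) 1, |F s| ≤ C) : |∫ s, ρ s * F s| ≤ C := by
  have h1 : ‖∫ s, ρ s * F s‖ ≤ ∫ s, ρ s * C :=
    MeasureTheory.norm_integral_le_of_norm_le (f := fun s => ρ s * F s)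
      (hρ.integrable.mul_const C) (Eventually.of_forall fun s => by
        rw [norm_mul, Real.norm_of_nonneg (hρ.nonneg s)]
        exact hρ.mul_le_mul (hF s))
  rwa [MeasureTheory.integral_mul_const, hρ.integral_eq_one, one_mul] at h1

/-- The cosine transform of a mollifier. -/
noncomputable def mollCos (ρ : ℝ → ℝ) (θ : ℝ) : ℝ := ∫ s, ρ s * Real.cos (θ * s)

lemma IsMollifier.abs_mollCos_le_one (hρ : IsMollifier ρ) (θ : ℝ) : |mollCos ρ θ| ≤ 1 :=
  hρ.abs_integral_mul_le fun _ _ => Real.abs_cos_le_one _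

lemma IsMollifier.integral_mul_sin (hρ : IsMollifier ρ) (θ : ℝ) :
    ∫ s, ρ s * Real.sin (θ * s) = 0 := by
  have h1 := MeasureTheory.integral_neg_eq_self (fun s => ρ s * Real.sin (θ * s))
    MeasureTheory.volume
  have h2 : ∀ s, ρ (-s) * Real.sin (θ * -s) = -(ρ s * Real.sin (θ * s)) := fun s => by
    rw [hρ.even, mul_neg, Real.sin_neg, mul_neg]
  simp only [h2, MeasureTheory.integral_neg] at h1
  linarith

lemma IsMollifier.integral_mul_cos_add (hρ : IsMollifier ρ) (θ b : ℝ) :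
    ∫ s, ρ s * Real.cos (b + θ * s) = mollCos ρ θ * Real.cos b := by
  have e : ∀ s, ρ s * Real.cos (b + θ * s) = Real.cos b * (ρ s * Real.cos (θ * s)) -
      Real.sin b * (ρ s * Real.sin (θ * s)) := fun s => by rw [Real.cos_add]; ring
  have i1 := (hρ.integrable_mul (F := fun s => Real.cos (θ * s))
    (by fun_prop)).const_mul (Real.cos b)
  have i2 := (hρ.integrable_mul (F := fun s => Real.sin (θ * s))
    (by fun_prop)).const_mul (Real.sin b)
  rw [MeasureTheory.integral_congr_ae (Eventually.of_forall e), MeasureTheory.integral_sub i1 i2,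
    MeasureTheory.integral_const_mul, MeasureTheory.integral_const_mul,
      hρ.integral_mul_sin, mollCos]
  ring

lemma IsMollifier.exists_abs_mollCos_le (hρ : IsMollifier ρ) :
    ∃ C, 0 ≤ C ∧ ∀ θ, 0 < θ → |mollCos ρ θ| ≤ C / θ ^ 2 := by
  have hs1 := (contDiff_infty_iff_deriv.1 hρ.smooth)
  have hs2 := (contDiff_infty_iff_deriv.1 hs1.2)
  have hzero : ∀ {F : ℝ → ℝ}, (∀ s ∉ Set.Icc (-1 : ℝ) 1, F s = 0) →
      ∀ s ∉ Set.Icc (-1 : ℝ) 1, deriv F s = 0 := fun {F} hF s hs => by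
    have : F =ᶠ[nhds s] fun _ => 0 := by
      filter_upwards [isClosed_Icc.isOpen_compl.mem_nhds hs] with v hv using hF v hv
    rw [this.deriv_eq, deriv_const]
  have hz1 := hzero hρ.zero
  have hz2 := hzero hz1
  refine ⟨∫ s, |deriv (deriv ρ) s|, MeasureTheory.integral_nonneg fun _ => abs_nonneg _,
    fun θ hθ => ?_⟩
  have hi : ∀ {F G : ℝ → ℝ}, Continuous F → (∀ s ∉ Set.Icc (-1 : ℝ) 1, F s = 0) → Continuous G →
      MeasureTheory.Integrable fun s => F s * G s := fun hF hz hG =>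
    integrable_of_eq_zero (hF.mul hG) fun s hs => by rw [hz s hs, zero_mul]
  have hc0 := hρ.smooth.continuous
  have hc1 := hs1.2.continuous
  have hc2 := hs2.2.continuous
  have hcos : Continuous fun s => Real.cos (θ * s) := by fun_prop
  have hsin : Continuous fun s => Real.sin (θ * s) := by fun_prop
  have hd : ∀ s, HasDerivAt (fun s => θ * (ρ s * Real.sin (θ * s)) + deriv ρ s * Real.cos (θ * s))
      (θ ^ 2 * (ρ s * Real.cos (θ * s)) + deriv (deriv ρ) s * Real.cos (θ * s)) s := fun s => by
    have hlin : HasDerivAt (fun w => θ * w) θ s := by simpa using (hasDerivAt_id' s).const_mul θ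
    refine ((((hs1.1 s).hasDerivAt.fun_mul hlin.sin).const_mul θ).fun_add
      ((hs2.1 s).hasDerivAt.fun_mul hlin.cos)).congr_deriv ?_
    ring
  have i1 := (hi hc0 hρ.zero hcos).const_mul (θ ^ 2)
  have i2 := hi hc2 hz2 hcos
  have key := MeasureTheory.integral_eq_zero_of_hasDerivAt_of_integrable hd (i1.add i2)
    (((hi hc0 hρ.zero hsin).const_mul θ).add (hi hc1 hz1 hcos))
  rw [MeasureTheory.integral_add i1 i2, MeasureTheory.integral_const_mul, ← mollCos] at key
  have hb : |∫ s, deriv (deriv ρ) s * Real.cos (θ * s)| ≤ ∫ s, |deriv (deriv ρ) s| := by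
    refine MeasureTheory.norm_integral_le_of_norm_le
      (f := fun s => deriv (deriv ρ) s * Real.cos (θ * s))
      (integrable_of_eq_zero hc2 hz2).norm (Eventually.of_forall fun s => ?_)
    rw [norm_mul]
    exact mul_le_of_le_one_right (norm_nonneg _) (Real.abs_cos_le_one _)
  rw [le_div_iff₀ (by positivity), ← abs_of_pos (by positivity : 0 < θ ^ 2), ← abs_mul,
    mul_comm, show θ ^ 2 * mollCos ρ θ = -∫ s, deriv (deriv ρ) s * Real.cos (θ * s) by linarith,
    abs_neg]
  exact hb

lemma IsMollifier.abs_one_sub_mollCos_le (hρ : IsMollifier ρ) (θ : ℝ) :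
    |1 - mollCos ρ θ| ≤ θ ^ 2 / 2 := by
  have e : 1 - mollCos ρ θ = ∫ s, ρ s * (1 - Real.cos (θ * s)) := by
    simp only [mul_sub, mul_one]
    rw [MeasureTheory.integral_sub hρ.integrable
      (hρ.integrable_mul (F := fun s => Real.cos (θ * s)) (by fun_prop)),
        hρ.integral_eq_one, mollCos]
  rw [e]
  refine hρ.abs_integral_mul_le fun s hs => ?_
  rw [abs_of_nonneg (by linarith [Real.cos_le_one (θ * s)])]
  have h1 := Real.one_sub_sq_div_two_le_cos (x := θ * s)
  have h2 : s ^ 2 ≤ 1 := by nlinarith [hs.1, hs.2]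
  have h3 : (θ * s) ^ 2 ≤ θ ^ 2 := by rw [mul_pow]; nlinarith [sq_nonneg θ]
  linarith

lemma IsMollifier.abs_one_sub_mollCos_sq_le (hρ : IsMollifier ρ) {θ : ℝ} (hθ : 0 ≤ θ) :
    |1 - mollCos ρ θ ^ 2| ≤ √θ := by
  have h1 := abs_le.1 (hρ.abs_mollCos_le_one θ)
  rcases le_total θ 1 with h | h
  · have h2 := abs_le.1 (hρ.abs_one_sub_mollCos_le θ)
    have h3 : θ ^ 2 ≤ √θ := Real.le_sqrt_of_sq_le (by
      rw [← pow_mul]; exact pow_le_of_le_one hθ h (by norm_num))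
    rw [abs_le]
    constructor <;> nlinarith
  · have h3 : 1 ≤ √θ := Real.one_le_sqrt.2 h
    rw [abs_le]
    constructor <;> nlinarith [sq_nonneg (mollCos ρ θ)]

end Mollifier

section AveragingFunctions

variable {ρ : ℝ → ℝ}

/-- A test function averaging `y⁻¹ᐟ² F(y²)` over `[y - h, y + h]`. -/
noncomputable def avgTest (ρ : ℝ → ℝ) (h y u : ℝ) : ℝ :=
  h⁻¹ * ρ ((√u - y) / h) * ((√√u)⁻¹ * (2 * √u)⁻¹)

lemma IsMollifier.isTest_avgTest (hρ : IsMollifier ρ) {h y : ℝ} (hh : 0 < h) (hy : h < y) :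
    IsTest ((y - h) ^ 2) ((y + h) ^ 2) (avgTest ρ h y) := by
  have hpos : 0 < y - h := sub_pos.2 hy
  have hz : ∀ u ∉ Set.Icc ((y - h) ^ 2) ((y + h) ^ 2), avgTest ρ h y u = 0 := fun u hu => by
    rw [avgTest, hρ.zero, mul_zero, zero_mul]
    rintro ⟨h1, h2⟩
    rw [le_div_iff₀ hh] at h1
    rw [div_le_iff₀ hh] at h2
    have hs : 0 < √u := by linarith
    have hu0 : 0 < u := Real.sqrt_pos.1 hs
    refine hu ⟨?_, ?_⟩
    · rw [← Real.sq_sqrt hu0.le]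
      exact pow_le_pow_left₀ hpos.le (by linarith) 2
    · rw [← Real.sq_sqrt hu0.le]
      exact pow_le_pow_left₀ hs.le (by linarith) 2
  refine ⟨by positivity, contDiff_iff_contDiffAt.2 fun u => ?_, hz⟩
  rcases le_or_gt u 0 with hu | hu
  · have hev : avgTest ρ h y =ᶠ[nhds u] fun _ => 0 := by
      filter_upwards [gt_mem_nhds (hu.trans_lt (by positivity : 0 < (y - h) ^ 2))] with v hv
      exact hz v fun hc => hc.1.not_gt hv
    exact contDiffAt_const.congr_of_eventuallyEq hev
  · have h1 : ContDiffAt ℝ (⊤ : ℕ∞) (fun u : ℝ => √u) u := contDiffAt_id.sqrt hu.ne'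
    have hsq : √u ≠ 0 := (Real.sqrt_pos.2 hu).ne'
    have hsq' : √√u ≠ 0 := (Real.sqrt_pos.2 (Real.sqrt_pos.2 hu)).ne'
    unfold avgTest
    exact (contDiffAt_const.mul (hρ.smooth.contDiffAt.comp u
      ((h1.sub contDiffAt_const).div_const h))).mul
      (((h1.sqrt hsq).inv hsq').mul ((contDiffAt_const.mul h1).inv (mul_ne_zero two_ne_zero hsq)))

lemma IsMollifier.integral_avgTest_mul (hρ : IsMollifier ρ) {h y : ℝ} (hh : 0 < h) (hy : h < y)
    (F : ℝ → ℝ) :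
    ∫ u, avgTest ρ h y u * F u = ∫ s, ρ s * ((√(y + h * s))⁻¹ * F ((y + h * s) ^ 2)) := by
  have h1 : ∫ u, avgTest ρ h y u * F u = ∫ u in Set.Ioi 0, avgTest ρ h y u * F u := by
    refine (MeasureTheory.setIntegral_eq_integral_of_forall_compl_eq_zero fun u hu => ?_).symm
    rw [(hρ.isTest_avgTest hh hy).apply_nonpos (not_lt.1 hu), zero_mul]
  have h2 := MeasureTheory.integral_comp_rpow_Ioi_of_pos (g := fun u => avgTest ρ h y u * F u)
    two_pos
  have h3 : ∫ v in Set.Ioi (0 : ℝ), ((2 : ℝ) * v ^ ((2 : ℝ) - 1)) •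
        (avgTest ρ h y (v ^ (2 : ℝ)) * F (v ^ (2 : ℝ))) =
      ∫ v in Set.Ioi (0 : ℝ), h⁻¹ * (ρ ((v - y) / h) * ((√v)⁻¹ * F (v ^ 2))) := by
    refine MeasureTheory.setIntegral_congr_fun measurableSet_Ioi fun v hv => ?_
    have hv0 : 0 < v := hv
    simp only [Real.rpow_two, smul_eq_mul]
    rw [avgTest, Real.sqrt_sq hv0.le, show (2 : ℝ) - 1 = 1 by norm_num, Real.rpow_one]
    have : √v ≠ 0 := (Real.sqrt_pos.2 hv0).ne'
    field_simp
  have h4 : ∫ v in Set.Ioi (0 : ℝ), h⁻¹ * (ρ ((v - y) / h) * ((√v)⁻¹ * F (v ^ 2))) =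
      ∫ v, h⁻¹ * (ρ ((v - y) / h) * ((√v)⁻¹ * F (v ^ 2))) := by
    refine MeasureTheory.setIntegral_eq_integral_of_forall_compl_eq_zero fun v hv => ?_
    rw [hρ.zero, zero_mul, mul_zero]
    rintro ⟨h5, -⟩
    rw [le_div_iff₀ hh] at h5
    exact hv (by rw [Set.mem_Ioi]; linarith)
  have h5 := MeasureTheory.Measure.integral_comp_mul_left
    (fun v => h⁻¹ * (ρ (v / h) * ((√(y + v))⁻¹ * F ((y + v) ^ 2)))) h
  have h6 := MeasureTheory.integral_add_left_eq_self (μ := MeasureTheory.volume)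
    (fun v => h⁻¹ * (ρ ((v - y) / h) * ((√v)⁻¹ * F (v ^ 2)))) y
  simp only [add_sub_cancel_left] at h6
  rw [h1, ← h2, h3, h4, ← h6]
  simp only [mul_div_cancel_left₀ _ hh.ne', abs_of_pos (inv_pos.2 hh), smul_eq_mul,
    MeasureTheory.integral_const_mul] at h5
  rw [MeasureTheory.integral_const_mul]
  exact (mul_left_cancel₀ (inv_pos.2 hh).ne' h5).symm

end AveragingFunctions

section KernelOfAverages

/-- The coefficients in the truncated Voronoi expansion of the averaged error term. -/
noncomputable def vcoef (ρ : ℝ → ℝ) (h : ℝ) (n : ℕ) : ℝ :=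
  mollCos ρ (4 * π * √n * h) * (dR n / (π * √2 * qroot n ^ 3))

/-- The terms in the Voronoi summation formula. -/
noncomputable def vterm (g : ℝ → ℝ) (n : ℕ) : ℝ :=
  dR n * (2 / π * ∫ u, g u * kern (2 * π * u) (2 * π * n))

lemma abs_kern_sub_cos_le {n : ℕ} (hn : n ≠ 0) {u : ℝ} (hu : 1 / 4 ≤ u) :
    |2 / π * kern (2 * π * u) (2 * π * n) -
      √√u * Real.cos (4 * π * √n * √u - π / 4) / (π * √2 * qroot n ^ 3)| ≤
      (√√u)⁻¹ / qroot n ^ 5 := by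
  have hu0 : 0 < u := by linarith
  have hn0 : (0 : ℝ) < n := by exact_mod_cast Nat.pos_of_ne_zero hn
  have hn1 : (1 : ℝ) ≤ n := by exact_mod_cast Nat.pos_of_ne_zero hn
  have hq := qroot_pos hn
  set q := qroot n with hqdef
  set r := √√u with hrdef
  have hr : 0 < r := Real.sqrt_pos.2 (Real.sqrt_pos.2 hu0)
  have hr2 : r ^ 2 = √u := Real.sq_sqrt (Real.sqrt_nonneg _)
  have hr4 : r ^ 4 = u := by
    rw [show 4 = 2 * 2 from rfl, pow_mul, hr2, Real.sq_sqrt hu0.le]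
  have hq2 : q ^ 2 = √n := qroot_sq n
  have hq4 : q ^ 4 = n := qroot_pow_four n
  have hab : √(2 * π * u * (2 * π * n)) = 2 * π * q ^ 2 * r ^ 2 := by
    rw [← hr4, ← hq4, show 2 * π * r ^ 4 * (2 * π * q ^ 4) = (2 * π * q ^ 2 * r ^ 2) ^ 2 by ring]
    exact Real.sqrt_sq (by positivity)
  have hdiv : √(2 * π * u / (2 * π * n)) = r ^ 2 / q ^ 2 := by
    rw [← hr4, ← hq4, show 2 * π * r ^ 4 / (2 * π * q ^ 4) = (r ^ 2 / q ^ 2) ^ 2 by field_simp]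
    exact Real.sqrt_sq (by positivity)
  have hr2' : 1 / 2 ≤ r ^ 2 := by
    rw [hr2]
    exact Real.le_sqrt_of_sq_le (by linarith)
  have hq2' : 1 ≤ q ^ 2 := by rw [hq2]; exact Real.one_le_sqrt.2 hn1
  have hqr : 1 / 2 ≤ q ^ 2 * r ^ 2 := by nlinarith
  have hl : 1 ≤ 2 * √(2 * π * u * (2 * π * n)) := by
    rw [hab]
    nlinarith [Real.pi_gt_three]
  have key := abs_kern_sub_main_le (a := 2 * π * u) (b := 2 * π * n) (by positivity)
    (by positivity) hl
  rw [hab, hdiv] at key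
  set L := 2 * (2 * π * q ^ 2 * r ^ 2) with hL
  have hLpos : 0 < L := by positivity
  have hsL : √(π / L) = 1 / (2 * q * r) := by
    rw [hL, show π / (2 * (2 * π * q ^ 2 * r ^ 2)) = (1 / (2 * q * r)) ^ 2 by field_simp]
    exact Real.sqrt_sq (by positivity)
  have hsL' : 2 * q * r ≤ √L := by
    refine Real.le_sqrt_of_sq_le ?_
    rw [hL]
    nlinarith [Real.pi_gt_three, (by positivity : 0 < q ^ 2 * r ^ 2)]
  have hcos : Real.sin (L + π / 4) = Real.cos (4 * π * √n * √u - π / 4) := by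
    rw [← hq2, ← hr2, ← Real.cos_pi_div_two_sub, ← Real.cos_neg, hL]
    congr 1
    ring
  rw [hcos, hsL] at key
  have h2 : √2 * √2 = 2 := Real.mul_self_sqrt zero_le_two
  have h2' : 0 < √2 := Real.sqrt_pos.2 two_pos
  generalize Real.cos (4 * π * √n * √u - π / 4) = c at *
  have e : 2 / π * kern (2 * π * u) (2 * π * n) - r * c / (π * √2 * q ^ 3) =
      2 / π * (kern (2 * π * u) (2 * π * n) -
        r ^ 2 / q ^ 2 * (√2 * (1 / (2 * q * r) / 2) * c)) := by
    generalize kern (2 * π * u) (2 * π * n) = k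
    have : r * c / (π * √2 * q ^ 3) = √2 * (r * c) / (2 * (π * q ^ 3)) := by
      rw [div_eq_div_iff (by positivity) (by positivity)]
      linear_combination (-(π * q ^ 3) * r * c) * h2
    rw [this]
    field_simp
  rw [e, abs_mul, abs_of_pos (by positivity : 0 < 2 / π)]
  calc 2 / π * |kern (2 * π * u) (2 * π * n) - r ^ 2 / q ^ 2 * (√2 * (1 / (2 * q * r) / 2) * c)|
      ≤ 2 / π * (r ^ 2 / q ^ 2 * (4 / (L * √L))) := by gcongr
    _ ≤ 2 / π * (r ^ 2 / q ^ 2 * (4 / (L * (2 * q * r)))) := by gcongr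
    _ = r⁻¹ / q ^ 5 * (1 / π ^ 2) := by rw [hL]; field_simp; norm_num
    _ ≤ r⁻¹ / q ^ 5 * 1 := by
        gcongr
        rw [div_le_one (by positivity)]
        nlinarith [Real.pi_gt_three]
    _ = _ := mul_one _

variable {ρ : ℝ → ℝ}

lemma IsMollifier.avgTest_nonneg (hρ : IsMollifier ρ) {h : ℝ} (hh : 0 < h) (y u : ℝ) :
    0 ≤ avgTest ρ h y u := by
  have := hρ.nonneg ((√u - y) / h)
  unfold avgTest
  positivity

lemma IsMollifier.integral_avgTest_le (hρ : IsMollifier ρ) {h y : ℝ} (hh : 0 < h) (hy : h < y) :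
    ∫ u, avgTest ρ h y u ≤ (√(y - h))⁻¹ := by
  have h1 := hρ.integral_avgTest_mul hh hy fun _ => 1
  simp only [mul_one] at h1
  rw [h1]
  refine (le_abs_self _).trans (hρ.abs_integral_mul_le fun s hs => ?_)
  have h2 : 0 < y - h := sub_pos.2 hy
  have h3 : y - h ≤ y + h * s := by nlinarith [hs.1]
  rw [abs_of_nonneg (by positivity)]
  gcongr

lemma IsMollifier.abs_vterm_sub_le (hρ : IsMollifier ρ) {h y : ℝ} (hh : 0 < h) (hh' : h ≤ 1 / 2)
    (hy : 1 ≤ y) (n : ℕ) :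
    |vterm (avgTest ρ h y) n - vcoef ρ h n * Real.cos (4 * π * √n * y - π / 4)| ≤
      2 / y * (dR n / qroot n ^ 5) := by
  rcases eq_or_ne n 0 with rfl | hn
  · simp [vterm, vcoef, dR]
  have hhy : h < y := by linarith
  have hT := hρ.isTest_avgTest hh hhy
  have hn0 : (0 : ℝ) < n := by exact_mod_cast Nat.pos_of_ne_zero hn
  have hq := qroot_pos hn
  have hyh : 1 / 2 ≤ y - h := by linarith
  have hyh0 : 0 < y - h := by linarith
  set M : ℝ → ℝ := fun u =>
    √√u * Real.cos (4 * π * √n * √u - π / 4) / (π * √2 * qroot n ^ 3) with hM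
  have hMc : Continuous M := by
    rw [hM]
    fun_prop
  have hMi : ∫ u, avgTest ρ h y u * M u =
      mollCos ρ (4 * π * √n * h) * Real.cos (4 * π * √n * y - π / 4) / (π * √2 * qroot n ^ 3) := by
    rw [hρ.integral_avgTest_mul hh hhy, ← hρ.integral_mul_cos_add, ← MeasureTheory.integral_div]
    refine MeasureTheory.integral_congr_ae (Eventually.of_forall fun s => ?_)
    simp only
    by_cases hs : s ∈ Set.Icc (-1 : ℝ) 1
    · have h3 : 0 < y + h * s := by nlinarith [hs.1]
      have h4 : √(y + h * s) ≠ 0 := (Real.sqrt_pos.2 h3).ne'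
      rw [hM]
      simp only
      rw [Real.sqrt_sq h3.le, show 4 * π * √n * (y + h * s) - π / 4 =
        4 * π * √n * y - π / 4 + 4 * π * √n * h * s by ring]
      field_simp
    · rw [hρ.zero s hs]; simp
  have hki := (hT.integrable_mul_kern (by positivity : 0 < 2 * π * (n : ℝ))).const_mul (2 / π)
  have e : vterm (avgTest ρ h y) n - vcoef ρ h n * Real.cos (4 * π * √n * y - π / 4) =
      dR n * ∫ u, avgTest ρ h y u * (2 / π * kern (2 * π * u) (2 * π * n) - M u) := by
    have e1 : ∀ u, avgTest ρ h y u * (2 / π * kern (2 * π * u) (2 * π * n) - M u) =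
        2 / π * (avgTest ρ h y u * kern (2 * π * u) (2 * π * n)) - avgTest ρ h y u * M u :=
      fun u => by ring
    rw [MeasureTheory.integral_congr_ae (Eventually.of_forall e1),
      MeasureTheory.integral_sub hki (hT.integrable_mul hMc), MeasureTheory.integral_const_mul, hMi,
      vterm, vcoef]
    ring
  have hb : ∀ u, ‖avgTest ρ h y u * (2 / π * kern (2 * π * u) (2 * π * n) - M u)‖ ≤
      avgTest ρ h y u * ((√(y - h))⁻¹ / qroot n ^ 5) := fun u => by
    by_cases hu : u ∈ Set.Icc ((y - h) ^ 2) ((y + h) ^ 2)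
    · rw [norm_mul, Real.norm_of_nonneg (hρ.avgTest_nonneg hh y u)]
      refine mul_le_mul_of_nonneg_left ?_ (hρ.avgTest_nonneg hh y u)
      refine (abs_kern_sub_cos_le hn (by nlinarith [hu.1])).trans ?_
      have : y - h ≤ √u := Real.le_sqrt_of_sq_le hu.1
      gcongr
    · rw [hT.zero u hu]; simp
  have hfin := MeasureTheory.norm_integral_le_of_norm_le
    (hT.integrable.mul_const _) (Eventually.of_forall hb)
  rw [MeasureTheory.integral_mul_const] at hfin
  rw [e, abs_mul, abs_of_nonneg (dR_nonneg n)]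
  calc dR n * |∫ u, avgTest ρ h y u * (2 / π * kern (2 * π * u) (2 * π * n) - M u)|
      ≤ dR n * ((√(y - h))⁻¹ * ((√(y - h))⁻¹ / qroot n ^ 5)) := by
        have := hρ.integral_avgTest_le hh hhy
        refine mul_le_mul_of_nonneg_left (hfin.trans ?_) (dR_nonneg n)
        gcongr
    _ = (y - h)⁻¹ * (dR n / qroot n ^ 5) := by
        rw [← Real.mul_self_sqrt hyh0.le, mul_inv, Real.mul_self_sqrt hyh0.le]
        ring
    _ ≤ 2 / y * (dR n / qroot n ^ 5) := by
        have := dR_nonneg n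
        gcongr
        rw [inv_le_comm₀ hyh0 (by positivity), inv_div]
        linarith

lemma abs_vcoef_le (hρ : IsMollifier ρ) (h : ℝ) (n : ℕ) : |vcoef ρ h n| ≤ dR n / qroot n ^ 3 := by
  rcases eq_or_ne n 0 with rfl | hn
  · simp [vcoef, dR]
  have hq := qroot_pos hn
  have hd := dR_nonneg n
  have h2 : 1 ≤ √2 := Real.one_le_sqrt.2 one_le_two
  rw [vcoef, abs_mul, abs_of_nonneg (by positivity : 0 ≤ dR n / (π * √2 * qroot n ^ 3))]
  calc _ ≤ 1 * (dR n / (π * √2 * qroot n ^ 3)) := by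
        gcongr; exact hρ.abs_mollCos_le_one _
    _ ≤ dR n / qroot n ^ 3 := by
        rw [one_mul]
        gcongr
        refine le_mul_of_one_le_left (by positivity) ?_
        nlinarith [Real.pi_gt_three]

lemma exists_abs_vcoef_le (hρ : IsMollifier ρ) :
    ∃ C, 0 ≤ C ∧ ∀ h, 0 < h → ∀ n, |vcoef ρ h n| ≤ C / h ^ 2 * (dR n / qroot n ^ 7) := by
  obtain ⟨C, hC, hb⟩ := hρ.exists_abs_mollCos_le
  refine ⟨C, hC, fun h hh n => ?_⟩
  rcases eq_or_ne n 0 with rfl | hn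
  · simp [vcoef, dR]
  have hq := qroot_pos hn
  have hd := dR_nonneg n
  have hpi := Real.pi_gt_three
  have h2 : 1 ≤ √2 := Real.one_le_sqrt.2 one_le_two
  rw [vcoef, abs_mul, abs_of_nonneg (by positivity : 0 ≤ dR n / (π * √2 * qroot n ^ 3)), ← qroot_sq]
  calc _ ≤ C / (4 * π * qroot n ^ 2 * h) ^ 2 * (dR n / (π * √2 * qroot n ^ 3)) := by
        gcongr; exact hb _ (by positivity)
    _ = C / h ^ 2 * (dR n / qroot n ^ 7) * (1 / ((4 * π) ^ 2 * (π * √2))) := by field_simp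
    _ ≤ C / h ^ 2 * (dR n / qroot n ^ 7) * 1 := by
        gcongr
        rw [div_le_one (by positivity)]
        have h3 : 1 ≤ (4 * π) ^ 2 := by nlinarith
        have h4 : 1 ≤ π * √2 := by nlinarith
        nlinarith
    _ = _ := mul_one _

lemma summable_dR_div_qroot : Summable fun n : ℕ => dR n / qroot n ^ 5 := by
  refine (summable_dR (by norm_num : (1 : ℝ) < 5 / 4)).congr fun n => ?_
  rw [div_eq_mul_inv, Real.rpow_neg (by positivity)]
  congr 2
  rw [qroot, Real.sqrt_eq_rpow, Real.sqrt_eq_rpow, ← Real.rpow_mul (by positivity),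
    ← Real.rpow_natCast, ← Real.rpow_mul (by positivity)]
  norm_num

lemma dR_div_qroot_seven_le {N n : ℕ} (hN : N ≠ 0) (hn : N ≤ n) :
    dR n / qroot n ^ 7 ≤ dR n / qroot n ^ 5 / √N := by
  have hN0 : (0 : ℝ) < N := by exact_mod_cast Nat.pos_of_ne_zero hN
  have hq := qroot_pos (n := n) (by omega)
  have hd := dR_nonneg n
  rw [div_div]
  gcongr
  rw [show qroot n ^ 7 = qroot n ^ 5 * qroot n ^ 2 by ring, qroot_sq]
  gcongr

lemma IsMollifier.exists_vterm_bounds (hρ : IsMollifier ρ) :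
    ∃ C, 0 ≤ C ∧ ∀ h y : ℝ, 0 < h → h ≤ 1 / 2 → 1 ≤ y →
      Summable (vterm (avgTest ρ h y)) ∧
      |∑' n, vterm (avgTest ρ h y) n| ≤ C / h ^ 2 ∧
      ∀ N : ℕ, N ≠ 0 →
        |(∑' n, vterm (avgTest ρ h y) n) - vpoly N (vcoef ρ h) y| ≤ C / y + C / (h ^ 2 * √N) := by
  obtain ⟨C, hC, hb⟩ := exists_abs_vcoef_le hρ
  set K := ∑' n : ℕ, dR n / qroot n ^ 5 with hK
  have hq5 : ∀ n : ℕ, 0 ≤ dR n / qroot n ^ 5 := fun n =>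
    div_nonneg (dR_nonneg n) (pow_nonneg (qroot_nonneg n) 5)
  have hK0 : 0 ≤ K := tsum_nonneg hq5
  have hs := summable_dR_div_qroot
  refine ⟨(C + 2) * K, by positivity, fun h y hh hh' hy => ?_⟩
  have hy0 : 0 < y := by linarith
  have hterm : ∀ n, |vterm (avgTest ρ h y) n| ≤
      (C + 2) / h ^ 2 * (dR n / qroot n ^ 5) := fun n => by
    rcases eq_or_ne n 0 with rfl | hn
    · simp [vterm, dR]
    have h1 := hρ.abs_vterm_sub_le hh hh' hy n
    have h2 := abs_sub_abs_le_abs_sub (vterm (avgTest ρ h y) n)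
      (vcoef ρ h n * Real.cos (4 * π * √n * y - π / 4))
    have h3 : |vcoef ρ h n * Real.cos (4 * π * √n * y - π / 4)| ≤
        C / h ^ 2 * (dR n / qroot n ^ 5) := by
      rw [abs_mul]
      refine (mul_le_of_le_one_right (abs_nonneg _) (Real.abs_cos_le_one _)).trans
        ((hb h hh n).trans ?_)
      have h4 := dR_div_qroot_seven_le (N := 1) one_ne_zero (Nat.one_le_iff_ne_zero.2 hn)
      rw [Nat.cast_one, Real.sqrt_one, div_one] at h4
      gcongr
    have h5 : 2 / y ≤ 2 / h ^ 2 := by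
      gcongr
      nlinarith
    have h6 := mul_le_mul_of_nonneg_right h5 (hq5 n)
    rw [add_div, add_mul]
    linarith
  have hsum : Summable (vterm (avgTest ρ h y)) :=
    Summable.of_norm_bounded (hs.mul_left ((C + 2) / h ^ 2)) hterm
  refine ⟨hsum, ?_, fun N hN => ?_⟩
  · have := tsum_of_norm_bounded (f := vterm (avgTest ρ h y))
      (hs.mul_left ((C + 2) / h ^ 2)).hasSum hterm
    rw [tsum_mul_left, ← hK] at this
    exact this.trans_eq (by ring)
  · have hN0 : (0 : ℝ) < N := by exact_mod_cast Nat.pos_of_ne_zero hN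
    have hp : HasSum (fun n => if n ∈ Finset.Icc 1 N then
        vcoef ρ h n * Real.cos (4 * π * √n * y - π / 4) else 0) (vpoly N (vcoef ρ h) y) := by
      rw [vpoly, ← Finset.sum_extend_by_zero]
      exact hasSum_sum_of_ne_finset_zero fun n hn => if_neg hn
    have hd := hsum.hasSum.sub hp
    have hbd : ∀ n, ‖vterm (avgTest ρ h y) n - (if n ∈ Finset.Icc 1 N then
        vcoef ρ h n * Real.cos (4 * π * √n * y - π / 4) else 0)‖ ≤
        (2 / y + C / (h ^ 2 * √N)) * (dR n / qroot n ^ 5) := fun n => by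
      have h1 := hρ.abs_vterm_sub_le hh hh' hy n
      have h0 : 0 ≤ C / (h ^ 2 * √N) * (dR n / qroot n ^ 5) := mul_nonneg (by positivity) (hq5 n)
      rw [Real.norm_eq_abs, add_mul]
      split_ifs with hn
      · linarith
      · rw [sub_zero]
        rcases eq_or_ne n 0 with rfl | hn0
        · simp [vterm, dR]
        have hNn : N ≤ n := by
          rw [Finset.mem_Icc] at hn
          omega
        have h2 := abs_sub_abs_le_abs_sub (vterm (avgTest ρ h y) n)
          (vcoef ρ h n * Real.cos (4 * π * √n * y - π / 4))
        have h3 : |vcoef ρ h n * Real.cos (4 * π * √n * y - π / 4)| ≤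
            C / (h ^ 2 * √N) * (dR n / qroot n ^ 5) := by
          rw [abs_mul]
          refine (mul_le_of_le_one_right (abs_nonneg _) (Real.abs_cos_le_one _)).trans
            ((hb h hh n).trans ?_)
          calc C / h ^ 2 * (dR n / qroot n ^ 7) ≤ C / h ^ 2 * (dR n / qroot n ^ 5 / √N) :=
                mul_le_mul_of_nonneg_left (dR_div_qroot_seven_le hN hNn) (by positivity)
            _ = _ := by
                have := (Real.sqrt_pos.2 hN0).ne'
                field_simp
        linarith
    have := hd.tsum_eq ▸ tsum_of_norm_bounded
      (hs.mul_left (2 / y + C / (h ^ 2 * √N))).hasSum hbd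
    rw [tsum_mul_left, ← hK] at this
    refine this.trans ?_
    rw [add_mul]
    have e1 : 2 / y * K ≤ (C + 2) * K / y := by
      rw [div_mul_eq_mul_div]
      gcongr
      linarith
    have e2 : C / (h ^ 2 * √N) * K ≤ (C + 2) * K / (h ^ 2 * √N) := by
      rw [div_mul_eq_mul_div]
      gcongr
      linarith
    exact add_le_add e1 e2

end KernelOfAverages

section Functional

variable {α β α₁ β₁ α₂ β₂ : ℝ} {g g₁ g₂ : ℝ → ℝ}

/-- Three test functions, combined linearly so that the integral is additive. -/
lemma integral_linear_combination {f f₁ f₂ : ℝ → ℝ} (D a b : ℝ) (h : MeasureTheory.Integrable f)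
    (h₁ : MeasureTheory.Integrable f₁) (h₂ : MeasureTheory.Integrable f₂) :
    ∫ u, (D * f u - (a * f₁ u + b * f₂ u)) =
      D * (∫ u, f u) - (a * (∫ u, f₁ u) + b * ∫ u, f₂ u) := by
  have i : MeasureTheory.Integrable fun u => a * f₁ u + b * f₂ u :=
    (h₁.const_mul a).add (h₂.const_mul b)
  rw [MeasureTheory.integral_sub (h.const_mul D) i, MeasureTheory.integral_const_mul,
    MeasureTheory.integral_add (h₁.const_mul a) (h₂.const_mul b), MeasureTheory.integral_const_mul,
    MeasureTheory.integral_const_mul]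

lemma IsTest.linear_combination (h : IsTest α β g) (h₁ : IsTest α₁ β₁ g₁) (h₂ : IsTest α₂ β₂ g₂)
    (D a b : ℝ) : IsTest (min α (min α₁ α₂)) (max β (max β₁ β₂))
      fun u => D * g u - (a * g₁ u + b * g₂ u) where
  pos := lt_min h.pos (lt_min h₁.pos h₂.pos)
  smooth := (contDiff_const.mul h.smooth).sub
    ((contDiff_const.mul h₁.smooth).add (contDiff_const.mul h₂.smooth))
  zero := fun u hu => by
    simp only [Set.mem_Icc, min_le_iff, le_max_iff, not_and_or, not_or] at hu
    rw [h.zero u, h₁.zero u, h₂.zero u]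
    · ring
    all_goals
      simp only [Set.mem_Icc, not_and_or]
      tauto

lemma exists_dirichletDelta_functional (h₁ : IsTest α₁ β₁ g₁) (h₂ : IsTest α₂ β₂ g₂)
    (hs₁ : Summable (vterm g₁)) (hs₂ : Summable (vterm g₂))
    (hD : (∫ u, g₁ u) * (∫ u, u * g₂ u) - (∫ u, g₂ u) * (∫ u, u * g₁ u) ≠ 0) :
    ∃ c₀ c₁ : ℝ, ∀ (α β : ℝ) (g : ℝ → ℝ), IsTest α β g → Summable (vterm g) →
      (∫ u, dirichletDelta u * g u) - ∑' n, vterm g n = c₀ * (∫ u, g u) + c₁ * ∫ u, u * g u := by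
  set P₁ := ∫ u, g₁ u with hP₁
  set P₂ := ∫ u, g₂ u with hP₂
  set Q₁ := ∫ u, u * g₁ u with hQ₁
  set Q₂ := ∫ u, u * g₂ u with hQ₂
  set D := P₁ * Q₂ - P₂ * Q₁ with hDdef
  set L₁ := (∫ u, dirichletDelta u * g₁ u) - ∑' n, vterm g₁ n with hL₁
  set L₂ := (∫ u, dirichletDelta u * g₂ u) - ∑' n, vterm g₂ n with hL₂
  refine ⟨(Q₂ * L₁ - Q₁ * L₂) / D, (P₁ * L₂ - P₂ * L₁) / D, fun α β g h hs => ?_⟩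
  set P := ∫ u, g u with hP
  set Q := ∫ u, u * g u with hQ
  set a := P * Q₂ - P₂ * Q with ha
  set b := P₁ * Q - P * Q₁ with hb
  have hG := h.linear_combination h₁ h₂ D a b
  have hu {α β : ℝ} {g : ℝ → ℝ} (h : IsTest α β g) : MeasureTheory.Integrable fun u => u * g u :=
    (h.mul_left contDiff_id).integrable
  have e0 : ∫ u, (D * g u - (a * g₁ u + b * g₂ u)) = 0 := by
    rw [integral_linear_combination D a b h.integrable h₁.integrable h₂.integrable]
    simp only [← hP, ← hP₁, ← hP₂, hDdef, ha, hb]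
    ring
  have e1 : ∫ u, u * (D * g u - (a * g₁ u + b * g₂ u)) = 0 := by
    have : ∀ u, u * (D * g u - (a * g₁ u + b * g₂ u)) =
      D * (u * g u) - (a * (u * g₁ u) + b * (u * g₂ u)) := fun u => by ring
    rw [funext this, integral_linear_combination D a b (hu h) (hu h₁) (hu h₂)]
    simp only [← hQ, ← hQ₁, ← hQ₂, hDdef, ha, hb]
    ring
  have key := (hG.hasSum_kern e0 e1).tsum_eq
  have e2 : ∫ u, dirichletDelta u * (D * g u - (a * g₁ u + b * g₂ u)) =
      D * (∫ u, dirichletDelta u * g u) - (a * (∫ u, dirichletDelta u * g₁ u) +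
        b * ∫ u, dirichletDelta u * g₂ u) := by
    rw [← integral_linear_combination D a b h.integrable_dirichletDelta_mul
      h₁.integrable_dirichletDelta_mul h₂.integrable_dirichletDelta_mul]
    exact MeasureTheory.integral_congr_ae (Eventually.of_forall fun u => by ring)
  have e3 : ∀ n : ℕ, dR n * (2 / π * ∫ u, (D * g u - (a * g₁ u + b * g₂ u)) *
      kern (2 * π * u) (2 * π * n)) = D * vterm g n - (a * vterm g₁ n + b * vterm g₂ n) :=
      fun n => by
    rcases eq_or_ne n 0 with rfl | hn
    · simp [vterm, dR]
    have hn0 : (0 : ℝ) < n := by exact_mod_cast Nat.pos_of_ne_zero hn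
    have hb' : 0 < 2 * π * n := by positivity
    have : ∀ u, (D * g u - (a * g₁ u + b * g₂ u)) * kern (2 * π * u) (2 * π * n) =
      D * (g u * kern (2 * π * u) (2 * π * n)) - (a * (g₁ u * kern (2 * π * u) (2 * π * n)) +
        b * (g₂ u * kern (2 * π * u) (2 * π * n))) := fun u => by ring
    rw [funext this, integral_linear_combination D a b (h.integrable_mul_kern hb')
      (h₁.integrable_mul_kern hb') (h₂.integrable_mul_kern hb')]
    simp only [vterm]
    ring
  rw [funext e3, e2, ((hs.mul_left D).tsum_sub ((hs₁.mul_left a).add (hs₂.mul_left b))),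
    (hs₁.mul_left a).tsum_add (hs₂.mul_left b), tsum_mul_left, tsum_mul_left, tsum_mul_left] at key
  have : D * ((∫ u, dirichletDelta u * g u) - ∑' n, vterm g n) = a * L₁ + b * L₂ := by
    rw [hL₁, hL₂]
    linarith
  rw [← mul_right_inj' hD, this, ha, hb]
  field_simp
  ring

end Functional

section AveragedError

variable {ρ : ℝ → ℝ} {h y : ℝ}

lemma IsMollifier.le_integral_avgTest (hρ : IsMollifier ρ) (hh : 0 < h) (hy : h < y) :
    (√(y + h))⁻¹ ≤ ∫ u, avgTest ρ h y u := by
  have e1 := hρ.integral_avgTest_mul hh hy fun _ => 1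
  simp only [mul_one] at e1
  have e2 : ∀ s, ρ s * (√(y + h * s))⁻¹ = ρ s * (√(max (y + h * s) (y - h)))⁻¹ := fun s => by
    by_cases hs : s ∈ Set.Icc (-1 : ℝ) 1
    · rw [max_eq_left]
      nlinarith [hs.1]
    · rw [hρ.zero s hs, zero_mul, zero_mul]
  have hpos : ∀ s, 0 < √(max (y + h * s) (y - h)) := fun s =>
    Real.sqrt_pos.2 (lt_max_of_lt_right (by linarith))
  have hc : Continuous fun s => (√(max (y + h * s) (y - h)))⁻¹ :=
    Continuous.inv₀ (by fun_prop) fun s => (hpos s).ne'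
  have h1 : ∫ s, ρ s * (√(y + h))⁻¹ ≤ ∫ s, ρ s * (√(max (y + h * s) (y - h)))⁻¹ :=
    MeasureTheory.integral_mono (hρ.integrable.mul_const _) (hρ.integrable_mul hc) fun s =>
      hρ.mul_le_mul fun hs => by
        have := hpos s
        gcongr
        refine max_le ?_ (by linarith)
        nlinarith [hs.2]
  rw [MeasureTheory.integral_mul_const, hρ.integral_eq_one, one_mul] at h1
  rw [e1, funext e2]
  exact h1

lemma IsMollifier.abs_integral_avgTest_sub_le (hρ : IsMollifier ρ) (hh : 0 < h) (hh' : h ≤ 1 / 2)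
    (hy : 1 ≤ y) : |(∫ u, avgTest ρ h y u) - (√y)⁻¹| ≤ 2 / y := by
  have hl := hρ.le_integral_avgTest hh (by linarith : h < y)
  have hu := hρ.integral_avgTest_le hh (by linarith : h < y)
  have hp : 0 < √(y - h) := Real.sqrt_pos.2 (by linarith)
  have hq : 0 < √(y + h) := Real.sqrt_pos.2 (by linarith)
  have hr : 0 < √y := Real.sqrt_pos.2 (by linarith)
  have h1 : (√y)⁻¹ ≤ (√(y - h))⁻¹ := by gcongr; linarith
  have h2 : (√(y + h))⁻¹ ≤ (√y)⁻¹ := by gcongr; linarith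
  have h3 : (√(y - h))⁻¹ - (√(y + h))⁻¹ ≤ 2 / y := by
    have hp2 := Real.sq_sqrt (by linarith : 0 ≤ y - h)
    have hq2 := Real.sq_sqrt (by linarith : 0 ≤ y + h)
    have hpq : √(y - h) ≤ √(y + h) := Real.sqrt_le_sqrt (by linarith)
    have hp1 : 1 / 2 ≤ √(y - h) := Real.le_sqrt_of_sq_le (by linarith)
    generalize √(y - h) = p at *
    generalize √(y + h) = q at *
    have e : p⁻¹ - q⁻¹ = (q - p) / (p * q) := by field_simp
    rw [e, div_le_div_iff₀ (by positivity) (by linarith)]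
    have a1 : q - p ≤ 1 := by nlinarith
    have a2 : y ≤ 2 * (p * q) := by nlinarith
    nlinarith
  rw [abs_le]
  constructor <;> linarith

lemma IsMollifier.moment_bounds (hρ : IsMollifier ρ) (hh : 0 < h) (hy : h < y) :
    (y - h) ^ 2 * (∫ u, avgTest ρ h y u) ≤ ∫ u, u * avgTest ρ h y u ∧
      ∫ u, u * avgTest ρ h y u ≤ (y + h) ^ 2 * ∫ u, avgTest ρ h y u := by
  have ht := hρ.isTest_avgTest hh hy
  have hi : MeasureTheory.Integrable fun u => u * avgTest ρ h y u :=
    (ht.mul_left contDiff_id).integrable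
  rw [← MeasureTheory.integral_const_mul, ← MeasureTheory.integral_const_mul]
  refine ⟨MeasureTheory.integral_mono (ht.integrable.const_mul _) hi fun u => ?_,
    MeasureTheory.integral_mono hi (ht.integrable.const_mul _) fun u => ?_⟩
  all_goals
    by_cases hu : u ∈ Set.Icc ((y - h) ^ 2) ((y + h) ^ 2)
    · first
      | exact mul_le_mul_of_nonneg_right hu.1 (hρ.avgTest_nonneg hh y u)
      | exact mul_le_mul_of_nonneg_right hu.2 (hρ.avgTest_nonneg hh y u)
    · simp [ht.zero u hu]

lemma IsMollifier.abs_integral_dirichletDelta_mul_avgTest_le (hρ : IsMollifier ρ) (hh : 0 < h)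
    (hy : h + 1 ≤ y) :
    |∫ u, dirichletDelta u * avgTest ρ h y u| ≤ 8 * (y + h) * ∫ u, avgTest ρ h y u := by
  have ht := hρ.isTest_avgTest hh (by linarith : h < y)
  rw [← MeasureTheory.integral_const_mul]
  refine MeasureTheory.norm_integral_le_of_norm_le (f := fun u =>
    dirichletDelta u * avgTest ρ h y u)
    (ht.integrable.const_mul _) (Eventually.of_forall fun u => ?_)
  by_cases hu : u ∈ Set.Icc ((y - h) ^ 2) ((y + h) ^ 2)
  · have hu1 : 1 ≤ u := le_trans (by nlinarith) hu.1
    have h1 := abs_dirichletDelta_le hu1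
    have h2 : √u ≤ y + h := (Real.sqrt_le_left (by linarith)).2 hu.2
    rw [Real.norm_eq_abs, abs_mul, abs_of_nonneg (hρ.avgTest_nonneg hh y u)]
    exact mul_le_mul_of_nonneg_right (by linarith) (hρ.avgTest_nonneg hh y u)
  · simp [ht.zero u hu]

lemma IsMollifier.exists_integral_dirichletDelta_mul_avgTest_eq (hρ : IsMollifier ρ) :
    ∃ c : ℝ, ∀ h y : ℝ, 0 < h → h ≤ 1 / 2 → 1 ≤ y →
      (∫ u, dirichletDelta u * avgTest ρ h y u) - ∑' n, vterm (avgTest ρ h y) n =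
        c * ∫ u, avgTest ρ h y u := by
  obtain ⟨C, hC, hb⟩ := hρ.exists_vterm_bounds
  have hhalf : (0 : ℝ) < 1 / 2 := by norm_num
  have hM {y : ℝ} (hy : 1 ≤ y) : 0 < ∫ u, avgTest ρ (1 / 2) y u :=
    (inv_pos.2 (Real.sqrt_pos.2 (by linarith))).trans_le
      (hρ.le_integral_avgTest hhalf (by linarith : 1 / 2 < y))
  have hdet : (∫ u, avgTest ρ (1 / 2) 1 u) * (∫ u, u * avgTest ρ (1 / 2) 3 u) -
      (∫ u, avgTest ρ (1 / 2) 3 u) * (∫ u, u * avgTest ρ (1 / 2) 1 u) ≠ 0 := by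
    have h1 := hM (y := 1) (by norm_num)
    have h3 := hM (y := 3) (by norm_num)
    have b1 := (hρ.moment_bounds hhalf (by norm_num : (1 / 2 : ℝ) < 1)).2
    have b3 := (hρ.moment_bounds hhalf (by norm_num : (1 / 2 : ℝ) < 3)).1
    have := mul_le_mul_of_nonneg_left b1 h3.le
    have := mul_le_mul_of_nonneg_left b3 h1.le
    nlinarith [mul_pos h1 h3]
  obtain ⟨c₀, c₁, hc⟩ := exists_dirichletDelta_functional
    (hρ.isTest_avgTest hhalf (by norm_num : (1 / 2 : ℝ) < 1))
    (hρ.isTest_avgTest hhalf (by norm_num : (1 / 2 : ℝ) < 3))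
    (hb _ _ hhalf le_rfl le_rfl).1 (hb _ _ hhalf le_rfl (by norm_num)).1 hdet
  set K := 8 + 4 * C + |c₀| with hK
  have hbound : ∀ y : ℝ, 2 ≤ y → |c₁| * y ≤ 8 * K := fun y hy => by
    have hy1 : 1 ≤ y := by linarith
    have hM0 := hM hy1
    have e := hc _ _ _ (hρ.isTest_avgTest hhalf (by linarith : 1 / 2 < y))
      (hb _ _ hhalf le_rfl hy1).1
    have a1 := hρ.abs_integral_dirichletDelta_mul_avgTest_le hhalf (by linarith : 1 / 2 + 1 ≤ y)
    have a2 := (hb _ _ hhalf le_rfl hy1).2.1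
    have a3 := (hρ.moment_bounds hhalf (by linarith : 1 / 2 < y)).1
    have a4 := hρ.le_integral_avgTest hhalf (by linarith : 1 / 2 < y)
    have a5 : 1 ≤ (y + 1 / 2) * ∫ u, avgTest ρ (1 / 2) y u := by
      have h1 : 0 < √(y + 1 / 2) := Real.sqrt_pos.2 (by linarith)
      have h2 : √(y + 1 / 2) ≤ y + 1 / 2 := (Real.sqrt_le_left (by linarith)).2 (by nlinarith)
      rw [inv_le_iff_one_le_mul₀' h1] at a4
      exact a4.trans (mul_le_mul_of_nonneg_right h2 hM0.le)
    generalize (∫ u, u * avgTest ρ (1 / 2) y u) = M₁ at *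
    generalize (∫ u, avgTest ρ (1 / 2) y u) = M₀ at *
    generalize (∫ u, dirichletDelta u * avgTest ρ (1 / 2) y u) = I at *
    generalize (∑' n, vterm (avgTest ρ (1 / 2) y) n) = S at *
    have hM1 : 0 ≤ M₁ := le_trans (by positivity) a3
    have a6 : |c₁| * M₁ ≤ 8 * (y + 1 / 2) * M₀ + 4 * C + |c₀| * M₀ := by
      have e1 : c₁ * M₁ = I - S - c₀ * M₀ := by linarith
      rw [← abs_of_nonneg hM1, ← abs_mul, e1]
      have t1 := abs_sub (I - S) (c₀ * M₀)
      have t2 := abs_sub I S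
      rw [abs_mul c₀, abs_of_pos hM0] at t1
      norm_num at a2
      linarith
    have a7 : |c₁| * (y - 1 / 2) ^ 2 * M₀ ≤ K * (y + 1 / 2) * M₀ := by
      have t1 := mul_le_mul_of_nonneg_left a3 (abs_nonneg c₁)
      have t2 := mul_le_mul_of_nonneg_left a5 (by linarith : 0 ≤ 4 * C)
      have t3 : |c₀| * M₀ ≤ |c₀| * (y + 1 / 2) * M₀ := by
        have := abs_nonneg c₀
        have : |c₀| ≤ |c₀| * (y + 1 / 2) := by nlinarith
        exact mul_le_mul_of_nonneg_right this hM0.le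
      rw [hK]
      linarith
    have a8 := le_of_mul_le_mul_right a7 hM0
    have hK0 : 0 ≤ K := by positivity
    have a9 : |c₁| * y * y ≤ 8 * K * y := by
      have t1 : y ^ 2 ≤ 4 * (y - 1 / 2) ^ 2 := by nlinarith
      have t2 := mul_le_mul_of_nonneg_left t1 (abs_nonneg c₁)
      have t3 := mul_le_mul_of_nonneg_left (by linarith : y + 1 / 2 ≤ 2 * y) hK0
      linarith
    exact le_of_mul_le_mul_right a9 (by linarith)
  have hc1 : c₁ = 0 := by
    by_contra hne
    have hpos : 0 < |c₁| := abs_pos.2 hne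
    have hK0 : 0 ≤ K := by positivity
    have := hbound (2 + 8 * K / |c₁|) (by
      have : 0 ≤ 8 * K / |c₁| := by positivity
      linarith)
    rw [mul_add, mul_div_cancel₀ _ hpos.ne'] at this
    linarith
  refine ⟨c₀, fun h y hh hh' hy => ?_⟩
  rw [hc _ _ _ (hρ.isTest_avgTest hh (by linarith : h < y)) (hb _ _ hh hh' hy).1, hc1, zero_mul,
    add_zero]

/-- Truncated Voronoi expansion of a local average of the normalized error term. -/
lemma IsMollifier.exists_abs_average_sub_vpoly_le (hρ : IsMollifier ρ) :
    ∃ c C : ℝ, 0 ≤ C ∧ ∀ h y : ℝ, 0 < h → h ≤ 1 / 2 → 1 ≤ y → ∀ N : ℕ, N ≠ 0 →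
      |(∫ s, ρ s * ((√(y + h * s))⁻¹ * dirichletDelta ((y + h * s) ^ 2))) -
        vpoly N (vcoef ρ h) y - c * (√y)⁻¹| ≤ C / y + C / (h ^ 2 * √N) := by
  obtain ⟨C, hC, hb⟩ := hρ.exists_vterm_bounds
  obtain ⟨c, hc⟩ := hρ.exists_integral_dirichletDelta_mul_avgTest_eq
  refine ⟨c, C + 2 * |c|, by positivity, fun h y hh hh' hy N hN => ?_⟩
  have h1 := hρ.integral_avgTest_mul hh (by linarith : h < y) dirichletDelta
  have h2 := hc h y hh hh' hy
  have h3 := (hb h y hh hh' hy).2.2 N hN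
  have h4 := hρ.abs_integral_avgTest_sub_le hh hh' hy
  have e : ∫ u, avgTest ρ h y u * dirichletDelta u = ∫ u, dirichletDelta u * avgTest ρ h y u :=
    MeasureTheory.integral_congr_ae (Eventually.of_forall fun u => mul_comm _ _)
  rw [← h1, e]
  generalize (∫ u, avgTest ρ h y u) = M₀ at *
  generalize (∫ u, dirichletDelta u * avgTest ρ h y u) = I at *
  generalize (∑' n, vterm (avgTest ρ h y) n) = S at *
  have e2 : I - vpoly N (vcoef ρ h) y - c * (√y)⁻¹ =
      (S - vpoly N (vcoef ρ h) y) + c * (M₀ - (√y)⁻¹) := by linarith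
  rw [e2]
  refine (abs_add_le _ _).trans ?_
  rw [abs_mul]
  have h5 := mul_le_mul_of_nonneg_left h4 (abs_nonneg c)
  have h6 : C / (h ^ 2 * √N) ≤ (C + 2 * |c|) / (h ^ 2 * √N) := by
    gcongr
    linarith [abs_nonneg c]
  have h7 : (C + 2 * |c|) / y = C / y + |c| * (2 / y) := by ring
  linarith

end AveragedError

section Smoothing

variable {ρ : ℝ → ℝ} {h y Y : ℝ}

/-- The summatory function of the number of divisors, at the square of the argument. -/
noncomputable def divSum (y : ℝ) : ℝ := ∑ n ∈ Finset.Icc 1 ⌊y ^ 2⌋₊, (n.divisors.card : ℝ)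

lemma divSum_nonneg (y : ℝ) : 0 ≤ divSum y := Finset.sum_nonneg fun _ _ => Nat.cast_nonneg _

lemma divSum_monotoneOn : MonotoneOn divSum (Set.Ici 0) := fun a ha b _ hab => by
  refine Finset.sum_le_sum_of_subset_of_nonneg (Finset.Icc_subset_Icc le_rfl ?_)
    fun _ _ _ => Nat.cast_nonneg _
  exact Nat.floor_mono (pow_le_pow_left₀ ha hab 2)

lemma divSum_le (y : ℝ) : divSum y ≤ y ^ 4 := by
  have hf : (⌊y ^ 2⌋₊ : ℝ) ≤ y ^ 2 := Nat.floor_le (by positivity)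
  have h1 : divSum y ≤ ∑ n ∈ Finset.Icc 1 ⌊y ^ 2⌋₊, y ^ 2 := by
    refine Finset.sum_le_sum fun n hn => ?_
    have : (n.divisors.card : ℝ) ≤ n := by exact_mod_cast Nat.card_divisors_le_self n
    refine this.trans (le_trans ?_ hf)
    exact_mod_cast (Finset.mem_Icc.1 hn).2
  rw [Finset.sum_const, Nat.card_Icc, Nat.add_sub_cancel, nsmul_eq_mul] at h1
  nlinarith [sq_nonneg y]

lemma divSum_le_of_le (hY : 1 ≤ Y) (hy : 0 ≤ y) (hyY : y ≤ Y + 1 / 2) : divSum y ≤ 16 * Y ^ 4 := by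
  have h1 : y ^ 4 ≤ (2 * Y) ^ 4 := pow_le_pow_left₀ hy (by linarith) 4
  linarith [divSum_le y, mul_pow 2 Y 4]

/-- The variation of the divisor sum near `y`. -/
noncomputable def divJump (h y : ℝ) : ℝ := divSum (y + h) - divSum (y - h)

lemma divJump_nonneg (hh : 0 ≤ h) (hy : h ≤ y) : 0 ≤ divJump h y :=
  sub_nonneg.2 (divSum_monotoneOn (sub_nonneg.2 hy) (by simp only [Set.mem_Ici]; linarith)
    (by linarith))

lemma divJump_le (hh : 0 ≤ h) (hh' : h ≤ 1 / 2) (hy : 1 ≤ y) (hyY : y ≤ Y) :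
    divJump h y ≤ 16 * Y ^ 4 :=
  (sub_le_self _ (divSum_nonneg _)).trans
    (divSum_le_of_le (by linarith) (by linarith) (by linarith))

lemma intervalIntegrable_divSum {a b : ℝ} (ha : 0 ≤ a) (hb : 0 ≤ b) :
    IntervalIntegrable divSum MeasureTheory.volume a b :=
  (divSum_monotoneOn.mono fun _ hx => (le_inf ha hb).trans hx.1).intervalIntegrable

lemma intervalIntegrable_divJump (hh : 0 ≤ h) (hh' : h ≤ 1 / 2) (hY : 1 ≤ Y) :
    IntervalIntegrable (divJump h) MeasureTheory.volume 1 Y := by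
  have h1 := (intervalIntegrable_divSum (a := 1 + h) (b := Y + h) (by linarith)
    (by linarith)).comp_add_right h
  have h2 := (intervalIntegrable_divSum (a := 1 - h) (b := Y - h) (by linarith)
    (by linarith)).comp_sub_right h
  simp only [add_sub_cancel_right, sub_add_cancel] at h1 h2
  exact h1.sub h2

lemma integral_divJump_le (hh : 0 ≤ h) (hh' : h ≤ 1 / 2) (hY : 1 ≤ Y) :
    ∫ y in (1 : ℝ)..Y, divJump h y ≤ 32 * h * Y ^ 4 := by
  have h1 := (intervalIntegrable_divSum (a := 1 + h) (b := Y + h) (by linarith)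
    (by linarith)).comp_add_right h
  have h2 := (intervalIntegrable_divSum (a := 1 - h) (b := Y - h) (by linarith)
    (by linarith)).comp_sub_right h
  simp only [add_sub_cancel_right, sub_add_cancel] at h1 h2
  simp only [divJump]
  rw [intervalIntegral.integral_sub h1 h2, intervalIntegral.integral_comp_add_right divSum,
    intervalIntegral.integral_comp_sub_right divSum,
    intervalIntegral.integral_interval_sub_interval_comm
      (intervalIntegrable_divSum (by linarith) (by linarith))
      (intervalIntegrable_divSum (by linarith) (by linarith))
      (intervalIntegrable_divSum (by linarith) (by linarith)),
    intervalIntegral.integral_symm (1 - h), intervalIntegral.integral_symm (Y - h)]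
  have h3 : 0 ≤ ∫ y in (1 - h)..(1 + h), divSum y :=
    intervalIntegral.integral_nonneg (by linarith) fun _ _ => divSum_nonneg _
  have h4 : ∫ y in (Y - h)..(Y + h), divSum y ≤ ∫ _ in (Y - h)..(Y + h), 16 * Y ^ 4 :=
    intervalIntegral.integral_mono_on (by linarith)
      (intervalIntegrable_divSum (by linarith) (by linarith)) intervalIntegrable_const
      fun y hy => divSum_le_of_le hY (by linarith [hy.1]) (by linarith [hy.2])
  rw [intervalIntegral.integral_const, smul_eq_mul] at h4
  linarith

lemma abs_divisor_main_sub_le {a b : ℝ} (ha : 1 / 4 ≤ a) (hb : 1 / 4 ≤ b) {B : ℝ} (haB : a ≤ B)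
    (hbB : b ≤ B) :
    |a * (Real.log a + 2 * Real.eulerMascheroniConstant - 1) -
      b * (Real.log b + 2 * Real.eulerMascheroniConstant - 1)| ≤ (B + 4) * |a - b| := by
  have hd : ∀ x ∈ Set.Icc (1 / 4) B,
      HasDerivWithinAt (fun x : ℝ => x * (Real.log x + 2 * Real.eulerMascheroniConstant - 1))
        (Real.log x + 2 * Real.eulerMascheroniConstant) (Set.Icc (1 / 4) B) x := fun x hx => by
    have hx0 : x ≠ 0 := by linarith [hx.1]
    refine (((hasDerivAt_id' x).fun_mul (((Real.hasDerivAt_log hx0).add_const _).sub_const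
      1)).congr_deriv ?_).hasDerivWithinAt
    field_simp
    ring
  have hbd : ∀ x ∈ Set.Icc (1 / 4) B,
      ‖Real.log x + 2 * Real.eulerMascheroniConstant‖ ≤ B + 4 := fun x hx => by
    have hx0 : 0 < x := by linarith [hx.1]
    have h1 := Real.one_half_lt_eulerMascheroniConstant
    have h2 := Real.eulerMascheroniConstant_lt_two_thirds
    have h3 := Real.log_le_sub_one_of_pos hx0
    have h4 := Real.one_sub_inv_le_log_of_pos hx0
    have h5 : x⁻¹ ≤ 4 := by
      rw [inv_le_comm₀ hx0 (by norm_num)]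
      linarith [hx.1]
    rw [Real.norm_eq_abs, abs_le]
    constructor <;> linarith [hx.2, hx.1]
  exact (convex_Icc (1 / 4 : ℝ) B).norm_image_sub_le_of_norm_hasDerivWithin_le hd hbd ⟨hb, hbB⟩
    ⟨ha, haB⟩

/-- The error term in the divisor problem, at a square and normalized. -/
noncomputable def normDelta (y : ℝ) : ℝ := (√y)⁻¹ * dirichletDelta (y ^ 2)

lemma measurable_normDelta : Measurable normDelta :=
  (by fun_prop : Measurable fun y : ℝ => (√y)⁻¹).mul
    (measurable_dirichletDelta.comp (by fun_prop))

lemma abs_dirichletDelta_sq_le (hy : 1 ≤ y) : |dirichletDelta (y ^ 2)| ≤ 8 * y := by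
  have := abs_dirichletDelta_le (x := y ^ 2) (by nlinarith)
  rwa [Real.sqrt_sq (by linarith)] at this

lemma abs_normDelta_sub_le (hh : 0 ≤ h) (hh' : h ≤ 1 / 2) (hy : 1 ≤ y) (hyY : y ≤ Y) {s : ℝ}
    (hs : s ∈ Set.Icc (-1 : ℝ) 1) :
    |normDelta y - normDelta (y + h * s)| ≤ 2 * divJump h y + 64 * h * Y ^ 3 := by
  have hY : 1 ≤ Y := hy.trans hyY
  set t := y + h * s with ht
  have ht1 : y - h ≤ t := by nlinarith [hs.1]
  have ht2 : t ≤ y + h := by nlinarith [hs.2]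
  have htpos : 1 / 2 ≤ t := by linarith
  have hyt : |y - t| ≤ h := abs_le.2 ⟨by linarith, by linarith⟩
  have e : normDelta y - normDelta t = (√t)⁻¹ * (dirichletDelta (y ^ 2) - dirichletDelta (t ^ 2)) +
      ((√y)⁻¹ - (√t)⁻¹) * dirichletDelta (y ^ 2) := by
    rw [normDelta, normDelta]; ring
  have hst : 1 / 2 ≤ √t := Real.le_sqrt_of_sq_le (by linarith)
  have hsy : 1 ≤ √y := Real.one_le_sqrt.2 hy
  have b1 : (√t)⁻¹ ≤ 2 := by
    rw [inv_le_comm₀ (by linarith) (by norm_num)]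
    linarith
  have b2 : |(√y)⁻¹ - (√t)⁻¹| ≤ 2 * h := by
    have q1 := Real.sq_sqrt (by linarith : 0 ≤ t)
    have q2 := Real.sq_sqrt (by linarith : 0 ≤ y)
    have e2 : (√y)⁻¹ - (√t)⁻¹ = (√t - √y) / (√y * √t) := by field_simp
    have e3 : |√t - √y| * (√t + √y) = |t - y| := by
      rw [← abs_of_pos (by linarith : 0 < √t + √y), ← abs_mul]
      congr 1
      linarith
    have e4 : |√t - √y| ≤ h := by
      have : |t - y| ≤ h := by rwa [abs_sub_comm]
      nlinarith [abs_nonneg (√t - √y)]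
    rw [e2, abs_div, abs_of_pos (by positivity : 0 < √y * √t), div_le_iff₀ (by positivity)]
    have : 1 / 2 ≤ √y * √t := by nlinarith
    nlinarith
  have b3 : |divSum y - divSum t| ≤ divJump h y := by
    have m1 := divSum_monotoneOn (a := y - h) (b := y) (by simp only [Set.mem_Ici]; linarith)
      (by simp only [Set.mem_Ici]; linarith) (by linarith)
    have m2 := divSum_monotoneOn (a := y) (b := y + h) (by simp only [Set.mem_Ici]; linarith)
      (by simp only [Set.mem_Ici]; linarith) (by linarith)
    have m3 := divSum_monotoneOn (a := y - h) (b := t) (by simp only [Set.mem_Ici]; linarith)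
      (by simp only [Set.mem_Ici]; linarith) ht1
    have m4 := divSum_monotoneOn (a := t) (b := y + h) (by simp only [Set.mem_Ici]; linarith)
      (by simp only [Set.mem_Ici]; linarith) ht2
    rw [divJump, abs_le]
    constructor <;> linarith
  have b4 := abs_divisor_main_sub_le (a := y ^ 2) (b := t ^ 2) (by nlinarith) (by nlinarith)
    (B := (2 * Y) ^ 2) (by nlinarith) (by nlinarith)
  have b5 : |y ^ 2 - t ^ 2| ≤ 3 * h * Y := by
    rw [sq_sub_sq, abs_mul, abs_of_pos (by linarith : 0 < y + t)]
    nlinarith [abs_nonneg (y - t)]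
  have b6 : ((2 * Y) ^ 2 + 4) * |y ^ 2 - t ^ 2| ≤ 24 * h * Y ^ 3 := by
    have : (2 * Y) ^ 2 + 4 ≤ 8 * Y ^ 2 := by nlinarith
    calc _ ≤ 8 * Y ^ 2 * (3 * h * Y) := by gcongr
      _ = _ := by ring
  have b7 : |dirichletDelta (y ^ 2) - dirichletDelta (t ^ 2)| ≤ divJump h y + 24 * h * Y ^ 3 := by
    have e5 : dirichletDelta (y ^ 2) - dirichletDelta (t ^ 2) = (divSum y - divSum t) -
      (y ^ 2 * (Real.log (y ^ 2) + 2 * Real.eulerMascheroniConstant - 1) -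
      t ^ 2 * (Real.log (t ^ 2) + 2 * Real.eulerMascheroniConstant - 1)) := by
      rw [dirichletDelta, dirichletDelta, divSum, divSum]; ring
    rw [e5]
    exact (abs_sub _ _).trans (add_le_add b3 (b4.trans b6))
  have b8 := abs_dirichletDelta_sq_le hy
  rw [e]
  refine (abs_add_le _ _).trans ?_
  rw [abs_mul, abs_mul, abs_of_pos (inv_pos.2 (by linarith : 0 < √t))]
  have b9 := mul_le_mul b1 b7 (abs_nonneg _) (by norm_num)
  have b10 := mul_le_mul b2 b8 (abs_nonneg _) (by linarith)
  have b11 : 2 * h * (8 * y) ≤ 16 * h * Y ^ 3 := by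
    have : y ≤ Y ^ 3 := hyY.trans (le_self_pow₀ hY (by norm_num))
    nlinarith
  linarith

lemma IsMollifier.abs_normDelta_sub_average_le (hρ : IsMollifier ρ) (hh : 0 ≤ h) (hh' : h ≤ 1 / 2)
    (hy : 1 ≤ y) (hyY : y ≤ Y) :
    |normDelta y - ∫ s, ρ s * normDelta (y + h * s)| ≤ 2 * divJump h y + 64 * h * Y ^ 3 := by
  set B := 2 * divJump h y + 64 * h * Y ^ 3 with hB
  have hd : ∀ s ∈ Set.Icc (-1 : ℝ) 1, |normDelta y - normDelta (y + h * s)| ≤ B := fun s hs =>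
    abs_normDelta_sub_le hh hh' hy hyY hs
  have hi : MeasureTheory.Integrable fun s => ρ s * normDelta (y + h * s) := by
    have hm : Measurable fun s => normDelta (y + h * s) :=
      measurable_normDelta.comp (by fun_prop)
    refine MeasureTheory.Integrable.mono' (hρ.integrable.mul_const (|normDelta y| + B))
      (hρ.smooth.continuous.measurable.mul hm).aestronglyMeasurable
        (Eventually.of_forall fun s => ?_)
    rw [norm_mul, Real.norm_of_nonneg (hρ.nonneg s)]
    refine hρ.mul_le_mul fun hs => ?_
    have h1 := hd s hs
    have h2 := abs_sub_abs_le_abs_sub (normDelta (y + h * s)) (normDelta y)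
    rw [abs_sub_comm] at h1
    rw [Real.norm_eq_abs]
    linarith
  have e : normDelta y - ∫ s, ρ s * normDelta (y + h * s) =
      ∫ s, ρ s * (normDelta y - normDelta (y + h * s)) := by
    simp only [mul_sub]
    rw [MeasureTheory.integral_sub (hρ.integrable.mul_const _) hi, MeasureTheory.integral_mul_const,
      hρ.integral_eq_one, one_mul]
  rw [e]
  exact hρ.abs_integral_mul_le hd

end Smoothing

section Assembly

variable {ρ : ℝ → ℝ} {h Y : ℝ}

lemma qroot_pow_eq_rpow (n k : ℕ) : qroot n ^ k = (n : ℝ) ^ ((k : ℝ) / 4) := by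
  rw [qroot, Real.sqrt_eq_rpow, Real.sqrt_eq_rpow, ← Real.rpow_mul (by positivity),
    ← Real.rpow_natCast, ← Real.rpow_mul (by positivity)]
  congr 1
  ring

lemma summable_dR_sq_div_qroot {k : ℕ} (hk : 5 ≤ k) :
    Summable fun n : ℕ => dR n ^ 2 / qroot n ^ k := by
  have hk' : (5 : ℝ) ≤ k := by exact_mod_cast hk
  refine (summable_dR_sq (by linarith : (1 : ℝ) < (k : ℝ) / 4)).congr fun n => ?_
  rw [qroot_pow_eq_rpow, Real.rpow_neg (by positivity), ← div_eq_mul_inv]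

lemma IsMollifier.exists_abs_sum_vcoef_sq_sub_le (hρ : IsMollifier ρ) :
    ∃ C, 0 ≤ C ∧ ∀ h : ℝ, 0 ≤ h → ∀ N : ℕ, N ≠ 0 →
      |∑ n ∈ Finset.Icc 1 N, vcoef ρ h n ^ 2 - (∑' n : ℕ, dR n ^ 2 / qroot n ^ 6) / (2 * π ^ 2)| ≤
        C * (√(4 * π * h) + (qroot N)⁻¹) := by
  have hs5 := summable_dR_sq_div_qroot (k := 5) le_rfl
  have hs6 := summable_dR_sq_div_qroot (k := 6) (by norm_num)
  have hq5 : ∀ n : ℕ, 0 ≤ dR n ^ 2 / qroot n ^ 5 := fun n =>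
    div_nonneg (sq_nonneg _) (pow_nonneg (qroot_nonneg n) 5)
  refine ⟨∑' n : ℕ, dR n ^ 2 / qroot n ^ 5, tsum_nonneg hq5, fun h hh N hN => ?_⟩
  have hqN := qroot_pos hN
  have hp : HasSum (fun n => if n ∈ Finset.Icc 1 N then vcoef ρ h n ^ 2 else 0)
      (∑ n ∈ Finset.Icc 1 N, vcoef ρ h n ^ 2) := by
    rw [← Finset.sum_extend_by_zero]
    exact hasSum_sum_of_ne_finset_zero fun n hn => if_neg hn
  have hd := hp.sub (hs6.hasSum.div_const (2 * π ^ 2))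
  have hb : ∀ n : ℕ, ‖(if n ∈ Finset.Icc 1 N then vcoef ρ h n ^ 2 else 0) -
      dR n ^ 2 / qroot n ^ 6 / (2 * π ^ 2)‖ ≤
      (√(4 * π * h) + (qroot N)⁻¹) * (dR n ^ 2 / qroot n ^ 5) := fun n => by
    rcases eq_or_ne n 0 with rfl | hn0
    · simp [dR]
    have hq := qroot_pos hn0
    have hpi : 1 ≤ 2 * π ^ 2 := by nlinarith [Real.pi_gt_three]
    have h65 : dR n ^ 2 / qroot n ^ 6 = (qroot n)⁻¹ * (dR n ^ 2 / qroot n ^ 5) := by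
      field_simp
    have h6 : 0 ≤ dR n ^ 2 / qroot n ^ 6 := by positivity
    have hs0 := Real.sqrt_nonneg (4 * π * h)
    rw [Real.norm_eq_abs]
    split_ifs with hn
    · have e : vcoef ρ h n ^ 2 - dR n ^ 2 / qroot n ^ 6 / (2 * π ^ 2) =
          -(1 - mollCos ρ (4 * π * √n * h) ^ 2) * (dR n ^ 2 / qroot n ^ 6) / (2 * π ^ 2) := by
        rw [vcoef, mul_pow, div_pow, mul_pow, mul_pow, Real.sq_sqrt zero_le_two]
        field_simp
        ring
      have h1 := hρ.abs_one_sub_mollCos_sq_le (by positivity : 0 ≤ 4 * π * √n * h)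
      have h2 : √(4 * π * √n * h) = √(4 * π * h) * qroot n := by
        rw [qroot, ← Real.sqrt_mul (by positivity)]
        congr 1
        ring
      rw [e, abs_div, abs_mul, abs_neg, abs_of_nonneg h6,
        abs_of_nonneg (by positivity : 0 ≤ 2 * π ^ 2)]
      refine (div_le_self (by positivity) hpi).trans ?_
      calc _ ≤ √(4 * π * h) * qroot n * (dR n ^ 2 / qroot n ^ 6) := by
            rw [← h2]
            exact mul_le_mul_of_nonneg_right h1 h6
        _ = √(4 * π * h) * (dR n ^ 2 / qroot n ^ 5) := by
            rw [h65]
            field_simp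
        _ ≤ _ := mul_le_mul_of_nonneg_right (le_add_of_nonneg_right (by positivity)) (hq5 n)
    · have hNn : N ≤ n := by
        rw [Finset.mem_Icc] at hn
        omega
      have hqle : qroot N ≤ qroot n := by
        unfold qroot
        gcongr
      rw [zero_sub, abs_neg, abs_of_nonneg (by positivity)]
      refine (div_le_self h6 hpi).trans ?_
      rw [h65]
      refine mul_le_mul_of_nonneg_right ?_ (hq5 n)
      have : (qroot n)⁻¹ ≤ (qroot N)⁻¹ := by gcongr
      linarith
  have := hd.tsum_eq ▸ tsum_of_norm_bounded
    (hs5.mul_left (√(4 * π * h) + (qroot N)⁻¹)).hasSum hb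
  rw [tsum_mul_left] at this
  exact this.trans_eq (mul_comm _ _)

lemma intervalIntegrable_of_abs_le {F : ℝ → ℝ} (hF : Measurable F) {B : ℝ} (hY : 1 ≤ Y)
    (hB : ∀ y, 1 ≤ y → y ≤ Y → |F y| ≤ B) : IntervalIntegrable F MeasureTheory.volume 1 Y := by
  refine (intervalIntegrable_const (c := B)).mono_fun' hF.aestronglyMeasurable ?_
  rw [Set.uIoc_of_le hY]
  filter_upwards [MeasureTheory.ae_restrict_mem measurableSet_Ioc] with y hy
  exact hB y hy.1.le hy.2

/-- The mean square of a perturbation `S + c y ^ (-1 / 2) + R` of `S`. -/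
lemma abs_integral_sq_perturb_sub_le {S R : ℝ → ℝ} {c A₁ A₂ A₃ B : ℝ} (hY : 1 ≤ Y)
    (hS : Continuous S)
    (hR : Measurable R) (hRB : ∀ y, 1 ≤ y → y ≤ Y → |R y| ≤ B)
    (h₁ : ∫ y in (1 : ℝ)..Y, 2 * y ^ 2 * R y ^ 2 ≤ A₁ * Y)
    (h₂ : |∫ y in (1 : ℝ)..Y, y ^ ((3 : ℝ) / 2) * S y| ≤ A₂ * Y ^ 2)
    (h₃ : ∫ y in (1 : ℝ)..Y, 2 * y ^ 2 * S y ^ 2 ≤ A₃ * Y ^ 3) :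
    |(∫ y in (1 : ℝ)..Y, 2 * y ^ 2 * (S y + c * (√y)⁻¹ + R y) ^ 2) -
      ∫ y in (1 : ℝ)..Y, 2 * y ^ 2 * S y ^ 2| ≤
      (4 * |c| * A₂ + 3 * A₁ + A₃ + 2 * c ^ 2) * Y ^ 2 := by
  have hY0 : 0 < Y := by linarith
  have iR : IntervalIntegrable R MeasureTheory.volume 1 Y := intervalIntegrable_of_abs_le hR hY hRB
  have iR2 : IntervalIntegrable (fun y => R y ^ 2) MeasureTheory.volume 1 Y :=
    intervalIntegrable_of_abs_le (hR.pow_const 2) hY (B := B ^ 2) fun y h1 h2 => by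
      rw [abs_pow]
      exact pow_le_pow_left₀ (abs_nonneg _) (hRB y h1 h2) 2
  have hsq : ContinuousOn (fun y : ℝ => (√y)⁻¹) (Set.uIcc 1 Y) :=
    ContinuousOn.inv₀ (by fun_prop) fun y hy => by
      rw [Set.uIcc_of_le hY] at hy
      exact (Real.sqrt_pos.2 (by linarith [hy.1])).ne'
  have hp : Continuous fun y : ℝ => y ^ ((3 : ℝ) / 2) := Real.continuous_rpow_const (by norm_num)
  have jS : IntervalIntegrable (fun y => 2 * y ^ 2 * S y ^ 2) MeasureTheory.volume 1 Y :=
    (by fun_prop : Continuous fun y => 2 * y ^ 2 * S y ^ 2).intervalIntegrable _ _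
  have jR : IntervalIntegrable (fun y => 2 * y ^ 2 * R y ^ 2) MeasureTheory.volume 1 Y :=
    iR2.continuousOn_mul (by fun_prop)
  have jc : IntervalIntegrable (fun y => y ^ ((3 : ℝ) / 2) * S y) MeasureTheory.volume 1 Y :=
    (hp.mul hS).intervalIntegrable _ _
  have jE : IntervalIntegrable (fun y => 2 * y ^ 2 * (S y + c * (√y)⁻¹ + R y) ^ 2)
      MeasureTheory.volume 1 Y := by
    have hc : ContinuousOn (fun y => 2 * y ^ 2 * (S y + c * (√y)⁻¹) ^ 2) (Set.uIcc 1 Y) := by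
      fun_prop
    have hc2 : ContinuousOn (fun y => 4 * y ^ 2 * (S y + c * (√y)⁻¹)) (Set.uIcc 1 Y) := by
      fun_prop
    refine ((hc.intervalIntegrable.add (iR.continuousOn_mul hc2)).add jR).congr
      (fun y _ => ?_)
    ring
  have jF : IntervalIntegrable (fun y => 2 * y ^ 2 * (S y + c * (√y)⁻¹ + R y) ^ 2 -
      2 * y ^ 2 * S y ^ 2 - 4 * c * (y ^ ((3 : ℝ) / 2) * S y)) MeasureTheory.volume 1 Y :=
    (jE.sub jS).sub (jc.const_mul (4 * c))
  have eF : ∫ y in (1 : ℝ)..Y, (2 * y ^ 2 * (S y + c * (√y)⁻¹ + R y) ^ 2 -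
      2 * y ^ 2 * S y ^ 2 - 4 * c * (y ^ ((3 : ℝ) / 2) * S y)) =
      (∫ y in (1 : ℝ)..Y, 2 * y ^ 2 * (S y + c * (√y)⁻¹ + R y) ^ 2) -
      (∫ y in (1 : ℝ)..Y, 2 * y ^ 2 * S y ^ 2) -
      4 * c * ∫ y in (1 : ℝ)..Y, y ^ ((3 : ℝ) / 2) * S y := by
    rw [intervalIntegral.integral_sub (jE.sub jS) (jc.const_mul (4 * c)),
      intervalIntegral.integral_sub jE jS, intervalIntegral.integral_const_mul]
  have jG : IntervalIntegrable (fun y => (Y + 2) * (2 * y ^ 2 * R y ^ 2) +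
      Y⁻¹ * (2 * y ^ 2 * S y ^ 2) + 4 * c ^ 2 * y) MeasureTheory.volume 1 Y :=
    ((jR.const_mul _).add (jS.const_mul _)).add
      ((by fun_prop : Continuous fun y : ℝ => 4 * c ^ 2 * y).intervalIntegrable _ _)
  have eG : ∫ y in (1 : ℝ)..Y, ((Y + 2) * (2 * y ^ 2 * R y ^ 2) +
      Y⁻¹ * (2 * y ^ 2 * S y ^ 2) + 4 * c ^ 2 * y) =
      (Y + 2) * (∫ y in (1 : ℝ)..Y, 2 * y ^ 2 * R y ^ 2) +
      Y⁻¹ * (∫ y in (1 : ℝ)..Y, 2 * y ^ 2 * S y ^ 2) + 4 * c ^ 2 * ((Y ^ 2 - 1 ^ 2) / 2) := by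
    rw [intervalIntegral.integral_add ((jR.const_mul _).add (jS.const_mul _))
      ((by fun_prop : Continuous fun y : ℝ => 4 * c ^ 2 * y).intervalIntegrable _ _),
      intervalIntegral.integral_add (jR.const_mul _) (jS.const_mul _),
      intervalIntegral.integral_const_mul, intervalIntegral.integral_const_mul,
      intervalIntegral.integral_const_mul, integral_id]
  have hFG : ‖∫ y in (1 : ℝ)..Y, (2 * y ^ 2 * (S y + c * (√y)⁻¹ + R y) ^ 2 -
      2 * y ^ 2 * S y ^ 2 - 4 * c * (y ^ ((3 : ℝ) / 2) * S y))‖ ≤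
      ∫ y in (1 : ℝ)..Y, ((Y + 2) * (2 * y ^ 2 * R y ^ 2) +
        Y⁻¹ * (2 * y ^ 2 * S y ^ 2) + 4 * c ^ 2 * y) := by
    refine intervalIntegral.norm_integral_le_of_norm_le hY
      (Eventually.of_forall fun y hy => ?_) jG
    have hy0 : 0 < y := by linarith [hy.1]
    have hr : 0 < √y := Real.sqrt_pos.2 hy0
    have e1 : y ^ ((3 : ℝ) / 2) = y ^ 2 * (√y)⁻¹ := by
      rw [Real.sqrt_eq_rpow, ← Real.rpow_neg hy0.le, ← Real.rpow_natCast, ← Real.rpow_add hy0]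
      norm_num
    have e2 : y ^ 2 * ((√y)⁻¹) ^ 2 = y := by
      rw [inv_pow, Real.sq_sqrt hy0.le]
      field_simp
    have e3 : 2 * y ^ 2 * (S y + c * (√y)⁻¹ + R y) ^ 2 - 2 * y ^ 2 * S y ^ 2 -
        4 * c * (y ^ ((3 : ℝ) / 2) * S y) =
        2 * y ^ 2 * (2 * S y * R y) + 2 * y ^ 2 * (c * (√y)⁻¹ + R y) ^ 2 := by
      rw [e1]; ring
    have a1 : |2 * S y * R y| ≤ Y * R y ^ 2 + Y⁻¹ * S y ^ 2 := by
      have t : 0 < √Y := Real.sqrt_pos.2 hY0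
      have t1 : √Y ^ 2 = Y := Real.sq_sqrt hY0.le
      have p1 := sq_nonneg (√Y * R y - (√Y)⁻¹ * S y)
      have p2 := sq_nonneg (√Y * R y + (√Y)⁻¹ * S y)
      have q1 : (√Y * R y - (√Y)⁻¹ * S y) ^ 2 = Y * R y ^ 2 + Y⁻¹ * S y ^ 2 - 2 * S y * R y := by
        rw [sub_sq, mul_pow, mul_pow, inv_pow, t1]
        field_simp
        ring
      have q2 : (√Y * R y + (√Y)⁻¹ * S y) ^ 2 = Y * R y ^ 2 + Y⁻¹ * S y ^ 2 + 2 * S y * R y := by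
        rw [add_sq, mul_pow, mul_pow, inv_pow, t1]
        field_simp
        ring
      rw [abs_le]
      constructor <;> linarith
    have a2 : 2 * y ^ 2 * (c * (√y)⁻¹ + R y) ^ 2 ≤ 4 * c ^ 2 * y + 4 * y ^ 2 * R y ^ 2 := by
      have p := sq_nonneg (c * (√y)⁻¹ - R y)
      have p2 : 2 * y ^ 2 * (c * (√y)⁻¹ + R y) ^ 2 ≤
          2 * y ^ 2 * (2 * c ^ 2 * ((√y)⁻¹) ^ 2 + 2 * R y ^ 2) := by
        gcongr
        linarith
      refine p2.trans_eq ?_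
      linear_combination 4 * c ^ 2 * e2
    rw [e3, Real.norm_eq_abs]
    refine (abs_add_le _ _).trans ?_
    rw [abs_mul, abs_of_pos (by positivity : 0 < 2 * y ^ 2),
      abs_of_nonneg (by positivity : 0 ≤ 2 * y ^ 2 * (c * (√y)⁻¹ + R y) ^ 2)]
    have a3 := mul_le_mul_of_nonneg_left a1 (by positivity : 0 ≤ 2 * y ^ 2)
    linarith
  rw [eF, eG, Real.norm_eq_abs] at hFG
  have hR0 : 0 ≤ ∫ y in (1 : ℝ)..Y, 2 * y ^ 2 * R y ^ 2 :=
    intervalIntegral.integral_nonneg hY fun _ _ => by positivity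
  generalize (∫ y in (1 : ℝ)..Y, 2 * y ^ 2 * (S y + c * (√y)⁻¹ + R y) ^ 2) = IE at *
  generalize (∫ y in (1 : ℝ)..Y, 2 * y ^ 2 * S y ^ 2) = IS at *
  generalize (∫ y in (1 : ℝ)..Y, 2 * y ^ 2 * R y ^ 2) = IR at *
  generalize (∫ y in (1 : ℝ)..Y, y ^ ((3 : ℝ) / 2) * S y) = IC at *
  have b1 : (Y + 2) * IR ≤ 3 * A₁ * Y ^ 2 := by
    calc (Y + 2) * IR ≤ 3 * Y * (A₁ * Y) := by gcongr; linarith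
      _ = _ := by ring
  have b2 : Y⁻¹ * IS ≤ A₃ * Y ^ 2 := by
    rw [inv_mul_le_iff₀ hY0]
    linarith
  have b3 : |4 * c * IC| ≤ 4 * |c| * A₂ * Y ^ 2 := by
    rw [abs_mul, abs_mul, abs_of_pos (by norm_num : (0 : ℝ) < 4), mul_assoc (4 * |c|)]
    gcongr
  have e : IE - IS = (IE - IS - 4 * c * IC) + 4 * c * IC := by ring
  rw [e]
  refine (abs_add_le _ _).trans ?_
  nlinarith [sq_nonneg c]

end Assembly

section MeanSquare

lemma integral_dirichletDelta_sq_eq {Y : ℝ} (hY : 1 ≤ Y) :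
    ∫ x in (1 : ℝ)..Y ^ 2, dirichletDelta x ^ 2 =
      ∫ y in (1 : ℝ)..Y, 2 * y ^ 2 * normDelta y ^ 2 := by
  have himg : (fun y : ℝ => y ^ 2) '' Set.Ioc 1 Y = Set.Ioc 1 (Y ^ 2) := by
    ext x
    constructor
    · rintro ⟨y, ⟨h1, h2⟩, rfl⟩
      exact ⟨by nlinarith, by nlinarith⟩
    · rintro ⟨h1, h2⟩
      refine ⟨√x, ⟨?_, (Real.sqrt_le_left (by linarith)).2 h2⟩, Real.sq_sqrt (by linarith)⟩
      exact Real.lt_sqrt_of_sq_lt (by linarith)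
  have hinj : Set.InjOn (fun y : ℝ => y ^ 2) (Set.Ioc 1 Y) := fun a ha b hb hab =>
    (pow_left_inj₀ (by linarith [ha.1]) (by linarith [hb.1]) two_ne_zero).1 hab
  have key := MeasureTheory.integral_image_eq_integral_abs_deriv_smul measurableSet_Ioc
    (fun y _ => (hasDerivAt_pow 2 y).hasDerivWithinAt) hinj fun x => dirichletDelta x ^ 2
  rw [himg] at key
  rw [intervalIntegral.integral_of_le (by nlinarith), intervalIntegral.integral_of_le hY, key]
  refine MeasureTheory.setIntegral_congr_fun measurableSet_Ioc fun y hy => ?_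
  have hy0 : 0 < y := by linarith [hy.1]
  have hs : (√y)⁻¹ ^ 2 = y⁻¹ := by rw [inv_pow, Real.sq_sqrt hy0.le]
  simp only [smul_eq_mul, normDelta]
  rw [mul_pow, hs, abs_of_pos (by norm_num; exact hy0)]
  field_simp
  norm_num
  ring

lemma exists_abs_integral_normDelta_sq_sub_le :
    ∃ C, 0 ≤ C ∧ ∀ Y : ℝ, 2 ≤ Y →
      |(∫ y in (1 : ℝ)..Y, 2 * y ^ 2 * normDelta y ^ 2) -
        Y ^ 3 / 3 * ((∑' n : ℕ, dR n ^ 2 / qroot n ^ 6) / (2 * π ^ 2))| ≤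
        C * Y ^ 2 * (1 + hR ⌈Y ^ 42⌉₊ ^ 4) := by
  obtain ⟨ρ, hρ⟩ := exists_isMollifier
  obtain ⟨c, C₁, hC₁, hA⟩ := hρ.exists_abs_average_sub_vpoly_le
  obtain ⟨C₂, hC₂, hB⟩ := hρ.exists_abs_sum_vcoef_sq_sub_le
  have hs5 := summable_dR_div_qroot
  have hq5 : ∀ n : ℕ, 0 ≤ dR n / qroot n ^ 5 := fun n =>
    div_nonneg (dR_nonneg n) (pow_nonneg (qroot_nonneg n) 5)
  set K := ∑' n : ℕ, dR n / qroot n ^ 5 with hK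
  have hK0 : 0 ≤ K := tsum_nonneg hq5
  set T := ∑' n : ℕ, dR n ^ 2 / qroot n ^ 6 with hT
  have hT0 : 0 ≤ T := tsum_nonneg fun n => div_nonneg (sq_nonneg _) (pow_nonneg (qroot_nonneg n) 6)
  set A := 64 + 2 * C₁ with hAdef
  have hA0 : 0 ≤ A := by positivity
  set A₁ := 8192 + 4 * A ^ 2 with hA₁
  have hpi := Real.pi_gt_three
  refine ⟨8 * |c| * K + 3 * A₁ + 7 * C₂ + T + 2 * c ^ 2 + 40, by positivity, fun Y hY => ?_⟩
  have hY0 : 0 < Y := by linarith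
  have hY1 : 1 ≤ Y := by linarith
  set h := (Y ^ 10)⁻¹ with hh
  set N := ⌈Y ^ 42⌉₊ with hN
  have hh0 : 0 < h := by positivity
  have hhY : h * Y ^ 10 = 1 := inv_mul_cancel₀ (by positivity)
  have hh2 : h ≤ 1 / 2 := by
    rw [hh, inv_le_comm₀ (by positivity) (by norm_num)]
    have : Y ≤ Y ^ 10 := le_self_pow₀ hY1 (by norm_num)
    linarith
  have hNY : Y ^ 42 ≤ N := Nat.le_ceil _
  have hN0 : N ≠ 0 := (Nat.ceil_pos.2 (by positivity)).ne'
  have hsN : Y ^ 21 ≤ √N := Real.le_sqrt_of_sq_le (by rw [← pow_mul]; exact hNY)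
  have hqN : Y ≤ qroot N :=
    Real.le_sqrt_of_sq_le ((pow_le_pow_right₀ hY1 (by norm_num)).trans hsN)
  set S := vpoly N (vcoef ρ h) with hS
  have hcoef : ∀ n ∈ Finset.Icc 1 N, |vcoef ρ h n| ≤ dR n / qroot n ^ 3 := fun n _ =>
    abs_vcoef_le hρ h n
  set R : ℝ → ℝ := fun y => normDelta y - S y - c * (√y)⁻¹ with hR'
  have hRm : Measurable R := (measurable_normDelta.sub (continuous_vpoly N _).measurable).sub
    (by fun_prop)
  have hRb : ∀ y, 1 ≤ y → y ≤ Y → |R y| ≤ 2 * divJump h y + A / y := fun y h1 h2 => by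
    have hy0 : 0 < y := by linarith
    have a1 := hρ.abs_normDelta_sub_average_le hh0.le hh2 h1 h2
    have a2 := hA h y hh0 hh2 h1 N hN0
    have e : ∫ s, ρ s * ((√(y + h * s))⁻¹ * dirichletDelta ((y + h * s) ^ 2)) =
      ∫ s, ρ s * normDelta (y + h * s) := rfl
    rw [e] at a2
    generalize (∫ s, ρ s * normDelta (y + h * s)) = I at *
    have e2 : R y = (normDelta y - I) + (I - S y - c * (√y)⁻¹) := by rw [hR']; ring
    have a3 : 64 * h * Y ^ 3 ≤ 64 / y := by
      have : h * Y ^ 3 ≤ 1 / y := by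
        rw [le_div_iff₀ hy0]
        calc h * Y ^ 3 * y ≤ h * Y ^ 3 * Y := by gcongr
          _ = h * Y ^ 4 := by ring
          _ ≤ h * Y ^ 10 := by gcongr; norm_num
          _ = 1 := hhY
      calc 64 * h * Y ^ 3 = 64 * (h * Y ^ 3) := by ring
        _ ≤ 64 * (1 / y) := by gcongr
        _ = 64 / y := by ring
    have a4 : C₁ / (h ^ 2 * √N) ≤ C₁ / y := by
      gcongr
      calc y ≤ Y := h2
        _ = (h * Y ^ 10) ^ 2 * Y := by rw [hhY]; ring
        _ = h ^ 2 * Y ^ 21 := by ring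
        _ ≤ h ^ 2 * √N := by gcongr
    have a5 : A / y = 64 / y + C₁ / y + C₁ / y := by rw [hAdef]; ring
    rw [e2]
    refine (abs_add_le _ _).trans ?_
    linarith
  have hRB : ∀ y, 1 ≤ y → y ≤ Y → |R y| ≤ 32 * Y ^ 4 + A := fun y h1 h2 => by
    have a1 := divJump_le hh0.le hh2 h1 h2
    have a2 : A / y ≤ A := div_le_self hA0 h1
    linarith [hRb y h1 h2]
  have h₁ : ∫ y in (1 : ℝ)..Y, 2 * y ^ 2 * R y ^ 2 ≤ A₁ * Y := by
    have jR : IntervalIntegrable (fun y => 2 * y ^ 2 * R y ^ 2) MeasureTheory.volume 1 Y :=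
      intervalIntegrable_of_abs_le (by fun_prop) hY1 (B := 2 * Y ^ 2 * (32 * Y ^ 4 + A) ^ 2)
        fun y h1 h2 => by
          rw [abs_of_nonneg (by positivity), ← sq_abs (R y)]
          have := hRB y h1 h2
          gcongr
    have jJ := intervalIntegrable_divJump hh0.le hh2 hY1
    have i1 := integral_divJump_le hh0.le hh2 hY1
    have i2 : ∫ y in (1 : ℝ)..Y, 2 * y ^ 2 * R y ^ 2 ≤
        ∫ y in (1 : ℝ)..Y, (256 * Y ^ 6 * divJump h y + 4 * A ^ 2) := by
      refine intervalIntegral.integral_mono_on hY1 jR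
        ((jJ.const_mul _).add intervalIntegrable_const) fun y hy => ?_
      have hy0 : 0 < y := by linarith [hy.1]
      have b1 := hRb y hy.1 hy.2
      have b2 := divJump_le hh0.le hh2 hy.1 hy.2
      have b3 := divJump_nonneg hh0.le (by linarith [hy.1] : h ≤ y)
      generalize divJump h y = J at *
      have b4 : R y ^ 2 ≤ (2 * J + A / y) ^ 2 := by
        rw [← sq_abs (R y)]
        exact pow_le_pow_left₀ (abs_nonneg _) b1 2
      have b5 : (2 * J + A / y) ^ 2 ≤ 8 * J ^ 2 + 2 * (A / y) ^ 2 := by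
        linarith [sq_nonneg (2 * J - A / y)]
      have b6 : J ^ 2 ≤ 16 * Y ^ 4 * J := by nlinarith
      calc 2 * y ^ 2 * R y ^ 2 ≤ 2 * y ^ 2 * (8 * J ^ 2 + 2 * (A / y) ^ 2) := by
            gcongr
            exact b4.trans b5
        _ = 16 * y ^ 2 * J ^ 2 + 4 * A ^ 2 := by
            field_simp
            ring
        _ ≤ 16 * Y ^ 2 * (16 * Y ^ 4 * J) + 4 * A ^ 2 := by
            have := hy.2
            gcongr
        _ = _ := by ring
    rw [intervalIntegral.integral_add (jJ.const_mul _) intervalIntegrable_const,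
      intervalIntegral.integral_const_mul, intervalIntegral.integral_const, smul_eq_mul] at i2
    have i3 : 256 * Y ^ 6 * (∫ y in (1 : ℝ)..Y, divJump h y) ≤ 8192 * Y := by
      calc _ ≤ 256 * Y ^ 6 * (32 * h * Y ^ 4) := by gcongr
        _ = 8192 * (h * Y ^ 10) := by ring
        _ ≤ 8192 * Y := by rw [hhY]; gcongr
    rw [hA₁]
    nlinarith [sq_nonneg A]
  have h₂ : |∫ y in (1 : ℝ)..Y, y ^ ((3 : ℝ) / 2) * S y| ≤ 2 * K * Y ^ 2 := by
    refine (abs_integral_rpow_mul_vpoly_le N (vcoef ρ h) (by norm_num) hY1).trans ?_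
    have b1 : ∑ n ∈ Finset.Icc 1 N, |vcoef ρ h n| / √n ≤ K := by
      refine le_trans (Finset.sum_le_sum fun n hn => ?_)
        (hs5.sum_le_tsum (Finset.Icc 1 N) fun n _ => hq5 n)
      rw [show qroot n ^ 5 = qroot n ^ 3 * qroot n ^ 2 by ring, ← div_div, qroot_sq]
      have := hcoef n hn
      gcongr
    have b2 : Y ^ ((3 : ℝ) / 2) ≤ Y ^ 2 := by
      rw [← Real.rpow_natCast]
      exact Real.rpow_le_rpow_of_exponent_le hY1 (by norm_num)
    gcongr
  have hsum := hB h hh0.le N hN0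
  have hw : √(4 * π * h) + (qroot N)⁻¹ ≤ 5 / Y := by
    have b1 : √(4 * π * h) ≤ 4 / Y := by
      rw [Real.sqrt_le_left (by positivity), div_pow, le_div_iff₀ (by positivity)]
      calc 4 * π * h * Y ^ 2 ≤ 4 * 4 * h * Y ^ 10 := by
            have := Real.pi_le_four
            gcongr
            norm_num
        _ = 4 ^ 2 := by rw [mul_assoc, hhY]; norm_num
    have b2 : (qroot N)⁻¹ ≤ 1 / Y := by
      rw [one_div]
      gcongr
    calc _ ≤ 4 / Y + 1 / Y := add_le_add b1 b2
      _ = 5 / Y := by ring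
  have hsum' : |∑ n ∈ Finset.Icc 1 N, vcoef ρ h n ^ 2 - T / (2 * π ^ 2)| ≤ 5 * C₂ / Y :=
    hsum.trans ((mul_le_mul_of_nonneg_left hw hC₂).trans_eq (by ring))
  have hmain := abs_integral_vpoly_sq_sub_le hcoef hY1
  have hH0 : 0 ≤ hR N ^ 4 := pow_nonneg (hR_nonneg N) 4
  have hTle : T / (2 * π ^ 2) ≤ T := div_le_self hT0 (by nlinarith)
  have h₃ : ∫ y in (1 : ℝ)..Y, 2 * y ^ 2 * S y ^ 2 ≤ (5 * C₂ + T + 20 * hR N ^ 4) * Y ^ 3 := by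
    have b1 := (abs_le.1 hmain).2
    have b2 := (abs_le.1 hsum').2
    have b3 : 5 * C₂ / Y ≤ 5 * C₂ := div_le_self (by positivity) hY1
    have b4 : Y ^ 3 / 3 * ∑ n ∈ Finset.Icc 1 N, vcoef ρ h n ^ 2 ≤ Y ^ 3 * (5 * C₂ + T) := by
      have : Y ^ 3 / 3 ≤ Y ^ 3 := div_le_self (by positivity) (by norm_num)
      calc _ ≤ Y ^ 3 / 3 * (5 * C₂ + T) := by gcongr; linarith
        _ ≤ _ := by gcongr
    have b5 : 20 * Y ^ 2 * hR N ^ 4 ≤ 20 * Y ^ 3 * hR N ^ 4 := by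
      gcongr
      norm_num
    linarith
  have key := abs_integral_sq_perturb_sub_le (c := c) hY1 (continuous_vpoly N (vcoef ρ h)) hRm hRB
    h₁ h₂ h₃
  have e : ∀ y, S y + c * (√y)⁻¹ + R y = normDelta y := fun y => by rw [hR']; ring
  simp only [← hS, e] at key
  have hcmp : |Y ^ 3 / 3 * ∑ n ∈ Finset.Icc 1 N, vcoef ρ h n ^ 2 - Y ^ 3 / 3 * (T / (2 * π ^ 2))| ≤
      2 * C₂ * Y ^ 2 := by
    rw [← mul_sub, abs_mul, abs_of_pos (by positivity)]
    calc _ ≤ Y ^ 3 / 3 * (5 * C₂ / Y) := by gcongr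
      _ = 5 / 3 * C₂ * Y ^ 2 := by field_simp
      _ ≤ _ := by gcongr; norm_num
  simp only [← hS] at hmain
  generalize (∫ y in (1 : ℝ)..Y, 2 * y ^ 2 * normDelta y ^ 2) = I₀ at *
  generalize (∫ y in (1 : ℝ)..Y, 2 * y ^ 2 * S y ^ 2) = I₁ at *
  generalize ∑ n ∈ Finset.Icc 1 N, vcoef ρ h n ^ 2 = V at *
  have e2 : I₀ - Y ^ 3 / 3 * (T / (2 * π ^ 2)) = (I₀ - I₁) + (I₁ - Y ^ 3 / 3 * V) +
      (Y ^ 3 / 3 * V - Y ^ 3 / 3 * (T / (2 * π ^ 2))) := by ring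
  rw [e2]
  refine (abs_add_three _ _ _).trans ?_
  have hD : 0 ≤ (8 * |c| * K + 3 * A₁ + 7 * C₂ + T + 2 * c ^ 2) * Y ^ 2 * hR N ^ 4 := by positivity
  have hE : 0 ≤ Y ^ 2 := by positivity
  linarith

end MeanSquare

end DivisorMeanSquare

open DivisorMeanSquare in
theorem tong_preissmann_mean_square_divisor :
    (fun X : ℝ => (∫ x in (1 : ℝ)..X, (dirichletDelta x) ^ 2) -
        (1 / (6 * Real.pi ^ 2) *
          ∑' n : ℕ, ((n + 1 : ℕ).divisors.card : ℝ) ^ 2 / ((n + 1 : ℝ) ^ ((3 : ℝ) / 2))) *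
          X ^ ((3 : ℝ) / 2)) =O[atTop]
      (fun X : ℝ => X * Real.log X ^ 4) := by
  obtain ⟨C, hC, hb⟩ := exists_abs_integral_normDelta_sq_sub_le
  have hT : ∑' n : ℕ, ((n + 1 : ℕ).divisors.card : ℝ) ^ 2 / ((n + 1 : ℝ) ^ ((3 : ℝ) / 2)) =
      ∑' n : ℕ, dR n ^ 2 / qroot n ^ 6 := by
    rw [(summable_dR_sq_div_qroot (by norm_num : 5 ≤ 6)).tsum_eq_zero_add]
    have h0 : dR 0 ^ 2 / qroot 0 ^ 6 = 0 := by simp [dR]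
    rw [h0, zero_add]
    refine tsum_congr fun n => ?_
    rw [qroot_pow_eq_rpow, dR]
    push_cast
    norm_num
  refine IsBigO.of_bound (C * (1 + 23 ^ 4)) ?_
  filter_upwards [eventually_ge_atTop (4 : ℝ)] with X hX
  have hX0 : 0 < X := by linarith
  set Y := √X with hY
  have hYX : Y ^ 2 = X := Real.sq_sqrt hX0.le
  have hY2 : 2 ≤ Y := Real.le_sqrt_of_sq_le (by linarith)
  have hpow : X ^ ((3 : ℝ) / 2) = Y ^ 3 := by
    rw [hY, Real.sqrt_eq_rpow, ← Real.rpow_natCast, ← Real.rpow_mul hX0.le]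
    norm_num
  have hlog1 : 1 ≤ Real.log X := by
    rw [Real.le_log_iff_exp_le hX0]
    linarith [Real.exp_one_lt_d9]
  have hlogN : hR ⌈Y ^ 42⌉₊ ≤ 23 * Real.log X := by
    have hY42 : 1 ≤ Y ^ 42 := one_le_pow₀ (by linarith)
    have h1 : (⌈Y ^ 42⌉₊ : ℝ) ≤ X * Y ^ 42 := by
      have := Nat.ceil_lt_add_one (by positivity : 0 ≤ Y ^ 42)
      nlinarith
    have h2 : X * Y ^ 42 = X ^ 22 := by rw [← hYX]; ring
    have h3 := Real.log_le_log (by exact_mod_cast Nat.ceil_pos.2 (by positivity)) (h1.trans_eq h2)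
    rw [Real.log_pow] at h3
    have h4 := hR_le ⌈Y ^ 42⌉₊
    push_cast at h3
    linarith
  have key := hb Y hY2
  rw [← integral_dirichletDelta_sq_eq (by linarith), hYX] at key
  rw [hT, hpow, Real.norm_eq_abs, Real.norm_of_nonneg (by positivity)]
  have e : 1 / (6 * π ^ 2) * (∑' n : ℕ, dR n ^ 2 / qroot n ^ 6) * Y ^ 3 =
      Y ^ 3 / 3 * ((∑' n : ℕ, dR n ^ 2 / qroot n ^ 6) / (2 * π ^ 2)) := by
    field_simp
    ring
  rw [e]
  refine key.trans ?_
  have h1 : hR ⌈Y ^ 42⌉₊ ^ 4 ≤ (23 * Real.log X) ^ 4 := pow_le_pow_left₀ (hR_nonneg _) hlogN 4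
  have h2 : 1 ≤ Real.log X ^ 4 := one_le_pow₀ hlog1
  rw [mul_pow] at h1
  calc C * X * (1 + hR ⌈Y ^ 42⌉₊ ^ 4) ≤ C * X * ((1 + 23 ^ 4) * Real.log X ^ 4) := by
        gcongr
        linarith
    _ = _ := by ring
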